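/- Let a, b be integers with 2 ≤ a ≤ 3600, 2 ≤ b ≤ 3600 and gcd(a,b) = 1, such that neither a nor b is a perfect power (i.e., neither equals m^k for integers m ≥ 1 and k ≥ 2), and let r be a positive integer. If (a,b,r) is not one of (3,2,1), (2,3,5), (2,3,13), (2,5,3), (13,3,10), (91,2,89), then there is at most one pair (x,y) of positive integers with a^x − b^y = r. -/

import Mathlib

namespace Pillai

theorem sum_weights_ge {ι : Type*} [Fintype ι] (w : ι → ℕ) (hw : ∀ k, w k ≤ Fintype.card ι)
    (hinj : ∀ k k', w k < Fintype.card ι → w k = w k' → k = k') :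
    ∑ n ∈ Finset.range (Fintype.card ι), n ≤ ∑ k, w k := by
  classical
  set N := Fintype.card ι with hN
  set A : Finset ι := {k | w k < N} with hA
  have hI : A.image w ⊆ Finset.range N := by
    intro n hn
    obtain ⟨k, hk, rfl⟩ := Finset.mem_image.1 hn
    exact Finset.mem_range.2 (Finset.mem_filter.1 hk).2
  have hAinj : Set.InjOn w A := fun k hk k' _ h => hinj k k' (Finset.mem_filter.1 hk).2 h
  have hcard : (A.image w).card = A.card := Finset.card_image_of_injOn hAinj
  have h1 : ∑ n ∈ A.image w, n = ∑ k ∈ A, w k := Finset.sum_image hAinj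
  have h2 : ∑ k ∈ Aᶜ, w k = Aᶜ.card * N := by
    rw [Finset.sum_congr rfl (g := fun _ => N), Finset.sum_const, smul_eq_mul]
    intro k hk
    have : ¬ w k < N := by simpa [hA] using hk
    exact le_antisymm (hw k) (not_lt.1 this)
  have h3 : ∑ n ∈ Finset.range N \ A.image w, n ≤ (Finset.range N \ A.image w).card * N := by
    rw [← smul_eq_mul]
    exact Finset.sum_le_card_nsmul _ _ _ fun n hn =>
      (Finset.mem_range.1 (Finset.mem_sdiff.1 hn).1).le
  rw [← Finset.sum_sdiff hI, ← Finset.sum_compl_add_sum A, h1, h2]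
  have h4 : (Finset.range N \ A.image w).card = Aᶜ.card := by
    rw [Finset.card_sdiff_of_subset hI, Finset.card_range, Finset.card_compl, hcard]
  rw [h4] at h3
  omega

theorem abs_det_le_prod {ι : Type*} [Fintype ι] [DecidableEq ι] (M : Matrix ι ι ℝ) :
    |M.det| ≤ ∑ σ : Equiv.Perm ι, ∏ k, |M k (σ k)| := by
  rw [← Matrix.det_transpose, Matrix.det_apply]
  refine (Finset.abs_sum_le_sum_abs _ _).trans (Finset.sum_le_sum fun σ _ => ?_)
  rw [Units.smul_def, zsmul_eq_mul, abs_mul, Finset.abs_prod]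
  have : |((Equiv.Perm.sign σ : ℤ) : ℝ)| = 1 := by
    rcases Int.units_eq_one_or (Equiv.Perm.sign σ) with h | h <;> simp [h]
  simp [this]

/-- A determinant whose rows are values of power series at points `x k`, up to errors `η`,
is small. -/
theorem pow_mul_abs_det_le {ι : Type*} [Fintype ι] [DecidableEq ι] (x : ι → ℝ)
    (c : ℕ → ι → ℝ) (η : Matrix ι ι ℝ) (E : ι → ℝ) {ρ : ℝ} (hρ : 1 ≤ ρ)
    (hE : ∀ k j, ∑ n ∈ Finset.range (Fintype.card ι), ρ ^ n * |x k ^ n * c n j|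
      + ρ ^ Fintype.card ι * |η k j| ≤ E j) :
    ρ ^ (∑ n ∈ Finset.range (Fintype.card ι), n) *
      |(Matrix.of fun k j => ∑ n ∈ Finset.range (Fintype.card ι), x k ^ n * c n j + η k j).det|
      ≤ (Fintype.card ι).factorial * ∏ j, E j := by
  set N := Fintype.card ι with hN
  let v : (k : ι) → Fin (N + 1) → ι → ℝ := fun k =>
    Fin.snoc (α := fun _ => ι → ℝ) (fun n : Fin N => fun j => x k ^ (n : ℕ) * c n j) (η k)
  have hv1 : ∀ k (n : Fin (N + 1)) (h : (n : ℕ) < N), v k n = x k ^ (n : ℕ) • c n := by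
    intro k n h
    have : n = Fin.castSucc ⟨n, h⟩ := by ext; simp
    rw [this]; simp only [v, Fin.snoc_castSucc]; ext j; simp
  have hrow : (Matrix.of fun k j => ∑ n ∈ Finset.range N, x k ^ n * c n j + η k j)
      = fun k => ∑ n, v k n := by
    ext k j
    simp [Fin.sum_univ_castSucc, v, Finset.sum_range]
  have hdet : (Matrix.of fun k j => ∑ n ∈ Finset.range N, x k ^ n * c n j + η k j).det
      = ∑ w : ι → Fin (N + 1), Matrix.det (fun k => v k (w k)) := by
    rw [hrow]
    exact MultilinearMap.map_sum (Matrix.detRowAlternating (n := ι) (R := ℝ)).toMultilinearMap v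
  have hterm : ∀ w : ι → Fin (N + 1),
      ρ ^ (∑ n ∈ Finset.range N, n) * |Matrix.det (fun k => v k (w k))| ≤
        ∑ σ : Equiv.Perm ι, ∏ k, ρ ^ (w k : ℕ) * |v k (w k) (σ k)| := by
    intro w
    have hnn : 0 ≤ ∑ σ : Equiv.Perm ι, ∏ k, ρ ^ (w k : ℕ) * |v k (w k) (σ k)| :=
      Finset.sum_nonneg fun σ _ => Finset.prod_nonneg fun k _ => by positivity
    by_cases hinj : ∀ k k', (w k : ℕ) < N → (w k : ℕ) = w k' → k = k'
    · have hs := sum_weights_ge (fun k => (w k : ℕ)) (fun k => Nat.lt_succ_iff.1 (w k).2) hinj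
      calc _ ≤ ρ ^ (∑ k, (w k : ℕ)) * ∑ σ : Equiv.Perm ι, ∏ k, |v k (w k) (σ k)| :=
            mul_le_mul (pow_le_pow_right₀ hρ hs) (abs_det_le_prod fun k => v k (w k))
              (abs_nonneg _) (by positivity)
        _ = _ := by
          rw [Finset.mul_sum]
          refine Finset.sum_congr rfl fun σ _ => ?_
          rw [Finset.prod_mul_distrib, Finset.prod_pow_eq_pow_sum]
    · push Not at hinj
      obtain ⟨k, k', hk, hkk, hne⟩ := hinj
      have : Matrix.det (fun k => v k (w k)) = 0 := by
        have e : w k = w k' := Fin.ext hkk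
        let A : Matrix ι ι ℝ := fun k => if (w k : ℕ) < N then c (w k) else v k (w k)
        have hA : (fun k => v k (w k)) = Matrix.of fun k j =>
            (if (w k : ℕ) < N then x k ^ (w k : ℕ) else 1) * A k j := by
          ext k j
          by_cases h : (w k : ℕ) < N <;> simp [A, h, hv1]
        rw [hA, Matrix.det_mul_column, Matrix.det_zero_of_row_eq hne, mul_zero]
        simp [A, ← e, hk]
      simpa [this] using hnn
  rw [hdet]
  calc _ ≤ ρ ^ (∑ n ∈ Finset.range N, n) * ∑ w : ι → Fin (N + 1),
          |Matrix.det (fun k => v k (w k))| := by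
        gcongr; exact Finset.abs_sum_le_sum_abs _ _
    _ ≤ ∑ w : ι → Fin (N + 1), ∑ σ : Equiv.Perm ι, ∏ k, ρ ^ (w k : ℕ) * |v k (w k) (σ k)| := by
        rw [Finset.mul_sum]; exact Finset.sum_le_sum fun w _ => hterm w
    _ = ∑ σ : Equiv.Perm ι, ∏ k, ∑ n : Fin (N + 1), ρ ^ (n : ℕ) * |v k n (σ k)| := by
        rw [Finset.sum_comm]
        refine Finset.sum_congr rfl fun σ _ => ?_
        rw [Finset.prod_univ_sum, Fintype.piFinset_univ]
    _ ≤ ∑ σ : Equiv.Perm ι, ∏ k, E (σ k) := by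
        refine Finset.sum_le_sum fun σ _ => Finset.prod_le_prod
          (fun k _ => Finset.sum_nonneg fun n _ => by positivity) fun k _ => ?_
        refine le_trans (le_of_eq ?_) (hE k (σ k))
        simp [Fin.sum_univ_castSucc, v, Finset.sum_range]
    _ = _ := by
        simp [Equiv.prod_comp, Fintype.card_perm, hN]

open Polynomial in
/-- The determinant of shifted and twisted polynomials does not vanish identically. -/
theorem exists_det_eval_ne_zero {d : ℕ} (Q : Fin d → ℝ[X]) (hQ : ∀ j, Q j ≠ 0) {β : ℝ}
    (t : Fin d → ℕ) (ht : Function.Injective t) (hβ : 1 < β) (δ : ℝ) :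
    ∃ x : ℝ, (Matrix.of fun i j : Fin d =>
      (Q j).eval (x + (i : ℕ) * δ) * (β ^ t j) ^ (i : ℕ)).det ≠ 0 := by
  have hlim : Filter.Tendsto (fun x : ℝ => (Matrix.of fun i j : Fin d =>
      (Q j).eval (x + (i : ℕ) * δ) / (Q j).eval x * (β ^ t j) ^ (i : ℕ)).det) Filter.atTop
      (nhds (Matrix.vandermonde fun j => β ^ t j).transpose.det) := by
    refine (Continuous.matrix_det continuous_id).continuousAt.tendsto.comp ?_
    refine tendsto_pi_nhds.2 fun i => tendsto_pi_nhds.2 fun j => ?_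
    have : Filter.Tendsto (fun x : ℝ => (Q j).eval (x + (i : ℕ) * δ) / (Q j).eval x)
        Filter.atTop (nhds 1) := by
      have hc := Polynomial.div_tendsto_atTop_leadingCoeff_div_of_degree_eq
        ((Q j).comp (X + C ((i : ℕ) * δ))) (Q j) (by
          rw [← taylor_apply, degree_taylor])
      rw [← taylor_apply, leadingCoeff_taylor,
        div_self (leadingCoeff_ne_zero.2 (hQ j))] at hc
      simpa [taylor_apply] using hc
    simpa [Matrix.vandermonde] using this.mul_const ((β ^ t j) ^ (i : ℕ))
  have hne : (Matrix.vandermonde fun j => β ^ t j).transpose.det ≠ 0 := by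
    rw [Matrix.det_transpose]
    exact Matrix.det_vandermonde_ne_zero_iff.2 fun i j h => ht (pow_right_injective₀
      (zero_lt_one.trans hβ) hβ.ne' h)
  obtain ⟨x, hx⟩ := (hlim.eventually_ne hne).exists
  refine ⟨x, fun h0 => hx ?_⟩
  have : (Matrix.of fun i j : Fin d =>
      (Q j).eval (x + (i : ℕ) * δ) / (Q j).eval x * (β ^ t j) ^ (i : ℕ)) =
      Matrix.of fun i j => ((Q j).eval x)⁻¹ * (Matrix.of fun i j : Fin d =>
        (Q j).eval (x + (i : ℕ) * δ) * (β ^ t j) ^ (i : ℕ)) i j := by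
    ext i j; simp only [Matrix.of_apply]; ring
  rw [this, Matrix.det_mul_row, h0, mul_zero]

open Polynomial in
/-- Zero estimate: an exponential polynomial vanishing on a large grid is trivial. -/
theorem exponential_polynomial_zero_estimate {L K R : ℕ} (Q : Fin L → ℝ[X])
    (hdeg : ∀ j, (Q j).natDegree ≤ K) {β : ℝ} (hβ : 1 < β) (v : ℕ → ℝ) (hv : ∀ s, 0 < v s)
    (δ ε c : ℝ)
    (hdist : ∀ r < R, ∀ s < R, ∀ r' < R, ∀ s' < R,
      c + r * δ + s * ε = c + r' * δ + s' * ε → r = r' ∧ s = s')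
    (hvan : ∀ r < R, ∀ s < R,
      ∑ j, (Q j).eval (c + r * δ + s * ε) * (β ^ r * v s) ^ (j : ℕ) = 0)
    (hLR : L ≤ R) (hcount : L * K < (R - L + 1) * R) : ∀ j, Q j = 0 := by
  classical
  by_contra! hne
  set J : Finset (Fin L) := {j | Q j ≠ 0} with hJ
  set d := J.card with hd
  have hdL : d ≤ L := (Finset.card_le_univ J).trans (by simp)
  have hd0 : 0 < d := Finset.card_pos.2 (by obtain ⟨j, hj⟩ := hne; exact ⟨j, by simp [hJ, hj]⟩)
  let e : Fin d ≃ J := (Finset.equivFin J).symm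
  let D : Matrix (Fin d) (Fin d) ℝ[X] := fun i j =>
    (Q (e j)).comp (X + C ((i : ℕ) * δ)) * C ((β ^ ((e j : Fin L) : ℕ)) ^ (i : ℕ))
  have hDeval : ∀ x : ℝ, D.det.eval x = (Matrix.of fun i j : Fin d =>
      (Q (e j)).eval (x + (i : ℕ) * δ) * (β ^ ((e j : Fin L) : ℕ)) ^ (i : ℕ)).det := by
    intro x
    rw [← coe_evalRingHom, RingHom.map_det]
    congr 1
    ext i j
    change eval x (D i j) = _
    simp [D]
  have hDne : D.det ≠ 0 := by
    obtain ⟨x, hx⟩ := exists_det_eval_ne_zero (fun j : Fin d => Q (e j))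
      (fun j => (Finset.mem_filter.1 (e j).2).2) (β := β) (fun j => ((e j : Fin L) : ℕ))
      (fun i j h => e.injective (Subtype.ext (Fin.ext h))) hβ δ
    intro h0
    exact hx (by rw [← hDeval, h0, eval_zero])
  have hDdeg : D.det.natDegree ≤ d * K := by
    rw [Matrix.det_apply]
    refine natDegree_sum_le_of_forall_le _ _ fun σ _ => ?_
    refine (natDegree_smul_le _ _).trans ((natDegree_prod_le _ _).trans ?_)
    refine (Finset.sum_le_card_nsmul _ _ K fun i _ => ?_).trans (by simp)
    refine natDegree_mul_le.trans ?_
    rw [natDegree_C, add_zero, ← taylor_apply, natDegree_taylor]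
    exact hdeg _
  let g : Fin (R - d + 1) × Fin R → ℝ := fun p => c + (p.1 : ℕ) * δ + (p.2 : ℕ) * ε
  have hg : Function.Injective g := by
    rintro ⟨r, s⟩ ⟨r', s'⟩ h
    obtain ⟨h1, h2⟩ := hdist r (by omega) s s.2 r' (by omega) s' s'.2 h
    exact Prod.ext (Fin.ext h1) (Fin.ext h2)
  refine hDne (eq_zero_of_natDegree_lt_card_of_eval_eq_zero D.det hg ?_ ?_)
  · rintro ⟨r, s⟩
    rw [hDeval]
    refine Matrix.exists_mulVec_eq_zero_iff.1
      ⟨fun j => (β ^ (r : ℕ) * v s) ^ ((e j : Fin L) : ℕ), fun h => ?_, ?_⟩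
    · have := congrFun h ⟨0, hd0⟩
      have hp : 0 < (β ^ (r : ℕ) * v s) ^ ((e ⟨0, hd0⟩ : Fin L) : ℕ) :=
        pow_pos (mul_pos (pow_pos (zero_lt_one.trans hβ) _) (hv _)) _
      exact hp.ne' this
    · ext i
      have h := hvan (r + i) (by omega) s s.2
      rw [← Finset.sum_subset (Finset.subset_univ J) (fun j _ hj => by
        have : Q j = 0 := by simpa [hJ] using hj
        simp [this]), ← Finset.sum_coe_sort, ← e.sum_comp] at h
      rw [Pi.zero_apply, ← h, Matrix.mulVec, dotProduct]
      refine Finset.sum_congr rfl fun j _ => ?_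
      simp only [Matrix.of_apply, g]
      push_cast
      rw [show c + (r : ℕ) * δ + (s : ℕ) * ε + (i : ℕ) * δ = c + ((r : ℕ) + (i : ℕ)) * δ
        + (s : ℕ) * ε by ring]
      ring
  · refine hDdeg.trans_lt ?_
    rw [Fintype.card_prod, Fintype.card_fin, Fintype.card_fin]
    calc d * K ≤ L * K := Nat.mul_le_mul_right _ hdL
      _ < (R - L + 1) * R := hcount
      _ ≤ _ := Nat.mul_le_mul_right _ (by omega)

/-- `f` is given on `[-y, y]` by a power series whose majorant at `y` is at most `E`. -/
def HasMajorant (f : ℝ → ℝ) (y E : ℝ) : Prop :=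
  ∃ a : ℕ → ℝ, (Summable fun n => |a n| * y ^ n) ∧ ∑' n, |a n| * y ^ n ≤ E ∧
    ∀ x, |x| ≤ y → HasSum (fun n => a n * x ^ n) (f x)

namespace HasMajorant

theorem mul {f g : ℝ → ℝ} {y E F : ℝ} (hy : 0 ≤ y) (hf : HasMajorant f y E)
    (hg : HasMajorant g y F) : HasMajorant (fun x => f x * g x) y (E * F) := by
  obtain ⟨a, ha, haE, hfa⟩ := hf
  obtain ⟨b, hb, hbF, hgb⟩ := hg
  have nn : ∀ (a : ℕ → ℝ) n, 0 ≤ |a n| * y ^ n := fun a n => by positivity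
  have ha' : Summable fun n => ‖|a n| * y ^ n‖ := by simpa [abs_of_nonneg hy] using ha
  have hb' : Summable fun n => ‖|b n| * y ^ n‖ := by simpa [abs_of_nonneg hy] using hb
  have key := (summable_norm_sum_mul_antidiagonal_of_summable_norm ha' hb').of_norm
  have le : ∀ n, |∑ p ∈ Finset.HasAntidiagonal.antidiagonal n, a p.1 * b p.2| * y ^ n ≤
      ∑ p ∈ Finset.HasAntidiagonal.antidiagonal n, |a p.1| * y ^ p.1 * (|b p.2| * y ^ p.2) := by
    intro n
    refine (mul_le_mul_of_nonneg_right (Finset.abs_sum_le_sum_abs _ _) (pow_nonneg hy n)).trans ?_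
    rw [Finset.sum_mul]
    refine Finset.sum_le_sum fun p hp => le_of_eq ?_
    rw [abs_mul, ← Finset.HasAntidiagonal.mem_antidiagonal.1 hp, pow_add]
    ring
  have hs := Summable.of_nonneg_of_le (fun n => by positivity) le key
  refine ⟨fun n => ∑ p ∈ Finset.HasAntidiagonal.antidiagonal n, a p.1 * b p.2, hs, ?_, fun x hx => ?_⟩
  · refine (hs.tsum_le_tsum le key).trans ?_
    rw [← tsum_mul_tsum_eq_tsum_sum_antidiagonal_of_summable_norm ha' hb']
    exact mul_le_mul haE hbF (tsum_nonneg (nn b)) ((tsum_nonneg (nn a)).trans haE)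
  · have bd : ∀ (a : ℕ → ℝ), (Summable fun n => |a n| * y ^ n) →
        Summable fun n => ‖a n * x ^ n‖ := fun a ha =>
      Summable.of_nonneg_of_le (fun n => norm_nonneg _) (fun n => by
        rw [norm_mul, norm_pow, Real.norm_eq_abs, Real.norm_eq_abs]; gcongr) ha
    have h1 := tsum_mul_tsum_eq_tsum_sum_antidiagonal_of_summable_norm (bd a ha) (bd b hb)
    have h2 := (summable_norm_sum_mul_antidiagonal_of_summable_norm (bd a ha) (bd b hb)).of_norm
    rw [(hfa x hx).tsum_eq, (hgb x hx).tsum_eq] at h1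
    beta_reduce
    rw [h1]
    refine h2.hasSum.congr_fun fun n => ?_
    rw [Finset.sum_mul]
    refine Finset.sum_congr rfl fun p hp => ?_
    rw [← Finset.HasAntidiagonal.mem_antidiagonal.1 hp, pow_add]
    ring

theorem mono {f : ℝ → ℝ} {y E F : ℝ} (hf : HasMajorant f y E) (h : E ≤ F) :
    HasMajorant f y F := by
  obtain ⟨a, ha, haE, hfa⟩ := hf
  exact ⟨a, ha, haE.trans h, hfa⟩

theorem const (c y : ℝ) : HasMajorant (fun _ => c) y |c| := by
  have h : ∀ x : ℝ, HasSum (fun n => (if n = 0 then c else 0) * x ^ n) c := fun x => by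
    convert hasSum_single 0 (f := fun n => (if n = 0 then c else 0) * x ^ n) ?_ using 1
    · simp
    · intro n hn; simp [hn]
  have h' : HasSum (fun n => |if n = 0 then c else 0| * y ^ n) |c| := by
    convert hasSum_single 0 (f := fun n => |if n = 0 then c else 0| * y ^ n) ?_ using 1
    · simp
    · intro n hn; simp [hn]
  exact ⟨fun n => if n = 0 then c else 0, h'.summable, h'.tsum_eq.le, fun x _ => h x⟩

theorem sub_natCast (t : ℕ) {y : ℝ} : HasMajorant (fun x => x - t) y (y + t) := by
  have key : ∀ c x : ℝ, HasSum (fun n => (if n = 0 then c else if n = 1 then 1 else 0) * x ^ n)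
      (x + c) := fun c x => by
    have h : ∀ n ∉ Finset.range 2,
        (if n = 0 then c else if n = 1 then 1 else 0) * x ^ n = 0 := fun n hn => by
      have : 2 ≤ n := not_lt.1 fun h => hn (Finset.mem_range.2 h)
      simp [show n ≠ 0 by omega, show n ≠ 1 by omega]
    simpa [Finset.sum_range_succ, add_comm] using hasSum_sum_of_ne_finset_zero h
  have h := key t y
  have e : (fun n => |if n = 0 then -(t : ℝ) else if n = 1 then 1 else 0| * y ^ n) =
      fun n => (if n = 0 then (t : ℝ) else if n = 1 then 1 else 0) * y ^ n := by
    ext n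
    split_ifs <;> simp
  refine ⟨fun n => if n = 0 then -(t : ℝ) else if n = 1 then 1 else 0, ?_, ?_, fun x _ => ?_⟩
  · rw [e]; exact h.summable
  · rw [e, h.tsum_eq]
  · simpa [sub_eq_add_neg] using key (-t) x

theorem exp (c y : ℝ) : HasMajorant (fun x => Real.exp (c * x)) y (Real.exp (|c| * y)) := by
  have key : ∀ c x : ℝ, HasSum (fun n : ℕ => c ^ n / n.factorial * x ^ n) (Real.exp (c * x)) := by
    intro c x
    have := NormedSpace.expSeries_div_hasSum_exp (c * x)
    rw [← Real.exp_eq_exp_ℝ] at this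
    exact this.congr_fun fun n => by rw [mul_pow]; ring
  have e : (fun n : ℕ => |c ^ n / n.factorial| * y ^ n) =
      fun n : ℕ => |c| ^ n / n.factorial * y ^ n := by
    ext n; rw [abs_div, abs_pow, Nat.abs_cast]
  exact ⟨fun n => c ^ n / n.factorial, by rw [e]; exact (key |c| y).summable,
    by rw [e, (key |c| y).tsum_eq], fun x _ => key c x⟩

end HasMajorant

/-- The binomial coefficient polynomial. -/
noncomputable def binomialPoly (i : ℕ) : Polynomial ℝ :=
  Polynomial.C ((i.factorial : ℝ)⁻¹) * descPochhammer ℝ i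

theorem natDegree_binomialPoly (i : ℕ) : (binomialPoly i).natDegree = i := by
  rw [binomialPoly, Polynomial.natDegree_C_mul (by positivity), descPochhammer_natDegree]

theorem exists_int_eval_binomialPoly (i : ℕ) (n : ℤ) :
    ∃ z : ℤ, (binomialPoly i).eval (n : ℝ) = z := by
  refine ⟨Ring.choose n i, ?_⟩
  have h := Ring.descPochhammer_eq_factorial_smul_choose n i
  rw [← Polynomial.eval_eq_smeval] at h
  rw [binomialPoly, Polynomial.eval_mul, Polynomial.eval_C, ← descPochhammer_eval_cast, h]
  have : (i.factorial : ℝ) ≠ 0 := by positivity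
  simp [this]

theorem hasMajorant_binomialPoly {y : ℝ} (hy : 0 ≤ y) (i : ℕ) :
    HasMajorant (fun x => (binomialPoly i).eval x) y (∏ t ∈ Finset.range i, (y + t) / (t + 1)) := by
  induction i with
  | zero => simpa [binomialPoly] using HasMajorant.const 1 y
  | succ i ih =>
    have h := (ih.mul hy (HasMajorant.sub_natCast i)).mul hy
      (HasMajorant.const ((i + 1 : ℝ)⁻¹) y)
    rw [Finset.prod_range_succ]
    have e : |((i : ℝ) + 1)⁻¹| = ((i : ℝ) + 1)⁻¹ := abs_of_nonneg (by positivity)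
    rw [e, mul_assoc, ← div_eq_mul_inv] at h
    convert h using 2 with x
    · simp only [binomialPoly, Polynomial.eval_mul, Polynomial.eval_C, descPochhammer_succ_eval,
        Nat.factorial_succ]
      push_cast
      rw [mul_inv]; ring

theorem prod_add_div_le {y : ℝ} (hy : 0 ≤ y) {i K : ℕ} (hi : i ≤ K) (hK : 0 < K) :
    ∏ t ∈ Finset.range i, (y + t) / ((t : ℝ) + 1) ≤ ((y + K) / K) ^ i * Real.exp K := by
  have hK' : (0 : ℝ) < K := by exact_mod_cast hK
  have h1 : ∏ t ∈ Finset.range i, (y + t) ≤ (y + K) ^ i := by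
    calc _ ≤ ∏ t ∈ Finset.range i, (y + K) := Finset.prod_le_prod (fun t _ => by positivity)
          fun t ht => by
            have : t ≤ K := ((Finset.mem_range.1 ht).trans_le hi).le
            have : (t : ℝ) ≤ K := by exact_mod_cast this
            linarith
      _ = _ := by simp
  have h2 : ∏ t ∈ Finset.range i, ((t : ℝ) + 1) = i.factorial := by
    rw [← Finset.prod_range_add_one_eq_factorial]; push_cast; rfl
  have h3 := Real.pow_div_factorial_le_exp (K : ℝ) hK'.le i
  rw [Finset.prod_div_distrib, h2, div_pow]
  calc _ ≤ (y + K) ^ i / i.factorial := by gcongr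
    _ = (y + K) ^ i / (K : ℝ) ^ i * ((K : ℝ) ^ i / i.factorial) := by field_simp
    _ ≤ _ := by gcongr

theorem exists_injective_det_ne_zero {G ι : Type*} [Fintype ι] [DecidableEq ι]
    (A : G → ι → ℝ) (hA : ∀ w : ι → ℝ, (∀ g, ∑ j, A g j * w j = 0) → w = 0) :
    ∃ e : ι → G, Function.Injective e ∧ (Matrix.of fun k j => A (e k) j).det ≠ 0 := by
  have htop : Submodule.span ℝ (Set.range A) = ⊤ := by
    by_contra h
    obtain ⟨f, hf, hle⟩ := Submodule.exists_le_ker_of_lt_top _ (lt_top_iff_ne_top.2 h)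
    refine hf (LinearMap.pi_ext' fun j => LinearMap.ext_ring ?_)
    have hfx : ∀ x : ι → ℝ, f x = ∑ j, x j * f (Pi.single j 1) := fun x => by
      conv_lhs => rw [← Finset.univ_sum_single x]
      rw [map_sum]
      refine Finset.sum_congr rfl fun j _ => ?_
      rw [show Pi.single j (x j) = x j • (Pi.single j 1 : ι → ℝ) by
        rw [← Pi.single_smul]; simp, map_smul, smul_eq_mul]
    have := hA (fun j => f (Pi.single j 1)) fun g => by
      rw [← hfx]; exact hle (Submodule.subset_span ⟨g, rfl⟩)
    simpa using congrFun this j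
  obtain ⟨κ, a, ha, hspan, hli⟩ := exists_linearIndependent' ℝ A
  let B := Module.Basis.mk hli (by rw [hspan, htop])
  let φ : ι ≃ κ := (Pi.basisFun ℝ ι).indexEquiv B
  refine ⟨a ∘ φ, ha.comp φ.injective, ?_⟩
  have : LinearIndependent ℝ (fun k => A (a (φ k))) := hli.comp φ φ.injective
  exact ((Matrix.isUnit_iff_isUnit_det _).1
    (Matrix.linearIndependent_rows_iff_isUnit (A := Matrix.of fun k j => A (a (φ k)) j)|>.1
      this)).ne_zero

theorem HasMajorant.exists_coeff {f : ℝ → ℝ} {y E : ℝ} (hf : HasMajorant f y E) :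
    ∃ a : ℕ → ℝ, ∀ (ρ x : ℝ) (N : ℕ), 1 ≤ ρ → ρ * |x| ≤ y →
      ∑ n ∈ Finset.range N, ρ ^ n * |x ^ n * a n|
        + ρ ^ N * |f x - ∑ n ∈ Finset.range N, x ^ n * a n| ≤ E := by
  obtain ⟨a, ha, haE, hfa⟩ := hf
  refine ⟨a, fun ρ x N hρ hx => ?_⟩
  have hρ0 : 0 < ρ := zero_lt_one.trans_le hρ
  have hxy : |x| ≤ y := by nlinarith [abs_nonneg x]
  have hy : 0 ≤ y := (abs_nonneg x).trans hxy
  have hs := hfa x hxy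
  have hle : ∀ n, ρ ^ n * |x ^ n * a n| ≤ |a n| * y ^ n := fun n => by
    rw [abs_mul, abs_pow, ← mul_assoc, ← mul_pow, mul_comm]
    gcongr
  have ht := (hasSum_nat_add_iff' N).2 hs
  have htail : ρ ^ N * |f x - ∑ n ∈ Finset.range N, x ^ n * a n| ≤
      ∑' n, |a (n + N)| * y ^ (n + N) := by
    have e : ∑ n ∈ Finset.range N, x ^ n * a n = ∑ n ∈ Finset.range N, a n * x ^ n :=
      Finset.sum_congr rfl fun n _ => mul_comm _ _
    have hs2 := (summable_nat_add_iff N).2 ha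
    rw [e, ← ht.tsum_eq, ← abs_of_pos (pow_pos hρ0 N), ← abs_mul, ← tsum_mul_left]
    have hn : ∀ n, ‖ρ ^ N * (a (n + N) * x ^ (n + N))‖ ≤ |a (n + N)| * y ^ (n + N) := fun n => by
      refine le_trans ?_ (hle (n + N))
      rw [norm_mul, Real.norm_eq_abs, Real.norm_eq_abs, abs_of_pos (pow_pos hρ0 N), mul_comm (a _)]
      gcongr
      omega
    have hsn := Summable.of_nonneg_of_le (fun n => norm_nonneg _) hn hs2
    exact (norm_tsum_le_tsum_norm hsn).trans (hsn.tsum_le_tsum hn hs2)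
  calc _ ≤ ∑ n ∈ Finset.range N, |a n| * y ^ n + ∑' n, |a (n + N)| * y ^ (n + N) :=
        add_le_add (Finset.sum_le_sum fun n _ => hle n) htail
    _ = ∑' n, |a n| * y ^ n := ha.sum_add_tsum_nat_add N
    _ ≤ E := haE

/-- Values `f j (x k)` perturbed by relative errors at most `ρ ^ (-N)` have a small determinant. -/
theorem pow_mul_abs_det_perturbed_le {ι : Type*} [Fintype ι] [DecidableEq ι] (f : ι → ℝ → ℝ)
    (x : ι → ℝ) {y ρ : ℝ} (E : ι → ℝ) (hf : ∀ j, HasMajorant (f j) y (E j)) (hρ : 1 ≤ ρ)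
    (hx : ∀ k, ρ * |x k| ≤ y) (ε : ι → ι → ℝ) (hε : ∀ k j, ρ ^ Fintype.card ι * |ε k j| ≤ 1) :
    ρ ^ (∑ n ∈ Finset.range (Fintype.card ι), n) *
      |(Matrix.of fun k j => f j (x k) * (1 + ε k j)).det|
      ≤ (Fintype.card ι).factorial * ∏ j, (2 * E j) := by
  choose a ha using fun j => (hf j).exists_coeff
  set N := Fintype.card ι
  have hM : (Matrix.of fun k j => f j (x k) * (1 + ε k j)) = Matrix.of fun k j =>
      ∑ n ∈ Finset.range N, x k ^ n * a j n + (f j (x k) - ∑ n ∈ Finset.range N, x k ^ n * a j n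
        + f j (x k) * ε k j) := by
    ext k j; simp only [Matrix.of_apply]; ring
  rw [hM]
  refine pow_mul_abs_det_le x (fun n j => a j n) (fun k j => f j (x k)
    - ∑ n ∈ Finset.range N, x k ^ n * a j n + f j (x k) * ε k j) (fun j => 2 * E j) hρ
    fun k j => ?_
  have h1 := ha j ρ (x k) N hρ (hx k)
  have h2 : |f j (x k)| ≤ E j := by simpa using ha j ρ (x k) 0 hρ (hx k)
  have hρN : 0 ≤ ρ ^ N := pow_nonneg (zero_le_one.trans hρ) N
  have h3 : ρ ^ N * |f j (x k) * ε k j| ≤ E j := by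
    rw [abs_mul]
    calc _ = |f j (x k)| * (ρ ^ N * |ε k j|) := by ring
      _ ≤ |f j (x k)| * 1 := by gcongr; exact hε k j
      _ ≤ E j := by rwa [mul_one]
  have h4 := mul_le_mul_of_nonneg_left (abs_add_le (f j (x k)
    - ∑ n ∈ Finset.range N, x k ^ n * a j n) (f j (x k) * ε k j)) hρN
  rw [mul_add] at h4
  change ∑ n ∈ Finset.range N, ρ ^ n * |x k ^ n * a j n| + ρ ^ N * |_| ≤ _
  linarith

/-- A nonzero matrix whose rows become integral after scaling has a determinant bounded below. -/
theorem one_le_prod_mul_abs_det {ι : Type*} [Fintype ι] [DecidableEq ι] (M : Matrix ι ι ℝ)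
    (c : ι → ℝ) (hc : ∀ k, 0 < c k) (hM : ∀ k j, ∃ z : ℤ, c k * M k j = z) (hdet : M.det ≠ 0) :
    1 ≤ (∏ k, c k) * |M.det| := by
  choose z hz using hM
  have h : (∏ k, c k) * M.det = ((Matrix.of z).det : ℤ) := by
    rw [← Matrix.det_mul_column, ← eq_intCast (Int.castRingHom ℝ), RingHom.map_det]
    congr 1
    ext k j
    exact hz k j
  have hpos : 0 < ∏ k, c k := Finset.prod_pos fun k _ => hc k
  rw [← abs_of_pos hpos, ← abs_mul, h, ← Int.cast_abs]
  have : (Matrix.of z).det ≠ 0 := fun h0 => by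
    rw [h0, Int.cast_zero] at h
    exact mul_ne_zero hpos.ne' hdet h
  exact_mod_cast Int.one_le_abs this

theorem eq_zero_of_sum_binomialPoly {K : ℕ} (w : Fin K → ℝ)
    (h : ∑ i : Fin K, Polynomial.C (w i) * binomialPoly i = 0) : w = 0 := by
  let S : Polynomial.Sequence ℝ := ⟨binomialPoly, fun i => by
    have h0 : binomialPoly i ≠ 0 := mul_ne_zero (Polynomial.C_ne_zero.2 (by positivity))
      (monic_descPochhammer ℝ i).ne_zero
    rw [Polynomial.degree_eq_natDegree h0, natDegree_binomialPoly]⟩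
  have hli : LinearIndependent ℝ fun i : Fin K => binomialPoly i :=
    S.linearIndependent.comp (fun i : Fin K => (i : ℕ)) Fin.val_injective
  ext i
  refine Fintype.linearIndependent_iff.1 hli w ?_ i
  simpa [Polynomial.smul_eq_C_mul] using h

/-- The columns of the interpolation matrix are linearly independent. -/
theorem interpolation_columns_independent {l K κ : ℕ} {α β X Y : ℝ} (hβ : 0 < β)
    (hlκ : l ≤ κ)
    (hdist : ∀ r s : ℤ, |r| ≤ 2 * κ → |s| ≤ 2 * κ → r * X + s * Y = 0 → r = 0 ∧ s = 0)
    (hcount : (2 * l + 1) * K < (2 * κ + 1 - (2 * l + 1) + 1) * (2 * κ + 1))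
    (w : Fin (K + 1) × Fin (2 * l + 1) → ℝ)
    (hw : ∀ g : Fin (2 * κ + 1) × Fin (2 * κ + 1), ∑ p : Fin (K + 1) × Fin (2 * l + 1),
      (binomialPoly p.1).eval (((g.1 : ℝ) - κ) * X + ((g.2 : ℝ) - κ) * Y) *
        Real.exp (((p.2 : ℝ) - l) * (((g.1 : ℝ) - κ) * β + ((g.2 : ℝ) - κ) * α)) * w p = 0) :
    w = 0 := by
  let Q : Fin (2 * l + 1) → Polynomial ℝ := fun j =>
    ∑ i : Fin (K + 1), Polynomial.C (w (i, j)) * binomialPoly i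
  have hQ : ∀ j, Q j = 0 := by
    refine exponential_polynomial_zero_estimate (L := 2 * l + 1) (K := K) (R := 2 * κ + 1) Q
      (fun j => ?_) (β := Real.exp β) (Real.one_lt_exp_iff.2 hβ)
      (fun s => Real.exp (-κ * β + ((s : ℝ) - κ) * α)) (fun s => Real.exp_pos _) X Y
      (-κ * (X + Y)) ?_ ?_ (by omega) hcount
    · refine Polynomial.natDegree_sum_le_of_forall_le _ _ fun i _ => ?_
      refine Polynomial.natDegree_mul_le.trans ?_
      rw [Polynomial.natDegree_C, zero_add, natDegree_binomialPoly]
      omega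
    · intro r hr s hs r' hr' s' hs' h
      have := hdist (r - r') (s - s') (by rw [abs_le]; omega) (by rw [abs_le]; omega)
        (by push_cast; linarith)
      omega
    · intro r hr s hs
      have h := hw (⟨r, hr⟩, ⟨s, hs⟩)
      rw [Fintype.sum_prod_type, Finset.sum_comm] at h
      rw [← mul_zero (Real.exp (l * (((r : ℝ) - κ) * β + ((s : ℝ) - κ) * α))), ← h,
        Finset.mul_sum]
      refine Finset.sum_congr rfl fun j _ => ?_
      rw [Polynomial.eval_finsetSum, Finset.sum_mul, Finset.mul_sum]
      refine Finset.sum_congr rfl fun i _ => ?_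
      rw [Polynomial.eval_mul, Polynomial.eval_C, ← Real.exp_nat_mul, ← Real.exp_add,
        ← Real.exp_nat_mul]
      have e1 : Real.exp ((j : ℕ) * (r * β + (-κ * β + ((s : ℝ) - κ) * α))) =
          Real.exp (l * (((r : ℝ) - κ) * β + ((s : ℝ) - κ) * α)) *
          Real.exp (((j : ℕ) - l) * (((r : ℝ) - κ) * β + ((s : ℝ) - κ) * α)) := by
        rw [← Real.exp_add]; ring_nf
      rw [e1, show -(κ : ℝ) * (X + Y) + r * X + s * Y = ((r : ℝ) - κ) * X + ((s : ℝ) - κ) * Y by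
        ring]
      ring
  ext ⟨i, j⟩
  exact congrFun (eq_zero_of_sum_binomialPoly (fun i => w (i, j)) (hQ j)) i

theorem exists_int_exp_mul {a : ℕ} (ha : 0 < a) (l : ℕ) (j r : ℤ) (hj : |j| ≤ l) :
    ∃ z : ℤ, Real.exp (l * |(r : ℝ)| * Real.log a) * Real.exp (j * r * Real.log a) = z := by
  have h : 0 ≤ l * |r| + j * r := by
    have : |j * r| ≤ l * |r| := by rw [abs_mul]; gcongr
    linarith [neg_abs_le (j * r)]
  refine ⟨(a : ℤ) ^ (l * |r| + j * r).toNat, ?_⟩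
  have e : ((l * |r| + j * r).toNat : ℝ) = l * |(r : ℝ)| + j * r := by
    have : ((l * |r| + j * r).toNat : ℤ) = l * |r| + j * r := Int.toNat_of_nonneg h
    exact_mod_cast this
  rw [← Real.exp_add, ← add_mul, ← e, Real.exp_nat_mul, Real.exp_log (by exact_mod_cast ha)]
  push_cast
  rfl

theorem sum_abs_sub_fin (κ : ℕ) :
    ∑ r : Fin (2 * κ + 1), |((r : ℕ) : ℝ) - κ| = κ * (κ + 1) := by
  rw [Fin.sum_univ_eq_sum_range (fun r : ℕ => |(r : ℝ) - κ|) (2 * κ + 1)]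
  induction κ with
  | zero => simp
  | succ κ ih =>
    rw [show 2 * (κ + 1) + 1 = (2 * κ + 1 + 1) + 1 by ring, Finset.sum_range_succ,
      Finset.sum_range_succ']
    have : ∀ r : ℕ, |((r + 1 : ℕ) : ℝ) - ((κ + 1 : ℕ) : ℝ)| = |(r : ℝ) - κ| := fun r => by
      push_cast; ring_nf
    simp only [this, ih]
    push_cast
    rw [abs_of_nonpos (by linarith), abs_of_nonneg (by linarith)]
    ring

/-- The interpolation determinant inequality for a small linear form `X log a - Y log b`. -/
theorem interpolation_determinant_inequality {a b X Y l K κ : ℕ} {ρ H : ℝ} (ha : 0 < a)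
    (hb : 1 < b) (hX : 0 < X) (hlX : 2 * (l * κ) ≤ X) (hlκ : l ≤ κ)
    (hdist : ∀ r s : ℤ, |r| ≤ 2 * κ → |s| ≤ 2 * κ → r * X + s * Y = 0 → r = 0 ∧ s = 0)
    (hcount : (2 * l + 1) * K < (2 * κ + 1 - (2 * l + 1) + 1) * (2 * κ + 1))
    (hρ : 1 ≤ ρ) (hΛ : ρ ^ ((K + 1) * (2 * l + 1)) * |X * Real.log a - Y * Real.log b| ≤ 1)
    (haH : Real.log a ≤ H) (hbH : Real.log b ≤ H)
    (hu : Real.log b / X * (X + Y) ≤ 2 * H) :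
    ρ ^ (∑ n ∈ Finset.range ((K + 1) * (2 * l + 1)), n) ≤
      ((K + 1) * (2 * l + 1)).factorial *
      (∏ p : Fin (K + 1) × Fin (2 * l + 1),
        (2 * (((ρ * (κ * (X + Y)) + (K + 1 : ℕ)) / (K + 1 : ℕ)) ^ (p.1 : ℕ) * Real.exp (K + 1 : ℕ) *
          Real.exp (|((p.2 : ℕ) : ℝ) - l| * (ρ * (2 * κ * H)))))) *
      Real.exp (l * H * (2 * (2 * κ + 1) * (κ * (κ + 1)))) := by
  set α := Real.log a with hα
  set β := Real.log b with hβ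
  have hX0 : (0 : ℝ) < X := by exact_mod_cast hX
  have hY0 : (0 : ℝ) ≤ Y := by positivity
  have hβ0 : 0 < β := Real.log_pos (by exact_mod_cast hb)
  have hα0 : 0 ≤ α := Real.log_natCast_nonneg a
  have hρ0 : 0 < ρ := zero_lt_one.trans_le hρ
  set u := β / X with hu'
  have hu0 : 0 < u := by positivity
  set Λ := X * α - Y * β with hΛ'
  have hΛ1 : |Λ| ≤ 1 := by
    have : 1 ≤ ρ ^ ((K + 1) * (2 * l + 1)) := one_le_pow₀ hρ
    nlinarith [abs_nonneg Λ]
  let x : Fin (2 * κ + 1) × Fin (2 * κ + 1) → ℝ := fun g =>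
    ((g.1 : ℝ) - κ) * X + ((g.2 : ℝ) - κ) * Y
  let θ : Fin (2 * κ + 1) × Fin (2 * κ + 1) → ℝ := fun g =>
    ((g.1 : ℝ) - κ) * β + ((g.2 : ℝ) - κ) * α
  obtain ⟨e, he, hdet⟩ := exists_injective_det_ne_zero
    (fun g (p : Fin (K + 1) × Fin (2 * l + 1)) => (binomialPoly p.1).eval (x g) *
      Real.exp (((p.2 : ℝ) - l) * θ g))
    (interpolation_columns_independent hβ0 hlκ
      (fun r s h1 h2 h => hdist r s h1 h2 (by exact_mod_cast h)) hcount)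
  set M : Matrix (Fin (K + 1) × Fin (2 * l + 1)) (Fin (K + 1) × Fin (2 * l + 1)) ℝ :=
    Matrix.of fun k p => (binomialPoly p.1).eval (x (e k)) * Real.exp (((p.2 : ℝ) - l) * θ (e k))
    with hM
  have hcard : Fintype.card (Fin (K + 1) × Fin (2 * l + 1)) = (K + 1) * (2 * l + 1) := by simp
  have hr : ∀ r : Fin (2 * κ + 1), |((r : ℕ) : ℝ) - κ| ≤ κ := fun r => by
    have : ((r : ℕ) : ℝ) ≤ 2 * κ := by exact_mod_cast (by omega : (r : ℕ) ≤ 2 * κ)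
    rw [abs_le]; constructor <;> linarith [(Nat.cast_nonneg (r : ℕ) : (0 : ℝ) ≤ r)]
  have hj : ∀ j : Fin (2 * l + 1), |((j : ℕ) : ℝ) - l| ≤ l := fun r => by
    have : ((r : ℕ) : ℝ) ≤ 2 * l := by exact_mod_cast (by omega : (r : ℕ) ≤ 2 * l)
    rw [abs_le]; constructor <;> linarith [(Nat.cast_nonneg (r : ℕ) : (0 : ℝ) ≤ r)]
  have hxW : ∀ g, |x g| ≤ κ * (X + Y) := fun g => by
    refine (abs_add_le _ _).trans ?_
    rw [abs_mul, abs_mul, abs_of_pos hX0, abs_of_nonneg hY0, mul_add]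
    gcongr <;> exact hr _
  -- lower bound
  let c : Fin (K + 1) × Fin (2 * l + 1) → ℝ := fun k =>
    Real.exp (l * |((e k).1 : ℝ) - κ| * β) * Real.exp (l * |((e k).2 : ℝ) - κ| * α)
  have hlow : 1 ≤ (∏ k, c k) * |M.det| := by
    refine one_le_prod_mul_abs_det M c (fun k => by positivity) (fun k p => ?_) hdet
    have hjz : |((p.2 : ℕ) : ℤ) - l| ≤ l := by rw [abs_le]; omega
    obtain ⟨z1, h1⟩ := exists_int_exp_mul (zero_lt_one.trans hb) l (((p.2 : ℕ) : ℤ) - l)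
      (((e k).1 : ℕ) - κ : ℤ) hjz
    obtain ⟨z2, h2⟩ := exists_int_exp_mul ha l (((p.2 : ℕ) : ℤ) - l)
      (((e k).2 : ℕ) - κ : ℤ) hjz
    obtain ⟨z3, h3⟩ := exists_int_eval_binomialPoly p.1
      ((((e k).1 : ℕ) - κ : ℤ) * X + (((e k).2 : ℕ) - κ : ℤ) * Y)
    refine ⟨z1 * z2 * z3, ?_⟩
    push_cast at h1 h2 h3 ⊢
    rw [← h1, ← h2, ← h3]
    simp only [M, c, x, θ, Matrix.of_apply]
    rw [mul_add, Real.exp_add, ← mul_assoc (((p.2 : ℕ) : ℝ) - l), ← mul_assoc (((p.2 : ℕ) : ℝ) - l)]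
    ring
  have hc : ∏ k, c k ≤ Real.exp (l * H * (2 * (2 * κ + 1) * (κ * (κ + 1)))) := by
    have h1 : ∀ k, c k ≤ Real.exp (l * H * (|((e k).1 : ℝ) - κ| + |((e k).2 : ℝ) - κ|)) :=
      fun k => by
        change Real.exp _ * Real.exp _ ≤ _
        rw [← Real.exp_add]
        apply Real.exp_le_exp.2
        have : 0 ≤ l * |((e k).1 : ℝ) - κ| := by positivity
        have : 0 ≤ l * |((e k).2 : ℝ) - κ| := by positivity
        nlinarith
    refine (Finset.prod_le_prod (fun k _ => by positivity) fun k _ => h1 k).trans ?_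
    rw [← Real.exp_sum]
    apply Real.exp_le_exp.2
    rw [← Finset.mul_sum]
    have hH : 0 ≤ H := hα0.trans haH
    gcongr
    calc ∑ k, (|((e k).1 : ℝ) - κ| + |((e k).2 : ℝ) - κ|)
        = ∑ g ∈ Finset.univ.image e, (|((g.1 : ℕ) : ℝ) - κ| + |((g.2 : ℕ) : ℝ) - κ|) := by
          rw [Finset.sum_image he.injOn]
      _ ≤ ∑ g : Fin (2 * κ + 1) × Fin (2 * κ + 1),
            (|((g.1 : ℕ) : ℝ) - κ| + |((g.2 : ℕ) : ℝ) - κ|) :=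
          Finset.sum_le_sum_of_subset_of_nonneg (Finset.subset_univ _) fun _ _ _ => by positivity
      _ = 2 * (2 * κ + 1) * (κ * (κ + 1)) := by
          rw [Fintype.sum_prod_type]
          simp only [Finset.sum_add_distrib, Finset.sum_const, Finset.card_univ, Fintype.card_fin,
            sum_abs_sub_fin, nsmul_eq_mul, ← Finset.mul_sum]
          push_cast; ring
  -- upper bound
  let f : Fin (K + 1) × Fin (2 * l + 1) → ℝ → ℝ := fun p t =>
    (binomialPoly p.1).eval t * Real.exp ((((p.2 : ℝ) - l) * u) * t)
  let E : Fin (K + 1) × Fin (2 * l + 1) → ℝ := fun p =>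
    (((ρ * (κ * (X + Y)) + (K + 1 : ℕ)) / (K + 1 : ℕ)) ^ (p.1 : ℕ) * Real.exp (K + 1 : ℕ)) *
          Real.exp (|((p.2 : ℕ) : ℝ) - l| * (ρ * (2 * κ * H)))
  have hf : ∀ p, HasMajorant (f p) (ρ * (κ * (X + Y))) (E p) := fun p => by
    have hy : 0 ≤ ρ * (κ * ((X : ℝ) + Y)) := by positivity
    refine ((((hasMajorant_binomialPoly hy p.1).mono
      (prod_add_div_le hy p.1.2.le (Nat.succ_pos K))).mul hy (HasMajorant.exp _ _)).mono ?_)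
    refine mul_le_mul_of_nonneg_left (Real.exp_le_exp.2 ?_) (by positivity)
    rw [abs_mul, abs_of_pos hu0, mul_assoc]
    refine mul_le_mul_of_nonneg_left ?_ (abs_nonneg _)
    calc u * (ρ * (κ * (X + Y))) = ρ * (κ * (u * (X + Y))) := by ring
      _ ≤ ρ * (κ * (2 * H)) := by gcongr
      _ = _ := by ring
  let ε : Fin (K + 1) × Fin (2 * l + 1) → Fin (K + 1) × Fin (2 * l + 1) → ℝ := fun k p =>
    Real.exp (((p.2 : ℝ) - l) * (((e k).2 : ℝ) - κ) * (Λ / X)) - 1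
  have hε : ∀ k p, ρ ^ Fintype.card (Fin (K + 1) × Fin (2 * l + 1)) * |ε k p| ≤ 1 := fun k p => by
    rw [hcard]
    refine le_trans (mul_le_mul_of_nonneg_left ?_ (pow_nonneg hρ0.le _)) hΛ
    have h1 : |((p.2 : ℝ) - l) * (((e k).2 : ℝ) - κ) * (Λ / X)| ≤ |Λ| / 2 := by
      rw [abs_mul, abs_mul, abs_div, abs_of_pos hX0]
      have h2 : |((p.2 : ℕ) : ℝ) - l| * |(((e k).2 : ℕ) : ℝ) - κ| ≤ l * κ :=
        mul_le_mul (hj _) (hr _) (abs_nonneg _) (by positivity)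
      have h3 : (2 * (l * κ) : ℝ) ≤ X := by exact_mod_cast hlX
      rw [mul_div_assoc', div_le_div_iff₀ hX0 two_pos]
      nlinarith [abs_nonneg Λ]
    have h2 := Real.abs_exp_sub_one_le (x := ((p.2 : ℝ) - l) * (((e k).2 : ℝ) - κ) * (Λ / X))
      (by linarith)
    exact h2.trans (by linarith)
  have hMf : M = Matrix.of fun k p => f p (x (e k)) * (1 + ε k p) := by
    ext k p
    simp only [M, f, ε, Matrix.of_apply, add_sub_cancel]
    rw [mul_assoc, ← Real.exp_add]
    congr 2
    simp only [x, θ, u, Λ]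
    field_simp
    ring
  have hup := pow_mul_abs_det_perturbed_le f (fun k => x (e k)) E hf hρ
    (fun k => mul_le_mul_of_nonneg_left (hxW _) hρ0.le) ε hε
  rw [← hMf, hcard] at hup
  have hP : 0 ≤ ρ ^ (∑ n ∈ Finset.range ((K + 1) * (2 * l + 1)), n) := by positivity
  calc ρ ^ (∑ n ∈ Finset.range ((K + 1) * (2 * l + 1)), n)
      ≤ ρ ^ (∑ n ∈ Finset.range ((K + 1) * (2 * l + 1)), n) * ((∏ k, c k) * |M.det|) :=
        le_mul_of_one_le_right hP hlow
    _ = ρ ^ (∑ n ∈ Finset.range ((K + 1) * (2 * l + 1)), n) * |M.det| * ∏ k, c k := by ring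
    _ ≤ _ := mul_le_mul hup hc (Finset.prod_nonneg fun k _ => by positivity) (by positivity)

theorem log_le_of_le_3600 {a : ℕ} (ha : 0 < a) (ha' : a ≤ 3600) : Real.log a ≤ 8.19 := by
  rw [Real.log_le_iff_le_exp (by exact_mod_cast ha)]
  have h1 : (1.208 : ℝ) ≤ Real.exp 0.19 :=
    le_trans (by norm_num) (Real.quadratic_le_exp_of_nonneg (by norm_num : (0 : ℝ) ≤ 0.19))
  have h2 : (2980.9 : ℝ) ≤ Real.exp 8 := by
    rw [show (8 : ℝ) = (8 : ℕ) * 1 by norm_num, Real.exp_nat_mul]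
    exact le_trans (by norm_num) (pow_le_pow_left₀ (by norm_num) Real.exp_one_gt_d9.le 8)
  rw [show (8.19 : ℝ) = 8 + 0.19 by norm_num, Real.exp_add]
  have h3 : (a : ℝ) ≤ 3600 := by exact_mod_cast ha'
  nlinarith

theorem sum_abs_fin_sub (l : ℕ) (K : ℕ) (c : ℝ) :
    ∑ p : Fin K × Fin (2 * l + 1), |((p.2 : ℕ) : ℝ) - l| * c = K * (l * (l + 1)) * c := by
  rw [Fintype.sum_prod_type]
  simp [← Finset.sum_mul, sum_abs_sub_fin, mul_assoc]

theorem sum_fst_fin (L : ℕ) (K : ℕ) (c : ℝ) :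
    ∑ p : Fin (K + 1) × Fin L, ((p.1 : ℕ) : ℝ) * c = L * ((K + 1) * K / 2) * c := by
  rw [Fintype.sum_prod_type]
  have : ∑ i : Fin (K + 1), ((i : ℕ) : ℝ) = (K + 1) * K / 2 := by
    rw [Fin.sum_univ_eq_sum_range (fun i : ℕ => (i : ℝ)) (K + 1)]
    have h := Finset.sum_range_id_mul_two (K + 1)
    have h' : ((∑ i ∈ Finset.range (K + 1), i : ℕ) : ℝ) * 2 = (K + 1) * K := by
      exact_mod_cast h
    push_cast at h'
    linarith
  simp only [Finset.sum_const, Finset.card_univ, Fintype.card_fin, nsmul_eq_mul]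
  rw [← Finset.mul_sum, ← Finset.sum_mul, this]
  ring

theorem pow_four_mul_le {l : ℕ} (hl : 10 ≤ l) : (l : ℝ) ^ 4 * 100 ≤ 4 ^ l := by
  induction l, hl using Nat.le_induction with
  | base => norm_num
  | succ n hn ih =>
    have : (10 : ℝ) ≤ n := by exact_mod_cast hn
    have h : ((n : ℝ) + 1) ^ 4 ≤ (1.1 * n) ^ 4 := pow_le_pow_left₀ (by linarith) (by linarith) 4
    rw [mul_pow] at h
    rw [pow_succ (4 : ℝ)]
    push_cast
    have : (0 : ℝ) ≤ (n : ℝ) ^ 4 := by positivity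
    norm_num at h
    linarith

/-- The logarithmic form of the interpolation determinant inequality. -/
theorem log_interpolation_inequality {l K N : ℕ} {S : ℕ} {t A B G c : ℝ}
    (hN : N = (K + 1) * (2 * l + 1)) (hA : 0 < A) (hG : Real.log A = G)
    (key : Real.exp t ^ S ≤ N.factorial * (∏ p : Fin (K + 1) × Fin (2 * l + 1),
        (2 * (A ^ (p.1 : ℕ) * Real.exp (K + 1 : ℕ) * Real.exp (|((p.2 : ℕ) : ℝ) - l| * B)))) *
      Real.exp c) :
    S * t ≤ N * Real.log N + (N * (Real.log 2 + (K + 1))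
      + (2 * l + 1) * ((K + 1) * K / 2) * G + (K + 1) * (l * (l + 1)) * B) + c := by
  have hpos : 0 < ∏ p : Fin (K + 1) × Fin (2 * l + 1),
      (2 * (A ^ (p.1 : ℕ) * Real.exp (K + 1 : ℕ) * Real.exp (|((p.2 : ℕ) : ℝ) - l| * B))) :=
    Finset.prod_pos fun p _ => by positivity
  have hfac : (0 : ℝ) < N.factorial := by exact_mod_cast N.factorial_pos
  have h := Real.log_le_log (by positivity) key
  rw [Real.log_pow, Real.log_exp, Real.log_mul (by positivity) (Real.exp_ne_zero _),
    Real.log_mul hfac.ne' hpos.ne', Real.log_exp, Real.log_prod (fun p _ => by positivity)] at h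
  have h1 : Real.log N.factorial ≤ N * Real.log N := by
    rw [← Real.log_pow]
    exact Real.log_le_log hfac (by exact_mod_cast N.factorial_le_pow)
  have h2 : ∑ p : Fin (K + 1) × Fin (2 * l + 1), Real.log
      (2 * (A ^ (p.1 : ℕ) * Real.exp (K + 1 : ℕ) * Real.exp (|((p.2 : ℕ) : ℝ) - l| * B))) =
      N * (Real.log 2 + (K + 1)) + (2 * l + 1) * ((K + 1) * K / 2) * G
        + (K + 1) * (l * (l + 1)) * B := by
    have e : ∀ p : Fin (K + 1) × Fin (2 * l + 1), Real.log
        (2 * (A ^ (p.1 : ℕ) * Real.exp (K + 1 : ℕ) * Real.exp (|((p.2 : ℕ) : ℝ) - l| * B))) =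
        (Real.log 2 + (K + 1)) + ((p.1 : ℕ) : ℝ) * G + |((p.2 : ℕ) : ℝ) - l| * B := fun p => by
      rw [Real.log_mul two_ne_zero (by positivity), Real.log_mul (by positivity) (by positivity),
        Real.log_mul (by positivity) (by positivity), Real.log_exp, Real.log_exp, Real.log_pow, hG]
      push_cast; ring
    simp only [e, Finset.sum_add_distrib, sum_abs_fin_sub, sum_fst_fin]
    rw [hN]
    simp
    ring
  linarith

theorem interpolation_parameters_contradiction {l K N κ : ℕ} {G B D : ℝ} (hl : 10 ≤ l)
    (hNdef : N = (K + 1) * (2 * l + 1)) (hK : K + 1 = 1190 * (2 * l + 1)) (hκ : κ = 35 * l + 17)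
    (hG0 : 0 ≤ G) (hG : G ≤ l * 1.3864) (hB0 : 0 ≤ B)
    (hB : B ≤ 4.9531 * (2 * κ * 8.2)) (hD : D = l * 8.2 * (2 * (2 * κ + 1) * (κ * (κ + 1))))
    (hlog : ((∑ n ∈ Finset.range N, n : ℕ) : ℝ) * 1.6 ≤ N * Real.log N +
      (N * (Real.log 2 + (K + 1)) + (2 * l + 1) * ((K + 1) * K / 2) * G +
        (K + 1) * (l * (l + 1)) * B) + D) : False := by
  have hlog2' := Real.log_two_lt_d9
  have hl10 : (10 : ℝ) ≤ l := by exact_mod_cast hl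
  have hN : N = 1190 * (2 * l + 1) ^ 2 := by rw [hNdef, hK]; ring
  have hKr : (K : ℝ) + 1 = 1190 * (2 * l + 1) := by exact_mod_cast hK
  have hNr : (N : ℝ) = 1190 * (2 * l + 1) ^ 2 := by exact_mod_cast hN
  have hκr : (κ : ℝ) = 35 * l + 17 := by exact_mod_cast hκ
  rw [hκr] at hB hD
  have hS : ((∑ n ∈ Finset.range N, n : ℕ) : ℝ) = N * (N - 1) / 2 := by
    have h := Finset.sum_range_id_mul_two N
    have h' : ((∑ n ∈ Finset.range N, n : ℕ) : ℝ) * 2 = N * (N - 1 : ℕ) := by exact_mod_cast h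
    rw [Nat.cast_pred (by rw [hNdef]; positivity)] at h'
    linarith
  obtain ⟨L, hL⟩ : ∃ L : ℝ, L = 2 * l + 1 := ⟨_, rfl⟩
  have hL21 : 21 ≤ L := by linarith
  have hl' : (l : ℝ) = (L - 1) / 2 := by linarith
  have hNL : (N : ℝ) = 1190 * L ^ 2 := by rw [hNr, hL]
  have hlogN : Real.log N ≤ 6.19 + 2 * L := by
    have h1190 := log_le_of_le_3600 (a := 1190) (by norm_num) (by norm_num)
    have h1 := Real.log_le_sub_one_of_pos (show 0 < L by linarith)
    rw [hNL, Real.log_mul (by norm_num) (by positivity), Real.log_pow]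
    push_cast at h1190 ⊢
    linarith
  have hKL : (K : ℝ) + 1 = 1190 * L := by rw [hKr, hL]
  have hB' : B ≤ 4.9531 * (35 * L * 8.2) := by
    refine hB.trans ?_
    linarith
  have hP1 : N * Real.log N ≤ 1190 * L ^ 2 * (6.19 + 2 * L) := by rw [← hNL]; gcongr
  have hP3 : (2 * (l : ℝ) + 1) * ((K + 1) * K / 2) * G ≤
      L * (1190 * L * (1190 * L) / 2) * (0.6932 * L) := by
    rw [← hL, hKL]
    have : (K : ℝ) ≤ 1190 * L := by linarith
    have : G ≤ 0.6932 * L := by linarith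
    gcongr
  have hP4 : ((K : ℝ) + 1) * (l * (l + 1)) * B ≤
      1190 * L * (L ^ 2 / 4) * (4.9531 * (35 * L * 8.2)) := by
    rw [hKL]
    have : (l : ℝ) * (l + 1) ≤ L ^ 2 / 4 := by
      have : (l : ℝ) * (l + 1) = (L ^ 2 - 1) / 4 := by rw [hl']; ring
      linarith only [this]
    gcongr
  have hP5 : D ≤ L / 2 * 8.2 * (2 * (35 * L) * (1225 * L ^ 2 / 4)) := by
    rw [hD]
    have h1 : 2 * (35 * (l : ℝ) + 17) + 1 = 35 * L := by rw [hl']; ring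
    have h2 : (35 * (l : ℝ) + 17) * (35 * l + 17 + 1) ≤ 1225 * L ^ 2 / 4 := by
      have : (35 * (l : ℝ) + 17) * (35 * l + 17 + 1) = (1225 * L ^ 2 - 1) / 4 := by
        rw [hl']; ring
      linarith only [this]
    rw [h1]
    have : (l : ℝ) ≤ L / 2 := by linarith
    gcongr
  rw [hS, hNL, hKL] at hlog
  rw [hNL] at hP1
  have hP2 : (1190 * L ^ 2 * (Real.log 2 + 1190 * L)) ≤ 1190 * L ^ 2 * (0.7 + 1190 * L) := by
    gcongr; linarith
  rw [hKL] at hP3 hP4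
  have hfin : 1190 * L ^ 2 * (1190 * L ^ 2 - 1) / 2 * 1.6 ≤ 1190 * L ^ 2 * (6.19 + 2 * L) +
    (1190 * L ^ 2 * (0.7 + 1190 * L) + L * (1190 * L * (1190 * L) / 2) * (0.6932 * L) +
      1190 * L * (L ^ 2 / 4) * (4.9531 * (35 * L * 8.2))) +
      L / 2 * 8.2 * (2 * (35 * L) * (1225 * L ^ 2 / 4)) := by
    linarith only [hlog, hP1, hP2, hP3, hP4, hP5]
  have hpos : (0 : ℝ) < L ^ 2 * (1190 * 110 * L ^ 2 - 1190 * 1193 * L - 1190 * 9) := by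
    apply mul_pos (by positivity)
    nlinarith only [hL21]
  have h2 : 0 ≤ L ^ 2 := by positivity
  have h3 : 0 ≤ L ^ 3 := by positivity
  have h4 : 0 ≤ L ^ 4 := by positivity
  linarith only [hfin, hpos, h2, h3, h4]

/-- A lower bound for `|X log a - Y log b|` with parameter `l`. -/
theorem one_lt_exp_mul_linear_form {a b X Y l : ℕ} (ha : 2 ≤ a) (ha' : a ≤ 3600) (hb : 2 ≤ b)
    (hb' : b ≤ 3600) (hl : 10 ≤ l) (hXu : X * Real.log a ≤ 4 ^ (l + 1))
    (hYu : Y * Real.log b ≤ 4 ^ (l + 1)) (hXl : (4 : ℝ) ^ l ≤ 16 * X)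
    (hdist : ∀ r s : ℤ, |r| ≤ 2 * (35 * l + 17) → |s| ≤ 2 * (35 * l + 17) →
      r * X + s * Y = 0 → r = 0 ∧ s = 0) :
    1 < Real.exp (1.6 * (1190 * (2 * l + 1) ^ 2)) * |X * Real.log a - Y * Real.log b| := by
  by_contra! hΛ
  have hlog2 := Real.log_two_gt_d9
  have hlog2' := Real.log_two_lt_d9
  have h4l := pow_four_mul_le hl
  have hl10 : (10 : ℝ) ≤ l := by exact_mod_cast hl
  have hXbig : (2 * l * (35 * l + 17) : ℝ) ≤ X ∧ (100 : ℝ) ≤ X := by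
    have : (100 : ℝ) * l ^ 2 ≤ l ^ 4 := by
      have : (100 : ℝ) ≤ l ^ 2 := by nlinarith only [hl10]
      nlinarith only [this]
    constructor <;> nlinarith only [hl10, this, h4l, hXl]
  have hla := log_le_of_le_3600 (by omega : 0 < a) ha'
  have hlb := log_le_of_le_3600 (by omega : 0 < b) hb'
  have hla2 : Real.log 2 ≤ Real.log a := Real.log_le_log two_pos (by exact_mod_cast ha)
  have hlb2 : Real.log 2 ≤ Real.log b := Real.log_le_log two_pos (by exact_mod_cast hb)
  have hX0 : (0 : ℝ) < X := by linarith
  have hΛ1 : |X * Real.log a - Y * Real.log b| ≤ 1 := by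
    have : 1 ≤ Real.exp (1.6 * (1190 * (2 * l + 1) ^ 2)) := Real.one_le_exp (by positivity)
    exact le_trans (le_mul_of_one_le_left (abs_nonneg _) this) hΛ
  obtain ⟨K, hK⟩ : ∃ K, K + 1 = 1190 * (2 * l + 1) := ⟨1190 * (2 * l + 1) - 1, by omega⟩
  have hKr : (K : ℝ) + 1 = 1190 * (2 * l + 1) := by exact_mod_cast hK
  have hN : (K + 1) * (2 * l + 1) = 1190 * (2 * l + 1) ^ 2 := by rw [hK]; ring
  have key := interpolation_determinant_inequality (a := a) (b := b) (X := X) (Y := Y) (l := l)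
    (K := K) (κ := 35 * l + 17) (ρ := Real.exp 1.6) (H := 8.2) (by omega) (by omega)
    (by exact_mod_cast hX0) (by
      have := hXbig.1
      rw [mul_assoc] at this
      exact_mod_cast this) (by omega)
    (by exact_mod_cast hdist) (by
      rw [show 2 * (35 * l + 17) + 1 - (2 * l + 1) + 1 = 68 * l + 35 by omega,
        show 2 * (35 * l + 17) + 1 = 35 * (2 * l + 1) by ring]
      nlinarith only [hN])
    (Real.one_le_exp (by norm_num))
    (by
      rw [← Real.exp_nat_mul, hN]
      refine le_trans (le_of_eq ?_) hΛ
      push_cast; ring_nf) (by linarith) (by linarith)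
    (by
      have : Real.log b / X * (X + Y) = Real.log b + Real.log a
          - (X * Real.log a - Y * Real.log b) / X := by field_simp; ring
      have h2 : |(X * Real.log a - Y * Real.log b) / X| ≤ 0.01 := by
        rw [abs_div, abs_of_pos hX0, div_le_iff₀ hX0]; linarith [hXbig.2]
      have := neg_abs_le ((X * Real.log a - Y * Real.log b) / X)
      linarith)
  obtain ⟨κ, hκ⟩ : ∃ κ, κ = 35 * l + 17 := ⟨_, rfl⟩
  rw [← hκ] at key
  obtain ⟨G, hG⟩ : ∃ G, Real.log ((Real.exp 1.6 * (κ * (X + Y)) + (K + 1 : ℕ)) / (K + 1 : ℕ)) = G :=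
    ⟨_, rfl⟩
  generalize hNdef : (K + 1) * (2 * l + 1) = N at key
  have hρ5 : Real.exp 1.6 ≤ 4.9531 := by
    have h1 : Real.exp 1.6 ^ 5 ≤ 4.9531 ^ 5 := by
      rw [← Real.exp_nat_mul, show ((5 : ℕ) : ℝ) * 1.6 = (8 : ℕ) * 1 by norm_num,
        Real.exp_nat_mul]
      exact (pow_le_pow_left₀ (Real.exp_pos 1).le Real.exp_one_lt_d9.le 8).trans (by norm_num)
    exact le_of_pow_le_pow_left₀ (by norm_num) (by norm_num) h1
  have hG' : G ≤ l * 1.3864 := by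
    have hXu' : (X : ℝ) * 0.693 ≤ 4 ^ (l + 1) := by
      nlinarith only [hX0, hla2, hlog2, hXu]
    have hYu' : (Y : ℝ) * 0.693 ≤ 4 ^ (l + 1) := by
      have : (0 : ℝ) ≤ Y := by positivity
      nlinarith only [this, hlb2, hlog2, hYu]
    have h1 : Real.log (4 ^ l) = l * (2 * Real.log 2) := by
      rw [Real.log_pow, show (4 : ℝ) = 2 ^ 2 by norm_num, Real.log_pow]; push_cast; ring
    have h2 : G ≤ Real.log (4 ^ l) := by
      rw [← hG, hκ]
      refine Real.log_le_log (by positivity) ?_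
      rw [div_le_iff₀ (by positivity)]
      push_cast
      rw [hKr]
      have h3 : (1000 : ℝ) ≤ 4 ^ l := by linarith [pow_le_pow_left₀ (by norm_num) hl10 4]
      have h4 : Real.exp 1.6 * ((35 * l + 17) * (X + Y)) ≤
          4.9531 * ((35 * l + 17.5) * (8 * 4 ^ l / 0.693)) := by
        have : (X + Y : ℝ) ≤ 8 * 4 ^ l / 0.693 := by
          rw [le_div_iff₀ (by norm_num)]; rw [pow_succ] at hXu' hYu'; linarith
        gcongr
        norm_num
      have h5 : (2 * (l : ℝ) + 1) * 1000 ≤ (2 * l + 1) * 4 ^ l := by gcongr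
      have h6 : (0 : ℝ) ≤ (2 * l + 1) * 4 ^ l := by positivity
      have h7 : (4.9531 : ℝ) * ((35 * l + 17.5) * (8 * 4 ^ l / 0.693)) =
          4.9531 * 17.5 * 8 / 0.693 * ((2 * l + 1) * 4 ^ l) := by ring
      rw [h7] at h4
      norm_num at h4
      linarith
    rw [h1] at h2
    nlinarith only [h2, hl10, hlog2']
  have hpos : 0 < (Real.exp 1.6 * (κ * (X + Y)) + (K + 1 : ℕ)) / (K + 1 : ℕ) := by positivity
  have hlog := log_interpolation_inequality hNdef.symm hpos hG key
  refine interpolation_parameters_contradiction hl hNdef.symm hK hκ ?_ hG'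
    (by positivity) ?_ rfl hlog
  · rw [← hG]
    refine Real.log_nonneg ?_
    rw [le_div_iff₀ (by positivity)]
    have : 0 ≤ Real.exp 1.6 * (κ * (X + Y)) := by positivity
    linarith
  · gcongr

/-- Boolean conjunction, written with a recursor so that the kernel evaluates it lazily. -/
noncomputable def band (x y : Bool) : Bool := Bool.rec false y x

/-- Choice between two numbers. -/
noncomputable def nif (c : Bool) (x y : ℕ) : ℕ := Bool.rec y x c

/-- Application of `k` to `x` that makes the kernel evaluate `x` first. -/
noncomputable def force (x : ℕ) (k : ℕ → Bool) : Bool :=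
  Nat.rec (motive := fun _ => Bool) (k 0) (fun n _ => k (Nat.succ n)) x

@[simp] theorem band_eq_true {x y : Bool} : band x y = true ↔ x = true ∧ y = true := by
  cases x <;> simp [band]

theorem nif_eq (c : Bool) (x y : ℕ) : nif c x y = if c then x else y := by
  cases c <;> rfl

@[simp] theorem force_eq (x : ℕ) (k : ℕ → Bool) : force x k = k x := by
  cases x <;> rfl

theorem rec_eq_ite (c x y : Bool) : (Bool.rec x y c : Bool) = if c then y else x := by
  cases c <;> rfl

/-! ### Vectors packed into one natural number -/

/-- The vector of the values of `f` on `l`, in lanes of `w` bits, lowest lane first. -/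
def pack {α : Type*} (w : ℕ) (l : List α) (f : α → ℕ) : ℕ :=
  l.foldr (fun b acc => f b + 2 ^ w * acc) 0

section pack

variable {α : Type*} {w : ℕ} {l : List α} {f g : α → ℕ}

@[simp] theorem pack_nil : pack w ([] : List α) f = 0 := rfl

@[simp] theorem pack_cons (b : α) : pack w (b :: l) f = f b + 2 ^ w * pack w l f := rfl

theorem pack_congr (h : ∀ b ∈ l, f b = g b) : pack w l f = pack w l g := by
  induction l with
  | nil => rfl
  | cons b l ih =>
    simp only [List.mem_cons, forall_eq_or_imp] at h
    rw [pack_cons, pack_cons, h.1, ih h.2]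

theorem pack_add : pack w l f + pack w l g = pack w l (fun b => f b + g b) := by
  induction l with
  | nil => rfl
  | cons b l ih => simp only [pack_cons, ← ih]; ring

theorem pack_sub (h : ∀ b ∈ l, g b ≤ f b) :
    pack w l f - pack w l g = pack w l (fun b => f b - g b) := by
  rw [Nat.sub_eq_iff_eq_add', pack_add]
  · exact pack_congr fun b hb => (Nat.add_sub_of_le (h b hb)).symm
  · induction l with
    | nil => simp
    | cons b l ih =>
      simp only [List.mem_cons, forall_eq_or_imp] at h
      simp only [pack_cons]
      gcongr
      exacts [h.1, ih h.2]

theorem pack_mul (a : ℕ) : pack w l f * a = pack w l (fun b => f b * a) := by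
  induction l with
  | nil => simp
  | cons b l ih => simp only [pack_cons, ← ih]; ring

theorem mul_pack (a : ℕ) : a * pack w l f = pack w l (fun b => a * f b) := by
  rw [mul_comm, pack_mul]; simp only [mul_comm]

theorem pack_shiftLeft (c : ℕ) : pack w l f <<< c = pack w l (fun b => f b * 2 ^ c) := by
  rw [Nat.shiftLeft_eq, pack_mul]

theorem pack_shiftRight (c : ℕ) : pack w l (fun b => f b * 2 ^ c) >>> c = pack w l f := by
  rw [← pack_shiftLeft, Nat.shiftLeft_shiftRight]

/-- Bitwise conjunction of two numbers, split at bit `w`. -/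
theorem land_add_two_pow_mul {x y a b : ℕ} (hx : x < 2 ^ w) (hy : y < 2 ^ w) :
    (x + 2 ^ w * a) &&& (y + 2 ^ w * b) = (x &&& y) + 2 ^ w * (a &&& b) := by
  have hxy : x &&& y < 2 ^ w := lt_of_le_of_lt Nat.and_le_left hx
  refine Nat.eq_of_testBit_eq fun i => ?_
  rw [Nat.testBit_and, add_comm x, add_comm y, add_comm (x &&& y),
    Nat.testBit_two_pow_mul_add _ hx, Nat.testBit_two_pow_mul_add _ hy,
    Nat.testBit_two_pow_mul_add _ hxy]
  split_ifs <;> rw [Nat.testBit_and]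

theorem pack_land (hf : ∀ b ∈ l, f b < 2 ^ w) (hg : ∀ b ∈ l, g b < 2 ^ w) :
    pack w l f &&& pack w l g = pack w l (fun b => f b &&& g b) := by
  induction l with
  | nil => simp
  | cons b l ih =>
    simp only [List.mem_cons, forall_eq_or_imp] at hf hg
    rw [pack_cons, pack_cons, land_add_two_pow_mul hf.1 hg.1, ih hf.2 hg.2, pack_cons]

end pack

theorem land_two_pow {d k : ℕ} (hd : d < 2 ^ (k + 1)) :
    d &&& 2 ^ k = if 2 ^ k ≤ d then 2 ^ k else 0 := by
  have h0 : (2 : ℕ) ^ k &&& 0 = 0 := Nat.and_zero _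
  split_ifs with h
  · obtain ⟨e, rfl⟩ := Nat.exists_eq_add_of_le h
    have he : e < 2 ^ k := by rw [pow_succ] at hd; omega
    have := land_add_two_pow_mul (a := 1) (b := 1) he (y := 0) (by positivity)
    simpa [add_comm] using this
  · have := land_add_two_pow_mul (a := 0) (b := 1) (not_le.mp h) (y := 0) (by positivity)
    simpa using this

/-- The numbers `b` with `lo ≤ b < lo + cnt` and `q b`, in decreasing order. -/
def lanes (q : ℕ → Bool) (lo : ℕ) : ℕ → List ℕ
  | 0 => []
  | i + 1 => if q (lo + i) then (lo + i) :: lanes q lo i else lanes q lo i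

theorem mem_lanes {q : ℕ → Bool} {lo cnt b : ℕ} :
    b ∈ lanes q lo cnt ↔ lo ≤ b ∧ b < lo + cnt ∧ q b = true := by
  induction cnt with
  | zero => simp [lanes]; omega
  | succ i ih =>
    by_cases hb : b = lo + i
    · subst hb
      by_cases hq : q (lo + i) <;> simp [lanes, hq, ih]
    · have : b < lo + (i + 1) ↔ b < lo + i := by omega
      rw [this]
      by_cases hq : q (lo + i) <;> simp [lanes, hq, ih, hb]

/-- Kernel-friendly form of `pack`. -/
noncomputable def packRange (w : ℕ) (q : ℕ → Bool) (f : ℕ → ℕ) (lo cnt : ℕ) : ℕ :=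
  Nat.rec (motive := fun _ => ℕ) 0 (fun i acc => nif (q (Nat.add lo i))
    (Nat.add (Nat.shiftLeft acc w) (f (Nat.add lo i))) acc) cnt

theorem packRange_eq (w : ℕ) (q : ℕ → Bool) (f : ℕ → ℕ) (lo cnt : ℕ) :
    packRange w q f lo cnt = pack w (lanes q lo cnt) f := by
  induction cnt with
  | zero => rfl
  | succ i ih =>
    have : packRange w q f lo (i + 1) = nif (q (lo + i))
      (packRange w q f lo i <<< w + f (lo + i)) (packRange w q f lo i) := rfl
    rw [this, nif_eq, ih]
    by_cases hq : q (lo + i)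
    · simp only [hq, if_true, lanes, pack_cons, Nat.shiftLeft_eq]; ring
    · simp [hq, lanes]

/-- Lane-wise subtraction of `2 ^ c * s` from `r`, in the lanes where the result is nonnegative
(`Ht` holds `2 ^ k - t` in every lane: where it is at least `t`). -/
noncomputable def condSub (k c H Ht r s : ℕ) : ℕ :=
  Nat.sub r (Nat.land (Nat.shiftLeft s c) ((fun d => Nat.sub d (Nat.shiftRight d k))
    (Nat.land (Nat.sub (Nat.add r Ht) (Nat.shiftLeft s c)) H)))

theorem condSub_pack {α : Type*} {k c t : ℕ} {l : List α} {r s : α → ℕ}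
    (ht : t ≤ 2 ^ k) (hr : ∀ b ∈ l, r b < 2 ^ k) (hs : ∀ b ∈ l, s b * 2 ^ c + t ≤ 2 ^ k)
    (hs' : ∀ b ∈ l, s b * 2 ^ c < 2 ^ k) :
    condSub k c (pack (k + 1) l fun _ => 2 ^ k) (pack (k + 1) l fun _ => 2 ^ k - t)
      (pack (k + 1) l r) (pack (k + 1) l s) =
    pack (k + 1) l fun b => if s b * 2 ^ c + t ≤ r b then r b - s b * 2 ^ c else r b := by
  have hk : (2 : ℕ) ^ (k + 1) = 2 ^ k + 2 ^ k := by rw [pow_succ]; ring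
  have hpos : 0 < (2 : ℕ) ^ k := by positivity
  change pack (k + 1) l r - ((pack (k + 1) l s <<< c) &&&
    (((pack (k + 1) l r + pack (k + 1) l (fun _ => 2 ^ k - t)) - (pack (k + 1) l s <<< c)) &&&
      pack (k + 1) l (fun _ => 2 ^ k)) -
    ((((pack (k + 1) l r + pack (k + 1) l (fun _ => 2 ^ k - t)) - (pack (k + 1) l s <<< c)) &&&
      pack (k + 1) l (fun _ => 2 ^ k)) >>> k)) = _
  rw [pack_shiftLeft, pack_add, pack_sub fun b hb => by have := hs b hb; omega,
    pack_land (fun b hb => by have := hr b hb; omega) (fun b _ => by omega),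
    pack_congr (f := fun b => r b + (2 ^ k - t) - s b * 2 ^ c &&& 2 ^ k)
      (g := fun b => (if s b * 2 ^ c + t ≤ r b then 1 else 0) * 2 ^ k) fun b hb => by
      have h1 := hr b hb
      have h2 := hs b hb
      rw [land_two_pow (by omega)]
      by_cases h : s b * 2 ^ c + t ≤ r b
      · rw [if_pos (by omega), if_pos h, one_mul]
      · rw [if_neg (by omega), if_neg h, zero_mul],
    pack_shiftRight, pack_sub fun b _ => Nat.le_mul_of_pos_right _ hpos,
    pack_land (fun b hb => by have := hs b hb; omega) (fun b _ => by split_ifs <;> omega),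
    pack_sub]
  · refine pack_congr fun b hb => ?_
    by_cases h : s b * 2 ^ c + t ≤ r b
    · simp only [if_pos h, one_mul]
      rw [Nat.and_two_pow_sub_one_eq_mod, Nat.mod_eq_of_lt (hs' b hb)]
    · simp [if_neg h]
  · intro b hb
    by_cases h : s b * 2 ^ c + t ≤ r b
    · exact Nat.and_le_left.trans (by omega)
    · simp [if_neg h]

/-- The top bit of every lane in which `y ≤ x`. -/
theorem geFlags_pack {α : Type*} {k : ℕ} {l : List α} {x y : α → ℕ}
    (hx : ∀ b ∈ l, x b < 2 ^ k) (hy : ∀ b ∈ l, y b < 2 ^ k) :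
    pack (k + 1) l x + pack (k + 1) l (fun _ => 2 ^ k) - pack (k + 1) l y =
      pack (k + 1) l (fun b => x b + 2 ^ k - y b) ∧
    ∀ b ∈ l, x b + 2 ^ k - y b < 2 ^ (k + 1) ∧ (2 ^ k ≤ x b + 2 ^ k - y b ↔ y b ≤ x b) := by
  refine ⟨?_, fun b hb => ?_⟩
  · rw [pack_add, pack_sub fun b hb => by have := hy b hb; omega]
  · have := hx b hb
    have := hy b hb
    rw [pow_succ]
    omega

/-- Two comparisons at once: the top bit of every lane in which `y ≤ x` and `v ≤ u`. -/
theorem geFlags_land_pack {α : Type*} {k : ℕ} {l : List α} {x y u v : α → ℕ}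
    (hx : ∀ b ∈ l, x b < 2 ^ k) (hy : ∀ b ∈ l, y b < 2 ^ k)
    (hu : ∀ b ∈ l, u b < 2 ^ k) (hv : ∀ b ∈ l, v b < 2 ^ k) :
    ((pack (k + 1) l x + pack (k + 1) l (fun _ => 2 ^ k) - pack (k + 1) l y) &&&
      (pack (k + 1) l u + pack (k + 1) l (fun _ => 2 ^ k) - pack (k + 1) l v)) &&&
      pack (k + 1) l (fun _ => 2 ^ k) =
    pack (k + 1) l (fun b => if y b ≤ x b ∧ v b ≤ u b then 2 ^ k else 0) := by
  obtain ⟨h1, h2⟩ := geFlags_pack hx hy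
  obtain ⟨h3, h4⟩ := geFlags_pack hu hv
  have hk : (2 : ℕ) ^ k < 2 ^ (k + 1) := Nat.pow_lt_pow_right (by norm_num) (by omega)
  rw [h1, h3, pack_land (fun b hb => (h2 b hb).1) (fun b hb => (h4 b hb).1),
    pack_land (fun b hb => lt_of_le_of_lt Nat.and_le_left (h2 b hb).1) (fun _ _ => hk)]
  refine pack_congr fun b hb => ?_
  rw [Nat.land_assoc, land_two_pow (h4 b hb).1]
  by_cases h : v b ≤ u b
  · rw [if_pos ((h4 b hb).2.2 h), land_two_pow (h2 b hb).1]
    simp only [(h2 b hb).2, h, and_true]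
  · rw [if_neg (mt (h4 b hb).2.1 h), if_neg (fun h' => h h'.2), Nat.and_zero]

/-- `check` holds for the entry of `V` in every lane flagged in `F` (`V` being shifted so that its
lanes start at the flag bits). -/
noncomputable def checkFlagged (check : ℕ → Bool) (w V : ℕ) (fuel : ℕ) : ℕ → Bool :=
  Nat.rec (motive := fun _ => ℕ → Bool) (fun F => Nat.beq F 0) (fun _ ih F => Bool.rec
    ((fun G => band (check (Nat.mod (Nat.div V (Nat.sub F G)) (Nat.pow 2 w))) (ih G))
      (Nat.land F (Nat.sub F 1))) true (Nat.beq F 0)) fuel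

theorem checkFlagged_succ (check : ℕ → Bool) (w V fuel F : ℕ) :
    checkFlagged check w V (fuel + 1) F = if F = 0 then true else
      band (check (V / (F - (F &&& (F - 1))) % 2 ^ w))
        (checkFlagged check w V fuel (F &&& (F - 1))) := by
  have : checkFlagged check w V (fuel + 1) F = (Bool.rec
      (band (check (V / (F - (F &&& (F - 1))) % 2 ^ w))
        (checkFlagged check w V fuel (F &&& (F - 1)))) true (Nat.beq F 0) : Bool) := rfl
  rw [this, rec_eq_ite]
  simp [Nat.beq_eq]

theorem land_sub_one_of_lowest_bit (e m : ℕ) :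
    (2 ^ e + 2 ^ (e + 1) * m) &&& (2 ^ e + 2 ^ (e + 1) * m - 1) = 2 ^ (e + 1) * m := by
  have hpos : 0 < (2 : ℕ) ^ e := by positivity
  have hlt : (2 : ℕ) ^ e < 2 ^ (e + 1) := Nat.pow_lt_pow_right (by norm_num) (by omega)
  rw [Nat.sub_add_comm hpos, land_add_two_pow_mul hlt (by omega), Nat.and_self,
    Nat.and_two_pow_sub_one_eq_mod, Nat.mod_self, zero_add]

theorem check_of_checkFlagged_aux {α : Type*} {k : ℕ} {check : ℕ → Bool} {B : α → ℕ}
    {P : α → Prop} [DecidablePred P] (l : List α) (hB : ∀ b ∈ l, B b < 2 ^ (k + 1)) :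
    ∀ (i fuel V₀ : ℕ), V₀ < 2 ^ ((k + 1) * i + k) →
      checkFlagged check (k + 1) (V₀ + 2 ^ ((k + 1) * i + k) * pack (k + 1) l B) fuel
        (2 ^ ((k + 1) * i) * pack (k + 1) l (fun b => if P b then 2 ^ k else 0)) = true →
      ∀ b ∈ l, P b → check (B b) = true := by
  induction l with
  | nil => simp
  | cons b l ih =>
    intro i fuel V₀ hV₀ h
    simp only [List.mem_cons, forall_eq_or_imp] at hB
    have he : (k + 1) * (i + 1) = (k + 1) * i + k + 1 := by ring
    have hV : V₀ + 2 ^ ((k + 1) * i + k) * pack (k + 1) (b :: l) B =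
        (V₀ + 2 ^ ((k + 1) * i + k) * B b) + 2 ^ ((k + 1) * (i + 1) + k) * pack (k + 1) l B := by
      rw [pack_cons, he]; ring
    have hV' : V₀ + 2 ^ ((k + 1) * i + k) * B b < 2 ^ ((k + 1) * (i + 1) + k) := by
      have h1 : B b + 1 ≤ 2 ^ (k + 1) := hB.1
      calc V₀ + 2 ^ ((k + 1) * i + k) * B b < 2 ^ ((k + 1) * i + k) * (B b + 1) := by
            rw [mul_add, mul_one]; omega
        _ ≤ 2 ^ ((k + 1) * i + k) * 2 ^ (k + 1) := by gcongr
        _ = _ := by rw [he]; ring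
    by_cases hP : P b
    · have hF : 2 ^ ((k + 1) * i) * pack (k + 1) (b :: l) (fun b => if P b then 2 ^ k else 0) =
          2 ^ ((k + 1) * i + k) + 2 ^ ((k + 1) * i + k + 1) *
            pack (k + 1) l (fun b => if P b then 2 ^ k else 0) := by
        rw [pack_cons, if_pos hP]; ring
      have hpos : 0 < (2 : ℕ) ^ ((k + 1) * i + k) := by positivity
      rw [hF] at h
      cases fuel with
      | zero =>
        have h' := Nat.eq_of_beq_eq_true h
        omega
      | succ fuel =>
        rw [checkFlagged_succ, if_neg (by omega), land_sub_one_of_lowest_bit, band_eq_true,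
          Nat.add_sub_cancel, hV, ← he] at h
        obtain ⟨h1, h2⟩ := h
        have h3 := ih hB.2 _ _ _ hV' h2
        simp only [List.mem_cons, forall_eq_or_imp]
        refine ⟨fun _ => ?_, h3⟩
        have h4 : (V₀ + 2 ^ ((k + 1) * i + k) * B b +
            2 ^ ((k + 1) * (i + 1) + k) * pack (k + 1) l B) / 2 ^ ((k + 1) * i + k) =
            B b + 2 ^ (k + 1) * pack (k + 1) l B := by
          rw [show V₀ + 2 ^ ((k + 1) * i + k) * B b +
            2 ^ ((k + 1) * (i + 1) + k) * pack (k + 1) l B =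
            V₀ + 2 ^ ((k + 1) * i + k) * (B b + 2 ^ (k + 1) * pack (k + 1) l B) by rw [he]; ring,
            Nat.add_mul_div_left _ _ hpos, Nat.div_eq_of_lt hV₀, zero_add]
        rwa [h4, Nat.add_mul_mod_self_left, Nat.mod_eq_of_lt hB.1] at h1
    · have hF : 2 ^ ((k + 1) * i) * pack (k + 1) (b :: l) (fun b => if P b then 2 ^ k else 0) =
          2 ^ ((k + 1) * (i + 1)) * pack (k + 1) l (fun b => if P b then 2 ^ k else 0) := by
        rw [pack_cons, if_neg hP]; ring
      rw [hF, hV] at h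
      have h3 := ih hB.2 _ _ _ hV' h
      simp only [List.mem_cons, forall_eq_or_imp]
      exact ⟨fun h' => absurd h' hP, h3⟩

theorem check_of_checkFlagged {α : Type*} {k fuel : ℕ} {check : ℕ → Bool} {B : α → ℕ}
    {P : α → Prop} [DecidablePred P] {l : List α} (hB : ∀ b ∈ l, B b < 2 ^ (k + 1))
    (h : checkFlagged check (k + 1) (pack (k + 1) l B <<< k) fuel
      (pack (k + 1) l (fun b => if P b then 2 ^ k else 0)) = true) :
    ∀ b ∈ l, P b → check (B b) = true := by
  refine check_of_checkFlagged_aux l hB 0 fuel 0 (by positivity) ?_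
  rwa [mul_zero, zero_add, zero_add, pow_zero, one_mul, mul_comm, ← Nat.shiftLeft_eq]

set_option exponentiation.threshold 1000000
set_option maxRecDepth 100000

/-! ### Perfect powers and logarithms of the integers up to 3600 -/

/-- The number whose `n`-th bit tells whether `n` is a perfect power, for `1 ≤ n ≤ 3600`. -/
noncomputable def powMask : ℕ :=
  0x100000000000000000000000000000200000000000000000000000000801000000000000000000000000000020000000000000000000000000001002000000000000000000000000200000000000000000000000000100000000000000000000000000200000000000000010000000001000000000000000000000000020000000000000000000000001000000000000000000000000200000000000000000000000100000000000000000000000200200800000000000000001000000000000000010000020000000000000000000001000000000000000000000200000000000000000000100000000100000000000200000000000000000001000000000000000000020000000000000000001000000000000000000200000000080000000100000000000000000200000000000000001000000000000000020000000000000001000001000000000200000000000000100000000000000200000000000001000000000000020000000000001000000000000200000000000100000000000200010000001000000000020000000001000000000200008000100000000200000001000800020100001000000200000100012200001000020001000200110a010312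

/-- Whether `n` is a perfect power (for `1 ≤ n ≤ 3600`). -/
noncomputable def isPow (n : ℕ) : Bool := Nat.beq (Nat.mod (Nat.shiftRight powMask n) 2) 1

/-- The number with bits at the positions `m ^ k`, `1 ≤ m ≤ cnt`, and at those set in `acc`. -/
noncomputable def powBits (k cnt acc : ℕ) : ℕ :=
  Nat.rec (motive := fun _ => ℕ) acc
    (fun m ih => Nat.lor ih (Nat.shiftLeft 1 (Nat.pow (Nat.succ m) k))) cnt

theorem powMask_eq :
    Nat.beq powMask (powBits 2 60 (powBits 3 15 (powBits 5 5 (powBits 7 3 (powBits 11 2 0))))) =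
      true := by
  decide +kernel

theorem of_testBit_powBits {k acc n : ℕ} (cnt : ℕ) (h : (powBits k cnt acc).testBit n = true) :
    acc.testBit n = true ∨ ∃ m, 1 ≤ m ∧ n = m ^ k := by
  induction cnt with
  | zero => exact Or.inl h
  | succ m ih =>
    have h' : (powBits k m acc ||| 1 <<< (m + 1) ^ k).testBit n = true := h
    rw [Nat.testBit_or, Bool.or_eq_true, Nat.one_shiftLeft, Nat.testBit_two_pow] at h'
    rcases h' with h' | h'
    · exact ih h'
    · exact Or.inr ⟨m + 1, by omega, (of_decide_eq_true h').symm⟩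

theorem exists_pow_of_isPow {n : ℕ} (h : isPow n = true) :
    ∃ m k : ℕ, 1 ≤ m ∧ 2 ≤ k ∧ n = m ^ k := by
  have h1 : powMask.testBit n = true := by
    have := Nat.eq_of_beq_eq_true h
    change powMask >>> n % 2 = 1 at this
    rw [Nat.testBit_eq_decide_div_mod_eq, ← Nat.shiftRight_eq_div_pow, this]
    rfl
  rw [Nat.eq_of_beq_eq_true powMask_eq] at h1
  rcases of_testBit_powBits _ h1 with h1 | ⟨m, hm, rfl⟩
  · rcases of_testBit_powBits _ h1 with h1 | ⟨m, hm, rfl⟩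
    · rcases of_testBit_powBits _ h1 with h1 | ⟨m, hm, rfl⟩
      · rcases of_testBit_powBits _ h1 with h1 | ⟨m, hm, rfl⟩
        · rcases of_testBit_powBits _ h1 with h1 | ⟨m, hm, rfl⟩
          · simp at h1
          · exact ⟨m, 11, hm, by norm_num, rfl⟩
        · exact ⟨m, 7, hm, by norm_num, rfl⟩
      · exact ⟨m, 5, hm, by norm_num, rfl⟩
    · exact ⟨m, 3, hm, by norm_num, rfl⟩
  · exact ⟨m, 2, hm, by norm_num, rfl⟩

/-- The values `⌊2 ^ 60 * log n⌋` for `1 ≤ n ≤ 3600`, in lanes of 64 bits. -/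
noncomputable def logTable : ℕ :=
  Nat.add 0x424a47a38c606c834208be109f73ab7c41c623ac49b0338641826f7194ca2d37413d97e71ca5e2da40f793171919351540b05686b669637b4067d72ca9b13e24401e0966ebfbcada3fd2e0ef842617603f8650d0447955683f384b555d5291323ee8c1fea201fe353e97a56f58375e703e44e55c64b4aea83df07078a176e9023d9a345f21e16cb33d421d7b2084d7ac3ce816ed479348993c8c0a6df8a886a43c2de02c29d8222c3bcd7ea85c7a59863b6aca8b1d589b573b05a67664e41a3b3a9df2d1101bac943a338d8b8683507e39c651dc758f7a6f395617f45440046438e2b4a61fe78abf386bf903721beb3837f1b1e9ab71a2063773a77d7190d60536f19c912256b3e2366b4df217ad359d35e071979bfc3d7a3550b5ad2c94468934bbbf7007091fc6342129d5e0359997338083efdb1a66d532d94ef92459f167322afbfba367e0123174e8ee7b8b8f0a30b65d28df5d61eb2fee84f6e7c722a02f1c6c0c096658e42e3ef674d7230cc92d54d783f4fef39d2c5c85fdf473de6a2b542c729a903e022a39942daf774eef290a08566318a1fd27c22d79a73cf9cc265dc76efe6e976f24d763776aaa2b052327d4f55a06152e2145647e7756e6d01f2272ae325a57541cab0bfa2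a20023219c041f7ed8d336a162e42fefa39ef351193ea7aad030a970b17217f7d1cf79a00000000000000000000000000000000
    (Nat.mul (Nat.pow 2 4096) (Nat.add 0x4d81ca5180b908584d616923097d641e4d40c5e7c8a79a404d1fdf901c90a3174cfeb505ca5ba5ee4cdd452bc6cd2b214cbb8eddfcdd2ede4c9990f111e724d24c774a3227594af24c54b96699c2da754c31dd4bbd1eb72b4c0eb49696362cb04beb3df390f5137d4bc7780633865b164ba36168ce0d6ee14b7ef8ac26ce35bf4b5a3c57229285064b352ae66918c2754b0fc2cc0554191f4aea026f01430efb4ac3e82afd1d6dc74a9d724fc1964d034a769f20ccea95564a4f6cd4da6f88cd4a27d995644faf9949ffe37e1f1ef5d049d7889c6ee8c2f849aec6eed554560b49859c645874ac9e495c06dbe1d1a64349320423952fe003490791f81e93e09d48dcae03f6f38c4e48b155de9efe644d4885870bcf59be7948593efa9da1cf47482c7b049572f95147ff386cc4b0403447d1745eba2bd8e247a32bed75c57e3f47745c1248ff4812474501aba6f519c74715197be28c270846e4a027d997512146b392358b9206784681ec0a9a7592f2464fa9eab40c2a5d461cc7f5e20111d545e94226bec5cbfb45b514508d38a42f45803a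1d30c8eec3454aaf0b03a0481945146e6a881d716d44dd735bf2ac720944a5b8cc88bf98cd446d3973d15cfbff4433efd0935b23d643f9d6259d04825a43bee676506aeaa943831a82ef38e2d343466bc4a044b5824308d369288e99a142ca4a4e50a5d568428ac8fceeadcda0
    (Nat.mul (Nat.pow 2 4096) (Nat.add 0x54094fdcb1c2e7ee53f3cf83741083e953de321e3963771a53c8775e1c1b5be853b29ef2f36d8b0d539ca88b4c76b614538693d4631cadda5370607a1abec6e2535a0e26f6b33e1e53439c84128ff0ec532d0b391a3caa87531659ec41cd37cf52ff88423d21605052e895de3748d07d52d18261c9a8ed7152ba4d6cf2e275da52a2f69e0d74be2a528b7d91c61c3fac5273e1e311ea1a70525c232b2412116252444101636c6e12522c3afb5fa91ea3521410acc63143fa51fbc1a756b448bc51e34d7ad75d7a8151cab3b508aefe1351b1f3e198fed57151990d8a17928a8c51800035e755ec055166cb6a312921f8514d6ea9d5c237665133e9755f1e0970511a3b4af17c6000510063a63be2c39650e662006821719e50cc35d00a559bc950b1de890fe3e74d50975b9cade5e65e507cac794f0508cc5061d08a80bd3fb45046c738e0014c2f502b8fea053a690850102a006f9cb3c24ff4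94db6fc969a44fd8cfd711b7b9404fbcda4c05dc90674fa0b38f898970e54f845af34e79f3994f67cfc56187396c4f4b115010781b714f2e1ed9cee4774a4f10f7a51a2179f44ef39af05c2c49314ed607f5cd87e2444eb83deb560273494e9a3c026c55da6e4e7c0167f49653314e5d8d441d61ad1d4e3edeba3bc0b0384e1ff4e8a5ab913c4e00cee88b2189a54de16bcdcdc2cd024dc1caa6d6db2cc44da1ea7c6bcac53b
    (Nat.mul (Nat.pow 2 4096) (Nat.add 0x58a903f68f8f31a05898ebd0fdd5fff35888c36aa1d6778158788aa2869a5bb858684157528789d35857e76745c491db58477cb03895110f5837010f99ad9ab2582674626c7efae15815d68547789d89580527545241e21357f466ab43ea22bc57e39465610f34f557d2b05d79fa267957c1ba6de8b1f8f857b0b2708f041c6d579f983ed4826668578e6bb1a476428d577d2ca16bc8d692576bdae616dfd210575a76570f6ea01e5748fecb3a3baec657377418f4d97dd45725d6161353244b57142497ddcbf95b57025f730e120b1756f0867bcd230a9f56de9985b0a352b056cc9863b846aad956ba82e84b2a667c56a858e535207c0456961a2ba3eb2d5a5683c68c2468d79956715dd69faf7ca1565edfda5817959b564c4c65e635ba0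f5639a34735c2a3645626e44b827110ba56140f3f54b10b36560123ee7e60069655ee22241765559755db09aa7a3a656255c7da4b405e2e6e55b493cf3eb3449e55a135fe81c7eb50558dc0a04a078cf1557a337b07d4f05355668e54578c80675552d0f0fd6df540553efb14e16ca734552b0c830ae5cec2551704fd9c3bed6a5502e445ce5694cf54eeaa1bec05ba9354da563f4d47c01a54c5e86e52714da654b160665f361898549cbde3d591a439548800a2108f04115473285b5eee9dde545e34c8fda8dfff544925a3124cd79e5433faa0a53987c6541eb3779bb0d837
    (Nat.mul (Nat.pow 2 4096) (Nat.add 0x5c3e39069a6ad4ea5c315cca6e99579b5c24762fbade71635c178525b8ffbb305c0a899b79ed9fee5bfd837fe53e69395bf072c1b8a72d405be3574f877293645bd63117b9f564eb5bc900088d00dee75bbbc4101152ba305bae7d1c2b02ddf95ba12b1a90eeb16f5b93cdf8cc2200675b8665a4373d66f15b78f209fdda374e5b6b73171bebcd905b5de8b85d1e43ca5b5052da5c3279815b42b169825760a25b3504520680820f5b274b7fecb9ab5d5b1986df0577b7355b0bb65aece6613f5afdd9df0a3316455aeff1568ed4b0db5ae1fcac75d012625ad3fbcb82f988025ac5ee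9e4232ea9b5ab7d50f06a668805aa9af07e9fde73b5a9b7c72cb96eb345a8d3d394fb2f2ab5a7ef144dea431075a70987ea3f696e65a6232cf8d95130c5a53c0204aeaf7a35a4540594c016ee55a36b362c098e99e5a281924973e718f5a1971867c5cc9115a0abc6fd94940cc59fbf9c7d34c2bd959ed29754aa4d9df59de4b5ed988fe4559cf5f6ad31f6ae459c0657f427603e859b15d81e972d20859a247583fc01766599322e771b34acb5983f0145f2edc315974aec39a7ea4b859655ed9672ee37a59560039b8dda7d3594692c8320688d35937166822c888d759278afc87a603355917f068083e81405908468cf60252a958f88d4d4adfc49d58e8c48aa7e9d1c358d8ec2653f8245e58c904013a4042b658b90bfbe8e7bcd5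
    (Nat.mul (Nat.pow 2 4096) (Nat.add 0x5f2b26bc9fe9d57c5f20715c2edfdf885f15b4cc2dbc12f05f0af102f12d7b845f0025f6ba51cc375ef5539db6806eb55eea79edff14df775edf98dd993853835ed4b06275aaa4d85ec9c072708a82a85ebec903511ce2435eb3ca0ac993adaf5ea8c37e76d3acbd5e9db553e039a5745e929f80775eb0865e8781f997dbbe7d5e7c5cb4870c4a4b5e712fa673d035b85e65fac4764ccc385e5abe038face8865e4f7958a9e039765e442cb89759a2215e38d81812ccb1c85e2d7b6bbeea2f6a5e2216a8261bb53c5e16a9c1ba3e57eb5e0b34acd45c55895dffb75db465c8185df431c880e857415de8a3e146c5e50c5ddd0d9bf8ea31085dd16eec6fff6d755dc5c7c66a21c1c35dba181d8a91b5c55dae5fe5596580b75da29f11433937475d96d59498ddd3925d8b03628f07120b5d7f286e3df81e145d7344aaa12f08fc5d67580a970f05fd5d5b6280e08965ad5d4f640020c54b515d435c7adcc6163e5d374be37b1079795d2b322c434e3b945d1f0f475df098af5d12e326d3d140565d06adbc8dd1e8ed5cfa6efa547a721c5cee26d1cf958f9e5ce1d53485cbf5ad5cd57a13dc3e001d5c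c91561161bcd0c5cbca70d543bc4075cb02f0994af82275ca3ad46b25723b65c9721b56472e3a05c8a8c463e3308d35c7dece9ae4619935c71438ffe654c815c64902952df2f015c57d2a5aa20785f5c4b0af4dc3b010b
    (Nat.mul (Nat.pow 2 4096) (Nat.add 0x61a4147b1c9fbe5a619ae80ba185cf346191b656a7b90c4d61887f561ccc743c617f4303e3cf3fdb61760159d5348d35616cba51bebac3d761636de56352b1aa615a1c0e7b065f4f6150c4c6b2df9aff61476807acce38f6613e05caff8e085461349e0a368c7b7d612b30bed1ce02d16121bde245d318c66118456dfb7cfe31610ec75b4ff225b6610543a394824d3260fbba400e8a440360f22b29f7575cfd60e8965a7c0a8adb60defbcabd7b260860d55b73d0195a7360cbb54ebbd03c3960c209547be781e160b8577dfee4e2eb60ae9fc4266d194860a4e21fc724848c609b1e89a88f6d60609154fa84f1e7ee6087856b092f53c9607dafd3d4a978026073d42d791f39e36069f2707a8aecdb60600a954f003a2f60561c945e899ece604c286603057de160422e028802c65d60382d622a9d2a26602e267d1958e5056024194b73fe11de601a05c54b738c69600febe2a1995dc86005cb9b6922b22e5ffba4e7856f55df5ff177beca64b7b45fe74418fc466f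555fdd09edcf8e45405fd2c934e8c3bacf5fc881e5dc5310325fbe33f82e63c6815fb3df6352ae9bd35fa9841eac52ff665f9f22218dabfbac5f94b9633824943d5f8a49dadc0b95795f7fd37f9866d3b05f7556487ac5d79a5f6ad22c7f13f5d85f6047228f69cf395f55b52183de375b5f4b1c2022567f605f407c151e56222e5f35d4f718cdcfd2
    (Nat.mul (Nat.pow 2 4096) (Nat.add 0x63c82b7abb19f02163c025760cac293b63b81b6951ac491c63b00d507af2f78e63a7fb2773344e91639fe4ea1ef36f1c6397ca945c75f663638fac2203b753536387898ee65bfbd1637f62d6cfa4816e637737f584608518636f08e6c2e189766366d5a642eda374635e9e2fb5b208aa6356627ec5b57b2b634e228f16ca924d6345de5c4601e009633d95e1e99bf27b6335491b90fb3118632cf804c49595246324a29905e63cf9631c48d3cf5ed9ae6313eab09458f69c630b882ac1071a566303213dba65c09362fab5e4de2c2c8f62f2461b82bd136e62e9d1dcf7171e1462e1592482c541fe62d8dbed65cef09362d05a32d8a81c6c62c7d3f00c21140862bf49202956316762b6b9be519f5e0362ae25c59e7f6a9762a58d3121933a27629ceffbe480bfb962944e20e8e5ce2d628ba79b2846b9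9c6282fc6593fcc9aa627a4c7b15247c35627197d68c8b97b86268de72d29f0cd76260204ab758a66162575d59022c8739624e959871f6756e6245c903bce6f1e4623cf79590701be56234214891325fec622b46175ae8f0f6622265fc80560bab621980f28b2f02b2621096f3fc0813646207a7fb4a40023a61feb402e3eb7e2d61f5bb052dc04a4b61ecbcfc83002cbc61e3b9e33563a27361dab1b38d0456c661d1a467c8475e1761c891fa1bc732c661bf7a64b23d739f61b65da1ac6c62db61ad3bab210824f4
    (Nat.mul (Nat.pow 2 4096) (Nat.add 0x65ab7feb7e8246e865a45eb8cccfea46659d3a575ec5f285659612c45bc128a1658ee7fce74b2ab96587b9fe21138e81658088c524e8f4546579544f0ab20aa665721c98e66681b2656ae19fc807ef3e6563a360bb9aa24c655c61d8c91e667f65551d04f4873713654dd4e23db5e1386546896da07095a4653f3aa4145b692a6537e8828cf0c42965309305f979c0ab65293a2b450676f56521ddef56663867651a7e4f101fb87165131b4750692374650bb4d4f120234f65044af4c7c1d17964fcdda3a562965e64f56cde56a5f5e064edf8a1a3b648b564e680ea503c627f64df05b51b57245164d786febf92fb8364d004c3f2e14c8a64c87f01668fc9a364c0f5b3c73fb5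1e64b968d7bcdd0f0164b1d869ea95add764aa4466eed0426664a2accb63234618649b1193dc4bd3cc649372bcea246ae7648bd043179b9c5264842a22eaaaa132647c8058e44bdb156474d2e180713d54646d21b935fa9f6d64656cdc76abf809645db447af23806e6455f7f746cfc024644e37e79fe58071644674151755a780643eac7c04c2fad06436e118ba77c8c1642f11e7855b78db64273ee4ace80292641f680c731f4a4464178d5b1480640b640faeccc7fcbc386407cc5dbeed250863ffe60a2506c95e63f7fbce2050042263f00da5d1151bf963e81b8d51dce30463e02580b75d3a5063d82b7c106f78aa63d02d7b6604b470
    (Nat.mul (Nat.pow 2 4096) (Nat.add 0x675bc4c5ed61390567555a861787cc85674eedb2c7cd50a567487e49ebb64f3567420c496e463bc3673b97af37fb68fe673520792ecaf5e7672ea6a5361cb2cb67282a312ec6fde16721ab1af70a9788671b29606a8e6e0d6714a4ff625b60d3670e1df5b4d7faea6707944135c424db670107dfb634cdab66fa78cf048f8aff66f3e70cec86303766ed529737125c8566e6bb6baa70ffd866e021880a1dd68266d984ea16cedb9566d2e58f8e6fb1cb66cc43762c1d02ea66c59e9ba81fd59466bef6fdb7e8d95966b84c9a0e0ba90966b19f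6e5a3a031666aaef78493ef80266a43cb584fa0eb0669d8723b45a5e8c6696cec07b599f66669013897af72ee96689557c51330b97668294969908c52b667bd0d5ea6a624966750a37da3b3b64666e40b9fa4acab166677459d94f711b6660a51502e130196659d2e8ff74583d6652fdd354542c6e664c25d1839d79a966454ae10c39232f663e6cff69d6a2f866378c2a14e67e5d6630a85e8294aed06629c19a24c2fe816622d7da6a0358da661beb1cbd920ea86614fb5e87500de0660e089d2bbd0cc6660712d60bf1a87566001a068599769065f91e2bf2ed09fd65f21f43aaabea9665eb1d4b00167f9d65e4183f42e7ecd865dd101dbf4fe23565d604e3bdec5dcc65cef68e83c3601b65c7e51b523c925d65c0d087671aded665b9b8cffc75fae765b29df248b3e2cf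
    (Nat.mul (Nat.pow 2 4096) (Nat.add 0x68e2bde87ef5d35368dce945e73eb95e68d712829987b00768d1399d07aead5f68cb5e93a1dc886b68c58164d682785268bfa20f12578ef568b9c090c0562ee268b3dce849b97c9c68adf71415facb2d68a80f128acf03f268a224e20c2409a6689c3880fc1e1688689649edbb1515af68905926a791f766688a662a1e4c0097688470f67a261536687e798a142bfd9868787fe3438fa6b4687284005da65d48686c85dfb5e603bf6866857f9de242ec686082de6549b570685a7dfa59e30dd9685476d1c78a3758684e6d62f82d7114684861ac33ca63ff684253abc06b332f683c435fe223869c683630c6db0d904a68301bdeeb470bc7682a04a650ee37f16823eb1b481ecaf6681dcf3c0aeee0886817b106d16be23068119079d19769b6680b6d933f641d8c680548514cb2873867ff20b2294de3a367f8f6b402e8ed4867f2ca55051aa03267ec9b93595af7b767e66a6d26ffa5ea67e036e09338c4a767da00ebc10d803f67d3c88cd158bba267cd8dc1e2c5adfc67c7508911cc79c267c110e078aebd1067bacec62f741b5167b48a384be6c01b67ae4334e18fdb3a67a7f9ba01b415ce67a1adc5bb50006d679b5f561b147a4a67950e692b63112d678ebafcf44a5a586788650f7b82441c67820c9ec4686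02f677bb1a8cffc269c6775542b9cdb3149676ef425273d6ff96768919368f154b867622c745957f8a6
    (Nat.mul (Nat.pow 2 4096) (Nat.add 0x6a47a03d7fbe84d76a42483c1d06cd176a3cee713c923c376a3792dbabfcd7236a32357a37ae70736a2cd64baad90a8a6a27754ecf7736f86a2212826e4a731f6a1cade54ed982196a174776376ec3d26a11df33ed1689586a0c751d339d66506a070930cd8e7f9a6a019b6d7c31d71269fc2bd1ff8a946a69f6ba5d16554b1e69f1470d7e063d6f69ebd1e1f2c79c7369e65ad92f77c51c69e0e1f1eda77a4269db672ae5981ba769d5ea82ce39d9de69d06bf85d29e72d69caeb8a46b0a54969c569373dbfcfef69bfe4fdf3f0a45869ba5edd1982057869b4d6d35d569d0f69af4cdf6cf2f97469a9c0fff47ba82069a433339eb34cf2699ea37914f8b617699911ceff44ecab69937e34042941e6698de8a6c8cd58f369885125f0ed2d536982b7b01ed715ca697d1c43f369c3d269777ee00e123f8c6971df830cc9e021696c3e2b8c14409969669ad826fd31116960f5877716a450695b4e38147699bc6955a4e895b5038f694ff9978fe9a962694a4c4396aa06ed69449ceb3c072704693eeb8d108b7ac269393827a338acd7693382b9818571006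92dcb41375b4f85692811bd4f146cd76922562c51794d24691c988cc5be93f46916d8dd3182bfb36911171c18cbe12a690b5347fe054edc69058d5f61fd543968ffc560c3e2dca768f9fb4aa1431a4d68f42f1b760728a368ee60d1bc71aab568e8906bed1c650f
    (Nat.mul (Nat.pow 2 4096) (Nat.add 0x6b8fe442804f36716b8af5acf63c317e6b860591c39e43446b8113eff7a7e4766b7c20c6a0ac10ba6b772c14cc1d31c96b7235d9868c08dc6b6d3e13dba696696b6844c2d637002c6b6349e58022757b6b5e4d7ae26811e26b594f82051fbdf76b544ff9ef790e806b4f4ee1a7ba21c06b4a4c38333e7b106b4547fc9675dca06b40422dd4e31f706b3b3acaf11b09796b3631d2ecc321fd6b312744c89084046b2c1b1f8446aef76b270d621eb655636b21fe0b95bc29d36b1ced1ae63fa9c96b17da8f0c31e6c96b12c667028c4d796b0db0a1c34f6ad16b08993e4781af4f6b03803b872e303c6afe6598796366ef6af949541431ee116af42b6d4cab3cdb6aef0be316e060516ae9eab465e0b26a6ae4c7e02bb88f326adfa365597007cd6ada7d42df09936b6ad55577ab80be1b6ad02c02acc8d5836acb00e2cfcb936e6ac5d4170067c6366ac0a59e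296ff7016abb757734a90dcd6ab643a10ac8f3476ab1101a937530686aabdae2b5418bd76aa6a3f855aea5096aa16b5a59288d136a9c3107a3055d416a96f4ff1583cb4a6a91b73f91c9bb466a8c77c7f7e2cf346a87369726bef43b6a81f3abfc30ed736a7caf0554ecdc5b6a7768a20c86c6d36a722080fd711ab86a6cd6a100fb2ef66a678b00ef4fc2356a623d9f9f7376fb6a5cee7be7434d4d6a579d949b7319c96a524ae88f8bfa336a4cf67695eac76d
    (Nat.mul (Nat.pow 2 4096) (Nat.add 0x6cbfca3a2aae93bb6cbb35fa99bcb5f46cb6a06b2b47c5976cb2098b1ea2c6ce6cad7159b27ac1cd6ca8d7d624d603e86ca43cffb3135fad6c9fa0d599e96bd66c9b03571565c1346c96648360ec37766c91c459b73620dc6c8d22d9525184d06c8880016ba059586c83dbd13bd7bb726c7f3647faff26496c7a8f64e06fa9456c75e72722d31cfa6c713d8df82356e96c6c929895a95c1e6c67e6462ffc929a6c633895fb01f1956c5e898729eb30906c59d918ef35f5326c55274a7caaffef6c50741b035d577f6c4bbf89b3a973176c470995bd34636a6c42523e4eeafa6c6c3d99829700f1d36c38df61c2f010606c3423daff774dd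b6c2f66ed7899f5cb6c2aa898599ec8ec6c25e8dacd0f1d506c2127b3fcb5fd436c1c6523119f44cd6c17a1273416bdf36c12dbbf8ba73b9e6c0e14eb3f19b3286c094ca9747454976c0482f950f9a17d6bffb7d9f92782756bfaeb4a90b65b476bf61d4a3a981da36bf14dd818f75a816bec7cf34d36520e6be7aa9af7ee023b6be2d6ce38ed33d36bde018c2f3786336bd92ad3f904797c6bd452a4b3be77656bcf78fd7c01da866bca9ddd6d9bf4356bc5c143a38a10e36bc0e32f37f87af56bbc039f44417c276bb72292e0ec5d5d6bb2400925ac64fb6bad5c01295fd3a86ba8767a020edf886ba38f72c4eaadec6b9ea6ea864c4b636b99bce059b3a2466b94d15351c66f9d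
    (Nat.mul (Nat.pow 2 4096) (Nat.add 0x6ddab099885cca9e6dd66a9fa67329016dd22381476ddf816dcddb3dcebc559e6dc991d49f501b596dc547451b9c62326dc0fb8ea59575746dbcaeb09eb031c26db860aa67e17bfb6db4117b619db7546dafc122ebd83aca6dab6fa06602c5c86da71cf32f0cf41f6da2c91aa563b1366d9e741626f0aa856d9a1de51119c1456d95c686c0c07b696d916dfa924173d06d8d143fe173c9b46d88b95609a88f536d845d3c65aa37d86d7ffff24fbc04716d7ba177219970ac6d7741ca34759dfc6d72e0eae0fabe786d6e7ed87f497ed46d6a1b9266f86f826d65b717ef136d096d6151686e1b078c6d5cea833a03e97f6d588267a8363d856d5419150d8d13806d4fae8abe55c4c86d4b42c80e4f57876d46d5cc50a9e1456d426796d805e8906d3df826f673c5d36d39877bfd7303466d3515953df1bc066d30a272084bfa4d6d2c2e11ac4b14c56d27b87379250afe6d234196bd7be0fa6d1ec97ac75cf9d46d1a501ee44071896d15d582610875c86d1159a48a009de76d0cdc84aadd41e66d085e220ebad0806d03de7c001d24576cff5d91c8eed8276cfadb62b2809a0e6cf657ee05887dd96cf1d3330a214e616ced4d3107c9ddf26c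e8c5e7456455b26ce43d55093584186cdfb37998e42a616cdb2854397849066cd69be42f5a6b3a6cd20e28be52f15c6ccd7f2129895a766cc8eeccb3838ca66cc45d2a9e251c8f
    (Nat.mul (Nat.pow 2 4096) (Nat.add 0x6ee34e7acdc855e96edf4cfa3836e7bc6edb4a78a1dce92b6ed746f589c920d56ed342706ea933296ecf3ce8cec940b76ecb365e281384106ec72ecff80fef296ec3263dbbe3c83a6ebf1ca6f051462c6ebb120b11b72c7f6eb706699c1066b76eb2f9c20af3a3476eaeec13d992edfe6eaadd5e82bb49f36ea6cda180d44aee6ea2bcdc4ddfae4c6e9eab0e6378f36c6e9a98373ad4f3856e9684564cc179086e926f6b11a4d6786e8e5975017d7cb36e8a427393e190c06e862a663ffe81116e82114c7c989a356e7df725c00a9b0e6e79dbf1804548736e75bfaf32cf00456e71a25e4cc34c036e6d83fe42d272c56e69648e89410ab46e65440e93e789e76e61227dd631d6bf6e5cffdbc31ed7a46e58dc27cd40023e6e54b76166b8ea166e509188013ece9e6e4c6a9b0e1828b36e484299fe1c377c6e44198441b28cbe6e3fef5948d298956e3bc418830334946e3797c15f5a2e4e6e336a534c7bd1496e2f3b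cdb89a70526e2b0c301175ee376e26db79c45b45e76e22a9aa3e2411f16e1e76c0eb36136a6e1a42bd3782b82e6e160d9e8e86a0866e11d7645b49242a6e0da00e085bd6a46e09679affda0b096e052e0aab6857196e00f35c743415af6dfcb78fc2f2e8916df87aa3ffe239986df43c9892c6bb316deffd6ce2ebe82d6debbd20572382f66de77bb255c514066de3392244ad67c46ddef56f893e0ba2
    (Nat.mul (Nat.pow 2 4096) (Nat.add 0x6fdbdc4babc96f066fd81733445cacb96fd45137423e3ea16fd08a5739fa069b6fccc292bfcfbc5f6fc8f9e967b2a5716fc5305ac5494cc56fc165e66bed3a016fbd9a8beeaaa8756fb9ce4ae0403db36fb60122d31ebfd46fb233135968cb676fae641c04f289026faa943c674162826fa6c374118bb7e96fa2f1c294b893ed6f9f1f27815f60216f9b4ba267c798cd6f977732d7e880676f93a1d86168d2af6f8fcb92939e77736f8bf460fd8e34ef6f881c432deb61d96f844338b31797086f8069411b2260c26f7c8e5bf3c8efa46f78b288ca75c9336f74d5c72c4078096f70f816a5ed3ba06f6d1976c3ecb7bf6f6939e7125ba3836f6559671d02780c6f6177f66f551ebb6f5d959494729f1a6f59b2411724c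c5a6f55cdfb81dff26b6f51e8c35ec282b26f4e02983794c05c6f4a1b7995c86c436f463367027870766f424a6006688b4f6f3e60642a04fa2d6f3a7572f56223be6f36898bf03c41df6f329caea1f70b176f2eaeda919d5ba66f2ac00f45e0de296f26d04c4519b3d26f22df9115461c346f1eeddd3c0a1ca26f1afb303eaf27246f170789a223c0f96f1312e8eafb28ab6f0f1d4d9d6cfbbd6f0b26b73d54dbd76f072f254e3213946f03369753273ad46eff3d0ccef9da9f6efb4285441210946ef74700347a31eb6ef34a7d21de6df86eef4cfb8d8c70446eeb4e7af873022d6ee74efae321ac0b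
    (Nat.mul (Nat.pow 2 4096) (Nat.add 0x70c630d3b080833170c2a16afb9f3e8270bf11374cece01470bb803849ece1e170b7ee6d97e62e5170b45bd6dbe2ea2070b0c873bab03e0a70ad3443d8de203c70a99f46dabf1d8770a6097c6468225370a272e419b04359709edb7d9e30861b709b43489543a9207097aa44a205ebef709410716754d6cf709075ce87cf0241708cda5ba5d3de4470893e186383794c7085a10462be47087082031f4524e6d9707e6468ac17ea0f707ac4e038b799e7707724858be3bd4270738358463b5e1a706fe158081c8ebb706c3e8471a42eae70689add22adaf6f7064f661bad2d8d370615111d96b8d30705daaed1d8d8d3f705a03f3260c3bbe70565c23917860c57052b37dfe1fecda704f0a020a0dbbc4704b5faf5309570d7047b4857696b8467044088411f60b0470405baac2236e90703cadf923d6b7547038ff6ed38330017035500b6d575a6870319fce8d3cb00c702deeb7ced7626f702a3cc6cd861b0f702689fb2461bb1d7022d6546e3d1aea701f21d245a4c906701b6c7444dec9147017b63a05ea525a7013ff23227f8df97010472f340f54e2700c8e5dd3c2ed7a7008d4ae9a7bc8f270051a2120d3405070015eb4ff1a512b6ffda269cd595a196ff9e53f234fd6cf6ff6273498741bec6ff2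6849c3f3127a6feea87e3caff31e6feae7d1994400f66fe726436ffe44256fe363d356e3440d6fdfa080e3acc13e
    (Nat.mul (Nat.pow 2 4096) (Nat.add 0x71a3d65d4e9c686071a076fbce500332719d16e42a763b5c7199b6161625bcc571965491444471c57192f255678759e4718f8f6232726076718c2bb7575832ff7188c754885a1774718562397767c24c7181fc65d63f2c63717e95d9566c68b6717b2e93a94979ec7177c6947ffe27b471745ddb8b7fd3f67170f4687c914fd8716d8a3b03c2b08e716a1f52d17124097166b3af95c6c5677163475100ba7144715fda36c20f99d3715c6c6089561aca7158fdce05ea0d1d71558e7ee6f39a9271521e72db66d118714eada9920375f8714b3c22b954d8d27147c9ddffb1a66b714456db133bbb487140e319a1dff61c713d6e99595609fd7139f959e72050747136835af88b9b4e71330c9c3aaf0643712f951d5a6bc86b712c1cde046d057b7128a3dde5279ed471252a1ca8da04607121af99fb8c0537711e3455890ea010711ab84efcfbd38971173b8602b66e2b7113bdfa4569de4771103fab700a0198710cc0992d52f4af710940c327c8e2317105c02909b7d1d571023eca7d33773870febca72c17007070fb39bec004e47370f7b610e266b13f70f4319d3c6cd9d070f0ac63770e83df70ed26633b09556770e99f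9c30e141f270e6180e00e057b670e28fb853168c6a70df069acf5989f870db7cb51d447adf70d7f206e437d67170d4668fcb592cc670d0da4f7992f28270cd4d4595944c5c70c9bf71c5d0da69
    (Nat.mul (Nat.pow 2 4096) (Nat.add 0x72761a6eaccec6c27272e6456a7e30a0726fb177cdbed3a7726c7c0594a4c41f726945ee7d1c650b72660f3244ea48407262d7d0a9ab0e66725f9fc968d346d0725c671c3faf4f3972592dc8eb63335e7255f3cf28ea8c797252b92eb5186099724f7de74c9701db724c41f8abe7ed82724905628f63aaec7245c824b339aa6672428a3ed37023df723f4bb0abe3f57c723c0c79f84882007238cc9a74278f2372358c11dae123b572324adfe7ab65a7722f0904559277f8722bc67edf78586e7228834f4014bd3e72253f7531f4f2857221faf06f7bb7a4721eb5c0b2e11c76721b6fe5b6325e607218295f3351c5467214e22ce3f6805272119a4e81ac829a720e51c3c5d45fa7720b088c69a327d27207bea82622447a72047416b42f5420720128d7cc7c065171fddceb278df77371fa90507dbe8c6b71f74307873ace1d71f3f50ffc0344c671f0a66993ebd33071ed5714069b91c271ea070f0b8ca96671e6b65a5a0c2e4c71e364f5a939fa8571e012e0b008887871dcc01b253ccd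2e71d96ca4bf6e127a71d6187d3505d0f471d2c3a43c3f89d571cf6e198b28a0a471cc17dcd7a034bd71c8c0edd756fab171c5694c3fcf157e71c210f7c65bef9d71beb7f0202213e471bb5e350217064a71b803c621011c7671b4a8a33177562771b14ccbe7e1357b71adf03ff876970171aa92ff173f89a971a73508f8142684
    (Nat.mul (Nat.pow 2 4096) (Nat.add 0x733e19aab3c4bf99733b0c9ac53bc2907337fef5c9a2c8f17334f0bb880bd8237331e1ebc7685196732ed2864e88d9cb732bc28ae41d3f427328b1f94eb461517325a0d154bc16e573228f12bc811527731f7cbd4c2ed60e731c69d0c9cf7ed37319564cfb4bc64e73164231a66adb3e73132d7e90d24a73731018338005e4e3730d02503967a5a47309ebd4823797cd7306d4c01f93bc3e7303bd12d677ef527300a4cc6bbdce6f72fd8beca41c9d8472fa727344292c7072f758601055bc4272f43db2ccf1e46c72f1226b3e2a77da72ee0689280969e672eaea0c4e75b33d72e7ccf4753336a072e4af415fe2a59672e190f2d20164f572de72088ee9715d72db528259d1438d72d8325ff5cbb4ab72d511a125c7e26172d1f045ac9112ec72cece4d4cce990472cbabb7c903b7b672c88884e38f861472c564b45eacd2d5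72c24045fc7207d272bf1b397ed10d6872bbf58ea7972dc472b8cf45386cf80872b5a85cf2d6235d72b280d5983171e472af58aee9b8938c72ac2fe8a88008c872a906829577052e72a5dc7c716751f372a2b1d5fcf5304d729f868ef89f3bb7729c5aa724be4c1872992e1e418557c9729600f40f0155877292d3284d191e36728fa4babb8d4e9b728c75ab19f828e4728945f927cd7621728615a4a45a67947282e4ad4ec577eb727fb312e60e4c53727c80d5290d957272794df3d674f040
    (Nat.mul (Nat.pow 2 4096) (Nat.add 0x73fcc8ed7fa2176e73f9df67fc12caed73f6f55aae261d0973f40ac5645bb0f873f11fa7ed18139873ee340216a4a7a273eb47d3af2f91d173e85b1c84cba4fa73e56ddc65704e0d73e280131ef9800673df91c07f279fc873dca2e4539f6fed73d9b37e69e9fc7c73d6c38e8f74869073d3d31491906fec73d0e2103d73267d73cdf08160360fc473cafe67c6d6743773c80bc33e356a8473c518939317c2c773c224d89225f1b173bf309207ebfb8d73bc3bbfc0d95f4473b946618941014073b650772d59164373b35a00793b0e2373b062fd38e37e7d73ad6b6d38320d4a73aa735042e95b6573a77aa624aeef0073a4816ea90b1dfb73a187a99b68f832739e8d56c71631b0739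b9275f7430cd173989706f702444d73959b099148f53273929e7d90ee88c4738fa162c0ac9e4f738ca3b8eb1ef4de7389a57fdac354e37386a6b759f979c47383a75f3302fb5a7380a77730033753737da6ff1aff3a87737aa5f6bdddaa2d7377a45de266ad0b7374a2345243d47c73719f79d7000573736e9c2e3a07615e736b985144a72ef2736893e2c00dc2ec73658ee2754a68ae736289502d4d4ad1735f832bb0e75b9a735c7c74c8ca3d5e7359752b3d882aca73566d4ed793df1a735364df5f407e3673505bdc9cc17cba734d5246582a87e5734a481c596f6d7373473d5e686403627344320c4cbc0f9c73412625ce0b2f8c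
    (Nat.mul (Nat.pow 2 4096) (Nat.add 0x74b2fc618e49660d74b0334e7c61e44674ad69bf312610de74aa9fb38146398074a7d52b415c013474a50a2645ea508e74a23ea4635d45cd749f72a56e0a24ee749ca6293a2f47a77499d92f9bf40d6574970bb86768cb2a74943dc37086bb6d74916f508b2fedde748ea05f8b2f3727748bd0f0443820957489010289e6d7bc748630962fc01e0674835fab0931383474808e40e98fddd6747dbc57a41a28ab747ae9ef0bf683ff74781706f4339beb7475439f2fc84c9574726fb791939157746f9b4fec5c73db746cc66812d1fb2a7469f0ffd78b1aa674671b170d06a0fd746444ad85ab270374616dc313c6fe88745e965789902115745bbe6ab9241e9f7458e5fc74880c2a74560d0c8da8725c7453339ad6593bfe745059a72055a472744d7f313d402616744aa438fea2689a7447c8be35ed2f437444ecc0b4784720744210404b82752f743f333ccc316472743c55b6079193f4743977abce9644bf7436991df21967bc7433ba0c42db8b8f7430da769183ca51742dfa5cae9fb74d742b19be6aa34c9f7428389b95e8d8c5742556f400b0ec23742274c77b224677741f9215d549c433741caededf1a4bd47419cb22686cbb1c7416e6e040ffd4427414021838782b0e74111cca1e6011e8740e36f5c22786cd740b509af324203e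740869b98090fa1674058251398ea25074029a61ed2305bd73ffb1eb6a395caa
    (Nat.mul (Nat.pow 2 4096) (Nat.add 0x75616d127e7be4da755ec1bcfcdb7c72755c15f5681cfab9755969bb9a23c4b27556bd0f6cc022be75540ff0b9af33d27551625f5a9ae0a1754eb45b2919cebe754c05e3feaf53b3754956f9b4cb680e7546a79c24ca9a5c7543f7cb27f6022575414786978332d3753e96ce4c942e93753be5a22037592875393401eb676ab9753681ed870b628b7533cf64cbf679b375311c6792e815c6752e68f5b48bbb6d752bb50f097900fb752900b36a3380f275264be2af2acc807523969cb0ba5dea7520e0e147298af4751e2ab04aab7735751b7409935f06687518bcecf94ecead7516055a54710ab975134d517ca78c05751094d249bfacec750ddbdc937242b8750b227031638fb07508688cfb2335097505ae32c82c24df7502f3616fe4940d75003818c99dec0c74fd7c58ac94bcb674fac020eff0ae0b74f803716ac471dd74f54649f40db57a74f288aa62b5134174efca928d8e043574ed0c024b56d17874ea4cf972b885c274e78d77da46dec874e4cd7d58803e9774e20d09c3cd9ce474df4c1cf282784c74dc8ab6badcc78a74d9c8d6f304eaa074d7067d710d9bf274d443aa0af3e15674d1805c969efd1374cebc94e9e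05ed974cbf852da7394aa74c933963dfe3bb074c66e5eea0ff10f74c3a8acb42242a474c0e27f71989fbb74be1bd6f7c049b074bb54b31bd0448c74b88d13b2e9479074b5c4f89215adb2
    (Nat.mul (Nat.pow 2 4096) (Nat.add 0x7608bd5c2d7447eb76062d6293fd57eb76039cffdbbd3f8b76010c33e2fdaa0575fe7afe87f8085575fbe95fa8d586cd75f9575723af02a075f6c4e4d68cff6875f432089f679c9b75f19ec25c268b0675ef0b11eaa1022d75ec76f7289db5b675e9e271f3d2cabb75e74d8229e5cd1e75e4b827a86ba4ce75e222624ce88b0975df8c31f4cfff8e75dcf5967d84bdd175da5e8fc458b21775d7c71da68cee9b75d52f400151a09c75d296f6b1c6056775cffe4194f85f5c75cd652087e5eae175cacb93677ad35975c8319a1092280275c597345ff5d0db75c2fc62325e837275c061236473b7b275bdc577d2cb9ca475bb295f59eb0d2a75b88cd9d64584ae75b5efe7243d13c875b35287202254db75b0b4b9a63460ab75ae167e92a0c2e575ab77d5c1836ea375a8d8bf0ee6b2e075a6393a56c32eed75a3994774ffc6cf75a0f8e64571979e759e5816a3dbebd6759bb6d86bf02f9f7599152b794de50e7596730fa7829856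7593d084d209d3f575912d8ad44d14d8758e8a2189a3be6e758be648cd530eb9758942007a8e125275869d486c7598627583f8207e182691758152888a71ecef757eac806c6cb9d0757c0607fedfed9b75795f1f1c906e967576b7c5a0309ca075740ffb646044e8757167c043ac9594756ebf1418901164756c15f6bd72834175696c680ca8f1ce7566c267e07592e3756417f61307bf08
    (Nat.mul (Nat.pow 2 4096) (Nat.add 0x76a97c7aee44fae776a705c1fd6c2e0b76a48ea7de6fe39e76a2172c73592918769f9f4f9e232de7769d271140bb3adf769aae713d00a9a57698356f74c4dc117695bc0bc9cb3388769342461dc908557690c81e5265a0f6768e4d94493a2964768bd2a7e3d1aa557689575903a900777686dba78a2ed3a176845f9358c38e047681e31c50b9534d767f66425353f7c6767ce90541c8f772767a6b64fd3f6d167677ed6166d0094b76756efa5f85097c7672f02fc85a2ee876707101823cb592766df16f6e0b4b32766b71796c96061b7668f11f5e9e5c1c7666706124d7195b7663ef3e9fe4572176616db7b05b72ab765eebcc36c303e8765c697c1392d43b7659e6c72733d528765763ad5200170b7654e02e7442bfb576525c4a6e380114764fd801200d0fc1764d535269e01998764ace3e2bc03c3e764848c445ad7b9f7645c2e49798b8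6e76433c9f0163a6927640b5f362e0c393763e2ee19bd34cfe763ba7698bef36bc76391f8b12d9216e76369746102650af76340e9a635ca16376318587ebf27fec762efc0e894ede63762c722e1ac92ac47629e7e67fa9451476275d379727757f7624d221406c626c762246a35a91068e761fbabdc49ea6ea761d2e705d8ec8d0761aa1bb044b27d77618149d97adabc976158717f6805e8a7612f929ff7d61f376106ad3914ee5ac760ddc148a8f1cf6760b4cecc9c83476
    (Nat.mul (Nat.pow 2 4096) (Nat.add 0x7744296f6690090d7741ca17d6bbc086773f6a662b85517f773d0a5a4a2c14eb773aa9f417e377f37738493379d2f4dd7735e81855160bf5773386a28ebc3c67773124d20bc8fd1c772ec2a6b133b58e772c602063e7b6967729fd3f08c4333977279a02849c39687725366abc36aac37722d277944e355077206e28f1914c32771e097eb8a22055771ba478ce16991877193f1716784cf27716d95976447a107714733fd1ebfeec77120cca0dd352e2770fa5f80e527ebc770d3ec9b7b5153e770ad73eee3a2ba277086f579614521c7706071393698c4977039e72ca5349a9770135751ede5e0476fecc1a750af9d576fc6262b0cca2a676f9f84db60a2b6e76f78ddb689dace476f5230bac547dce76f2b7de64ef2b4b76f04c537621711776ede06ac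39231c676eb742430db6eff76e9077fa18a41ab76e69a7cf91ed22076e42d1c1b0c504c76e1bf5ceab8ebd076df513f4b7dcc1a76dce2c320a7087d76da73e84d73a03c76d804aeb515729076d595163ab136ae76d3251ec15e73c176d0b4c82c2778df76ce44125e0954f876cbd2fd39f3cec176c96188a2c95c9676c6efb47b5f1c5876c47d80a67ccb4376c20aed06dcbdbd76bf97f97f2bd72376bd24a5f209818d76bab0f24207a58776b83cde51aaa1ce76b5c86a036942fe76b3539539acbb3e76b0de5fd6d099e176ae68c9bd22c30976abf2d2cee36738
    (Nat.mul (Nat.pow 2 4096) (Nat.add 0x77d9355bb93c2dc677d6ebb9a7cb8b5677d4a1c3cefea5ad77d2577a16d9ad8f77d00cdc675685c377cdc1eaa864bd3177cb76a4c1e988f477c92b0a9bbfbe6977c6df1c1db7cd3a77c492d92f97b96777c24641b91b154677bff955a1f2fb8377bdac14d1c6091877bb5e7f3030574877b91094a4c3758777b6c2551706637177b473c06e758aac77b224d69282b8cf77afd5976a95194077ad8602de092f1177ab3618d430ced677a8e5d93453187777a69543e5ac710177a44458cf6e7c6b77a1f317d8c0175d779fa180e8bd50f3779d4f93e6776473779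afd50b8f4b30d7798aab74730bd84779657c7781c1de377940481329c81277791b0e45d8ca0e0778f5cf0dfbc3cd2778d08a69ff01495778ab40584e1e12777885f0d75404e84778609be57aef52e7783b41812c653b977815e1a8d13c850777f07c5ad198a34777cb119594ea337777a5a15781ee930777802b9efeaf76f7775ab06a708282b777352fb83c08de57770fa986c52eccd776ea1dd46f2b422776c48c9f9c7f78a7769ef5e6aef68647767959a807a4f1a77653b7e206e846c7762e10930c66ab27760863b9770e722775e2b153a515b05775bcf95ff3f9cf4775973bdcc07f2067757178c866b06fd7754bb02141de96e77525e1e5aca00e3775000e1400d07fb774da34aa979057f774b455a7c9445767748e7109ed952357746886cf5b6ed66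
    (Nat.mul (Nat.pow 2 4096) (Nat.add 0x786905766460e0287866d00a3b72bc6278649a4ffa530cbd786264478b6c4f2278602df0d9200d81785df74bcdc6d8df785bc05853b04459785989165522e02b78575185bc5c34b3785519a67390bd6e7852e17864ebe3f17850a8fb7a8ffae1784e702f9e9638e7784c3714bb0eb3a17849fdaaba005a8a7847c3f18568f1e8784589e9073d0dae78434f9129680c60784114e9d5cc11f0783ed9f2f6420299783c9eac74997db6783a63163a98d8947838273031fd19477835eafa4479f16f7833ae745bb9b9067831719e615d6923782f34783efc96bc782cf701de256d62782ab93b285ca9fe78287b24071d958278263cbc63d9ffa37823fe0427fa39817821befb3cdd1055781f7fa18bd7c81b781d3ff6fe36162e781afffb7d3a1bf17818bfaef21c616578167f11460bcfc278143e22622dac0d7811fce22f9d91a9780fbb50976d6ce1780d796d82a57574780b3738da4429187808f4b2873e45fc7806b1da727ec54678046eb084e6d58c78022b34a74dd54877ffe766c2814d4c77fda346bf44eb2e77fb5ed486527bb377f91a100059e53277f6d4f9160121fc77f48f8fafe43ab177f249d3b69540a177f003c5129c482077edbd63ac7762d577eb76af6c9a9a0a77e92fa83b6fe8f777e6e84e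0157370577e4a0a0a6a6521177e258a013a8e8a777e0104c30a0844177ddc7a4e5c4837477db7eaa1b42142a
    (Nat.mul (Nat.pow 2 4096) (Nat.add 0x78f3f4a8784f1bdc78f1d2190579c23878efaf409a64439c78ed8c1f2390209c78eb68b48d7708e778e94500c48ad71c78e72103b5358c9578e4fcbd4bd94d3978e2d82d74d05b3d78e0b3541c6d12f378de8e312ef9e68a78dc68c498b959cd78da430e45e5fde478d81d0e22b26d0e78d5f6c41b49465b78d3d0301bcd295d78d1a9521058b1e078cf8229e4fe739578cd5ab785c8f5c478cb32fadebaaeef78c90af3dbce007f78c6e2a268f5326578c4ba06721a6eba78c2911fe31fbd6378c067eea7deffa278be3e72ac29ebb978bc14abdbca087878b9ea9a2280a8d178b7c03d6c06e76878b59595a40da22078b36aa2b63d75a078b13f648e36b8e078af13db179178a478ace8063ddd730478aabbe5eca212e278a88f7a0f5e6b6b78a662c29189338678a435bf5e90c14e78a2087061db0582789fdad586c586ee789daceeb8a55ddb789b7ebbe2c72f727899503cf06f292678972171ccd8fc0c7894f25a6337d8437892c2f69eb66847789093466a76cc4d788e6349b1929596788c33005f1ac1c0788a026a5e17b6137887d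18799893ace7885a057fc66766f78836edb719de8f378813d11e415671d787f0afb3eaa15ae787cd8976c3064a4787aa5e657740a6f787872e7eb37ff2778763f9c123677ba78740c02b720e11a7871d81bc49fdb69786fa3e72553351f786d6f64c3d1e62d786b3a948aaa0b1b
    (Nat.mul (Nat.pow 2 4096) (Nat.add 0x797a54e7d402b081797843fd534ece59797632ce7d454ef87974215b403bcf3e79720fa38a81117b796ffda74a5cf9d9796deb666e108ad7796bd8e0e3d5e1b17969c61699e032d17967b3077e5bc63979659fb37f6df3eb79638c1a8b35204e7961783c8fc8b893795f64197b392f17795d4fb13b8ff7bf795b3b03becf845979592610f2f340f2795710d8c5ef90307954fb5b25b1c7a87952e59800202c2e7950cf8f4319ee2c794eb940dc7725e8794ca2acba08cfd8794a8bd2c998c8e4794874b2f8e9cab379465d4d35b767ed794445a16db6087d79422daf8e92e5d27940157785f4071b793dfcf941783d82793be434aeb720657939cb29bb41098c7937b1d8549f115b7935984068530b0579337e61e3d780b77931643cb49fafc8792f49d0c81784e1792d2f1e0ba39820792b14246ca129437928f8e3d8661bc57926dd5c3c40f2fd7924c18d8578ce3e7922a577a14d64f07920891a7cf702a4791e6c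7605a6832e791c4f8a28854eb4791a3256d2b555bf791814dbf1510d497915f719716b6ac67913d90f400fe02b7911babd4a4257f8790f9c237cff3133790d7d41c53b3b71790b5e180fe3b2cb79093ea649de3be179071eec6008dfc87904feea3f3a080a7902de9fd4407a917900be0d0be3559978fe9d31d2e20ba178fc7c0e15f45f5078fa5aa1c1ca5f5f78f838ecc30c627f78f616ef065b033d
    (Nat.mul (Nat.pow 2 4096) (Nat.add 0x79fc705a5d93b8f579fa6ffa4ae54d8379f86f5a182a5d9179f66e79b553df5779f46d59124cc00779f26bf81ef9e0c579f06a56cb3a139b79ee687506e6187079ec6652c1d099ff79ea63efebc62ac479e8614c748d41ef79e65e684be6385279e45b43618b454979e257dda5307bab79e054370683c6ab79de504f752ce6c379dc4c26e0cd6e9779da47bd3900bfd479d843126d5c081879d63e266d6e3dc679d438f928c01ced79d2338a8ed4241a79d02dda8f26913379ce27e9192d5e5179cc21b61c583e9079ca1b4188109ae179c8148b4bb98edf79c60d9356afe59979c40659984a165f79c1feddffd8418e79bff7207ca42d5879bdef20fdf1428879bbe6df72fc894a79b9de5bcafca5e779b7d595f521d58d79b5cc8de095eb0779b3c3437c7c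4b7979b1b9b6b7f1eb1f79afafe7820d4a0079ada5d5c9de70a379ab9b817e6eecc879a990ea8ec1ce1379a78610e9d3a2c079a57af47e9a744e79a36f953c05c42a79a163f310fe885b799f580dec672824799d4be5bd1b78ab799b3f7a71f0b99e799932cbf9b591d0799725da43320bd6799518a53d2792a979930b2cd650ee3a7990fd70fd62400d798eef71a108ffcd798ce12eafebf7df798ad2a818ab41f67988c3ddc9e0439d7986b4cfb21daac97984a57dbfef6a60798295e7e1dab6c27980860e065e024f797e75f01bf0f9ec797c658e11048182
    (Nat.mul (Nat.pow 2 4096) (Nat.add 0x7a7a8a4c619f59ff7a789975ec7216567a76a8632bf8ddea7a74b714118f96b57a72c5888e8cd0d57a70d3c09441c3f57a6ee1bc13fa4cb37a6cef7afefcea067a6afcfd468aba9f7a690a42dbdf7a4d7a67174bb0317f5d7a652417b4b1b7f77a6330a6da8ba77b7a613cf912e563de7a5f490e4edf93027a5d54e67f9568107a5b6081961ca0cb7a596bdf838582e97a57770038dad9637a5581e3a721f1c87a538c89bf5a998c7a5196f2727f1b597a4fa11db1843c567a4dab0b6d5939797a4bb4bb96e7c4cb7a49be2e1f1402b17a47c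762f6bc87347a45d05a0eba53417a43d91357e0d1f07a41e18ec2fdd5c47a3fe9cc40d995e87a3df1cbc236ab6d7a3bf98d37d20e8a7a3a0110926313cf7a380855c29b69647a360f5cb927143d7a34162566ac6d4e7a321cafbbcc1ebf7a3022fba921211f7a2e29091f40b8937a2c2ed80eba72037a2a3468681820467a2839ba1bddd9507a263ecd1a89f3587a2443a1549501fd7a224836ba71d3717a204c8d3c8d6d997a1e50a4cb4f0b2f7a1c547d571818e07a1a5816d044326f7a185b7127291fce7a165e8c4c16d2397a1461682f5761517a126404c12f082f7a106661f1dc227c7a0e687fb19729867a0c6a5df092b14c7a0a6bfc9efb65937a086d5bacf806f27a066e7b0aa967df7a046f5aa82a69b77a026ffa758ff9c87a00705a62e90e5779fe707a603ea3a6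
    (Nat.mul (Nat.pow 2 4096) (Nat.add 0x7af4e0022419aee87af2fdcb28e666a07af11b5b61d1f0c07aef38b2c179a4537aed55d13a761c7e7aeb72b6bf5b363c7ae98f6342b80e277ae7abd6b716fe367ae5c8110efd9b817ae3e4123cecb3fa7ae1ffda33604c317ae01b68e4cf9d0c7ade36be43ad11857adc51da426644607ada6cbcd363fde67ad88765e90a319c7ad6a1d575b7fbf67ad4bc0b6bc7a0107ad2d607bd8e85597ad0efca5d5d354d7acf09533d7f59217acd22a2503bb76f7acb3bb787d431e97ac95492d685c3027ac76d342e887b977ac5859b820f809d7ac39dc8c34908c37ac1b5bbe45e5a1d7abfcd74d773c7c57abde4f38ea8af847abbfc37fc17776e7aba134211d58b887ab82a11c1f35b627ab640a6fe7c57bb7ab45701b976f01a7ab26d21e4e490687ab0830772c19e8b7aae98b2550578027aacae227da26f737aaac357de85ca4a7aa8d8526997be467aa6ed1210bb6f0d7aa50196c5ceebc17aa315e07aab2c897aa129ef212410247a9f3dc2ab0859737a9d515b0a21ad067a9b64b830348ea37a9977da0f005ed17a978ac0983f585c7a959d6bbda68dde7a93afdb70e5e73e7a91c20fa3a81f357a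8fd4084792c0ce7a8de5c54e4624e47a8bf746a95d6fa47a8a088c4a6e8e027a881996230a333b7a862a6424bbd6487a843af64109af597a824b4c6974b54c7a805b668f789b1e7a7e6b44a48bcd607a7c7ae69a1f6fa7
    (Nat.mul (Nat.pow 2 4096) (Nat.add 0x7b6ba96b0adf70977b69d4fd7b3ce4757b68005a536cf6507b662b81872ab35f7b6456730a2cf1c57b62812ed0264ea77b60abb4ccc52c3e7b5ed604f3b3afe17b5d001f3897c0157b5b2a038f13029f7b5953b1eac2da877b577d2a3f40662b7b55a66c80207d437b53cf78a0f3aeef7b51f84e95463fb87b5020ee50a0279c7b4e4957c685100f7b4c718aea7452037b4a9987afe8f3e57b48c14e0a59a7a77b46e8dded38c8b87b4510374bf45a097b43375a19f6040b7b415e464aa312a97b3f84fbd15c73467b3dab7aa17eb2b87b3bd1c2ae61fb407b39f7d3eb5a12857b381dae4bb657897b364351c2c1c0a07b3468be43c2d9667b328df3c1fbc0af7b30b2f230aa267e7b2ed7b9830749f57b2cfc49ac47f7427b2b20a29f9c85947b2944c45030d5027b2768aeb12c4c7d7b258c61b5b1d7b87b23afdd50dfe5157b21d32175d0638a7b1f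f62e1798c08d7b1e19032949e5f77b1c3ba09df037eb7b1a5e06689392ba7b1880347c3748c67b16a22acbda20627b14c3e94a7651b47b12e56feb0184957b1106bea06cce6a7b0f27d55da4b0077b0d48b4159113867b0b695abb154a237b0989c941100a147b07a9ff9a5b6c617b05c9fdb9cceab97b03e9c392355d497b0209511660f8917b0028a639174b317afe47c2ed1b3bbf7afc66a7252b06987afa8552d4003ba87af8a3c5ec4fbc3f7af6c20060c9b8d9
    (Nat.mul (Nat.pow 2 4096) (Nat.add 0x7bdf19bb86961b5b7bdd52532d9d7acc7bdb8ab82cc18f6f7bd9c2ea78bc361d7bd7faea064387c27bd632b6ca09d7ae7bd46a50b8bdb1e87bd2a1b7c709d97b7bd0d8ebe99546cf7bcf0fed150325ec7bcd46bb3df2d4d07bcb7d5658ffe1ba7bc9b3be5ac209767bc7e9f337cd35a57bc61ff4e4b17b0b7bc455c355fb17d77bc28b5e803271eb7bc0c0c657dc15227bbef5fad178b1987bbd2afbe18519ee7bbb5fc97c7a418f7bb9946396cd3af47bb7c8ca24ef35e47bb5fcfd1b4d7db67bb430fc6e5177957bb264c81260a0bb7bb0985ffbdc8cb07baecbc41f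22e38a7bacfef4708d60277bab31f0e471ce697ba964b96f2209737ba7974e04ebf9dc7ba5c9ae9a1993ef7ba3fbdb22f0d5de7ba22dd393b3c5fa7ba05f97e0a070e77b9e9127fdf0e7d27b9cc283dfdb3ea37b9af3ab7a918a317b99249ec241de737b97555dab164caf7b9585e82934e1aa7b93b63e30bfa3d67b91e65fb5d491827b90164cac8d9f027b8e46050900b4dd7b8c7588bf3fadf57b8aa4d7c35855b57b88d3f2095466317b8702d7853986557b8531882b0948067b836003eec126497b818e4ac45a83657b7fbc5c9fcaa70a7b7dea397502bc6d7b7c17e137efd06e7b7a4553dc7acfb37b787291568884ca7b769f9999f996467b74cc6c9aaa84da7b72f90a4c73a9747b712572a32933597b6f51a5929b263e7b6d7da30e95585f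
    (Nat.mul (Nat.pow 2 4096) (Nat.add 0x7c4f5ff1e1ac18647c4da4da75a892e97c4be99315d3ed077c4a2e1bb7cbfdde7c487274512b3ccf7c46b69cd788c0067c44fa9540783aff7c433e5d8189fd157c4181f5904af0047c3fc55d6244966f7c3e0894ecfd0a6a7c3c4b9c25f6fbfb7c3a8e7302b1afa07c38d11978a8fcd17c37138f7d554c847c3555d5062b97ab7c3397ea089d65ba7c31d9ce7a18cb237c301b82500867d87c2e5d057fd365c57c2c9e57fedd77547c2adf79c286d5e27c29206ac02c40427c27612aed26f9337c25a1ba3eccc5dd7c23e218aa6fec4a7c222246255f31dd7c206242a4e5d9cc7c1ea20e1e4ba3937c1ce1a886d4c9707c1b2111d3c1fed27c196049fa506ed27c179f50efb9baa47c15de26a933f80b7c141ccb1bf1afc77c125b3e3d21dc0d7c10998001efe6f27c0ed7905f83a8d97c0d156f4b0166e77c0b531cb989d16b7c099098a03a024d7c07cde2f42b7b7a7c060afbaa74254f7c0447e2b8264d027c0284981250a30b7c00c11badfe398d7bfefd6d803682c07bfd398d7dfd4f507bfb757b9c52cccd7bf9b137d03384057bf7ecc20e9857717bf6281a4c7681937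bf463407ebf93577bf29e349a61727a7bf0d8f6944657e47bef13866154ce0c7bed4de3f66faf527beb880f487624617be9c2084c43a2897be7fbcef6afea1d7be635633c8f04cb7be46ec512b143f77be2a7f46de33f167be0e0f142edd204
    (Nat.mul (Nat.pow 2 4096) (Nat.add 0x7cbca74956862d0a7cbaf7dccbb95ffa7cb94842cb382ae67cb7987b4b6cfacc7cb5e88642bf346a7cb43863a79332f77cb28813704a46d97cb0d7959342b4607caf26ea06d7b2777cad7610c161695f7cabc509b934f1607caa13d4e4a4517f7ca8627239fe7e317ca6b0e1af8f58117ca4ff233b9faa8c7ca34d36d4752a9a7ca19b1c705275697c9fe8d405770f0f7c9e365d8a1f613c7c9c83b8f484b9e67c9ad0e63add49f87c991de5535c23fe7c976ab634313ad47c95b758d38960517c9403cd278e43f37c925013266671877c909c2ac6354fd77c8ee813fd1b1f4f7c8d33cec134f8a97c8b7f5b089ccb917c89cab8c9695d517c8815e7f9ae47737c8660e88f7bf6667c84abba80dfa8297c82f65dc3e36ae87c8140d24e8e1ba37c7f8b1816e364d27c7dd52f12e3bd027c7c1f17388c657b7c7a68d07dd768df7c78b25ad8bb99c97c76fbb63f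2c916e7c7544e2a71aae377c738de0067312647c71d6ae531fa2a67c701f4d830704b87c6e67bd8c0c9e027c6caffe6410922d7c6af81000efc1bf7c693ff25883c8b37c6787a560a2fd147c65cf290f206d927c64167d59cbe01b7c625da23671d06c7c60a4979adb6eaf7c5eeb5d7cce9e057c5d31f3d20df3247c5b785a9058b2e37c59be91ad6ad0cd7c5804991efcedb77c564a70dac456497c549018d67301987c52d59107b78fab7c511ad9643d480f
    (Nat.mul (Nat.pow 2 4096) (Nat.add 0x7d27179e307ad6df7d25734342f157427d23cebd2d5241087d222a0be6c01f6c7d20852f665ac21c7d1ee027a33f3c157d1d3af49487e2897d1b9596314c4bbb7d19f00c70a14ddc7d184a574998fdec7d16a476b342ae967d14fe6aa4aaef0d7d13583314db89eb7d11b1cffadb84057d100b414daf1b517d0e64870457c5b87d0cbda115d42ff17d0b168f79203c617d096f52253501ea7d07c7e91108cacb7d062054338f13747d04789383b8895d7d02d0a6f87309dd7d01288e88a9a1007cff804a2b44885d7cfdd7d9d72925e67cfc2f3d833a0ac37cfa86752656f2207cf8dd80b75cc0007cf734602d2580137cf58b137e8864837cf3e19aa259c4c97cf237f58f6b1c797c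f08e243c8b0a157ceee426a0854dd97ced39fcb222c88f7ceb8fa668297a557ce9e523b95c81707ce83a749c7c19177ce68f990845983f7ce4e490f37370647ce3395c54bd2c587ce18dfb22d76f087cdfe26d5473f24c7cde36b2e04185a87cdc8acbbcec0d197cdadeb7e11c7fdd7cd932774378e7377cd78609daa45d377cd5d96f9d3f0b7f7cd42ca881e62a077cd27fb47f33fde57cd0d2938bbfd80c7ccf25459e1e14107ccd77caace016ed7ccbca22ae944dc17cca1c4d99c62c957cc86e4b64fe2d157cc6c01c06c1cd597cc511bf75938e9c7cc36335a7f2f3fe7cc1b47e945c81437cc0059a3149b98f7cbe568875311e1f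
    (Nat.mul (Nat.pow 2 4096) (Nat.add 0x7d8ed5c53db965de7d8d3bee29ebbe5c7d8ba1ee0ff419797d8a07c4e79b283b7d886d72a8a7238c7d86d2f74adbcb427d853852c5fa65187d839d8511c1bbba7d82028e25ee1dbd7d80676dfa395ca67d7ecc24865acbe57d7d30b1c2073fdb7d7b9515a4f10cd27d79f95026c806017d785d613f397c877d76c148e5f03e6b7d752507129495967d73889bbccc46d47d71ec06dc3a90ca7d704f4868802af97d6eb260593b44b17d6d154ea60784147d6b7813467e05077d69daae323558337d683d1f60c181fc7d669f66c9b3f9767d650184649ba7607d6363782904e51d7d61c5420e797ba77d6026e20c80a2877d5e88581a9efecc7d5ce9a43056a2017d5b4ac64527091c7d59abbe508d1b7a7d580c8c4a0329ce7d566d302900ed167d54cda9e4fb858d7d532df97565799b7d518e1ed1aeb4cd7d4fee19f14486be7d4e4deacb91a20e7d4cad9157fe1b4f7d4b0d0d8def67f47d496c5f64c85d427d47cb86d3e92f3c7d462a83d2af6f937d44895658760c917d42e7fe5c9550097d41467bd662de3f7d3fa4cebd31b4d97d3e02f7085229c37d3c60f4af11ea207d3abec7a8bbf9317d391c6fec9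8af3f7d3779ed71edb8837d35d7402ffe14107d3434681e0a12ba7d329165334f55fb7d30ee376708cede7d2f4adeb06ebce17d2da75b06b6acde7d2c03ac611377ec7d2a5fd2b6b542487d28bbcdfec97a34
    (Nat.mul (Nat.pow 2 4096) (Nat.add 0x7df403d8738855b37df27401d6ee3b287df0e4042e9957467def53df72e8ac467dedc3939c38ffc97dec3320a2e4d9fc7deaa2867f4484b27de911c529ae0a867de780dc9a7535fd7de5efccc9eb909f7de45e95b06062177de2cd374620af517de13bb1837739977ddfaa0460ac7daf7dde182fd606b2f37ddc8633dbc9ca707ddaf4106a376e027dd961c5798eff6c7dd7cf53020d97767dd63cb8fbee05037dd4a9f75f68cc2d7dd3170e24b4255f7dd183fd4403fc6a7dcff0c4b589efa37dce5d6471754ef47dccc9dc6ff31af87dcb362ca92e04117dc9a255154e697f7dc80e55ac7a58737dc67a2e66d58b277dc4e5df3c8167f37dc35168259d00637dc1bcc91a4510467dc028021293fcc97dbe931306a1d3837dbcfdfbee84498e7dbb68bcc24eba957db9d3557a1227e87db83dc60ddd378d7db6a80e75bc33527db5122ea9b907da7db37c26a1db43b27db1e5f65628165d7db04f9dbea24f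647daeb91cd34a5d657dad22738c1e4d217dab8ba1e119c88b7da9f4a7ca3615d17da85d853f6a166f7da6c63a38aa46367da52ec6ade8ba5a7da3972a9715207f7da1ff65ec1cbdbf7da06778a4ea6dbb7d9ecf62b966a19f7d9d372421775f2f7d9b9ebcd5003fcd7d9a062ccbe26f867d986d73fdfcac157d96d492632b43ee7d953b87f34815437d93a254a62a8d0d7d9208f873a7a60e7d906f735391e7db
    (Nat.mul (Nat.pow 2 4096) (Nat.add 0x7e56c17a5501ae997e553b2a30e1b7347e53b4b4d7b19e527e522e1a4258ba2b7e50a75a69bc590b7e4f207546bfc08c7e4d996ad2442cd17e4c123b0528cfbd7e4a8ae5d84ad02e7e49036b448549317e477bcb42b1493c7e45f405cba5d1667e446c1ad837d49d7e42e40a613a36dd7e415bd45f7dcc647e3fd378cbd158ec7e3e4af79f018edc7e3cc250d1d90e807e3b39845d20653c7e39b092399e0cc27e38277a60166a447e369e3cc94bcda97e3514d96dfe70bf7e338b5046ec766e7e3201a14cd1e9eb7e3077cc7868bde97e2eedd1c268cbcc7e2d63b12387d2d87e2bd96a947977667e2a4efe0def420d7e28c46b88989edb7e2739b2fd22dc7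d7e25aed464392b747e2423cfb6849d3e7e2298a4ecac238c7e210d53ff548f677e1f81dce72090677e1df63f9cb0b3d97e1c6a7c18a363ef7e1ade925394e6ed7e195282461f5e527e17c64be8dac6097e1639ef345cf38f7e14ad6c2139951f7e1320c2a80230e07e1193f2c146240b7e1006fc6592a2157e0e79df8d72b3dc7e0cec9c316f36cc7e0b5f324a0edc077e09d1a1cfd627917e0843eabb476f757e06b60d04e2daeb7e052808a52661817e0399dd948dca417e020b8bcb92aad77e007d1342ac66b67dfeee73f2502e3b7dfd5fadd2f0fdd87dfbd0c0dcff9d317dfa41ad08ea9e457df8b2724f1e5c907df72310a804fc2c7df593880c0668f7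
    (Nat.mul (Nat.pow 2 4096) (Nat.add 0x7eb72c116a7eeb917eb5aed64433294b7eb431779f07c58b7eb2b3f57460046c7eb1364fbd9d50d97eafb886741f3be87eae3a9991437c207eacbc890e65eccd7eab3e54e4e08d4d7ea9bffd0e0b805f7ea84181833d0b707ea6c2e23dc995ea7ea5441f3703a87f7ea3c538683bec797ea2462dcac12b047ea0c6ff57e04c7d7e9f47ad08e457bc7e9dc836d716715f7e9c489cbbbddb177e9ac8deb01ff2f57e9948fcad8032ae7e97c8f6ad202eee7e9648cca83f969b7e94c87e981c32217e93480c75f1e2bf7e91c7763afaa1c87e9046bbe06e7ff57e8ec5dd5f83a4a67e8d44dab16e4d2d7e8bc3b3cf60cc177e8a4268b28b88707e88c0f9541cfd0e7e873f65ad41b7d47e85bdadb72458f97e843bd16aed92507e82b9d0c1c4268d7e8137abb4cce8897e7fb5623d2aba877e7e32f453fe8d7a7e7cb061f26760497e7b2dab11823f117e79aacfaa6a426c7e7827cfb6388eaf7e76a4ab2e0453357e7521620ae2c9977e739df445e734f87e721a61d822e1427e7096aabaa522657e6f12cee67b539e7e6d8ece54b0d6b57e6c0aa8fe4f133c7e6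a865edc5d75d17e6901efe7e16f5e7e677d5c19de74557e65f8a36b55fbf47e6473c5d5477f7f7e62eec350b079837e61699bd68c650e7e5fe44f5fd4bcf17e5e5edde580fafd7e5cd9476086973e7e5b538bc9d907377e59cdab1a69bd227e5847a54b282727
    (Nat.mul (Nat.pow 2 4096) (Nat.add 0x7f155efce2146a7e7f13ea6cfcbf0f097f1275bb312c1d7e7f1100e7792fc2887f0f8bf1ce9c7b447f0e16da2b4314a37f0ca1a088f2aad17f0b2c44e178a8937f09b6c72ea0c6a97f0841276a350b337f06cb658dfdc90f7f05558193c19f3d7f03df7b7545783b7f0269532c4c896c7f00f308b29852737eff7c9c01e89c957efe060d13fb7a1a7efc8f5be28d45a87efb18886758a1a87ef9a1929c1677a17ef82a7a7a7df7947ef6b33ffc4497637ef53be31b1e12247ef3c463d0bc67877ef24cc216cfdb317ef0d4fde706f4167eef5d173b0e7bda7eede50e0c917e2a7eec6ce25539481c7eeaf4940ead67877ee97c233293aa607ee8038fba901e177ee68ad9a0450ef17ee51200dd53075f7ee399056b58cf5f7ee21fe743f36bd27ee0a6a660be1dd57edf2d42bb52621e7eddb3bc4d47f0537edc3a131034ba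627edac046fdacebdc7ed946580f42e94b7ed7cc463e874f8d7ed652118508f3287ed4d7b9dc54dfa37ed35d3f3df656df7ed1e2a1a376d06b7ed067e1065df8db7eceecfd6031b1217ecd71f6aa760ddd7ecbf6ccdead56ba7eca7b7ff65805bd7ec9000feaf4c69d7ec7847cb60076177ec608c650f621427ec48cecb54f04e47ec310efdc828cc57ec194cfc00653007ec0188c594e1f5d7ebe9c25a1cbe69b7ebd1f9b92efc9c97ebba2ee262815967eba261d54e141a17eb8a9291885efcd
    (Nat.mul (Nat.pow 2 4096) (Nat.add 0x7f7173c34559b2f67f70077bf1a503c57f6e9b14355fd5357f6d2e8c0ac569f77f6bc1e36c0f7a537f6a551a537633997f68e830bb3037987f677b269d729c0d7f660dfbf470ea197f64a0b0ba5d1db17f633344e967a5137f61c5b87bbf60357f60580b6b91a0397f5eea3db30a26de7f5d7c4f4c5325f07f5c0e4031953ebb7f5aa0105cf7817a7f5931bfc89f6cc97f57c34e6eb0ed167f5654bc494e5c0c7f54e6095298800b7f53773584ae8b8f7f520840d9ae1ca57f50992b4bb33c5a7f4f29f4d4d85e247f4dba9d6f365f577f4c4b2514e486927f4adb8bbff8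83297f496bd16a866c987f47fbf60ea0c1ec7f468bf9a65869337f451bdc2bbcaee87f43ab9d98db45617f423b3de7c0443a7f40cabd127627bf7f3f5a1b1305d05f7f3de957e37682107f3c78737dcde3be7f3b076ddc0ffeb67f399646f83f3e117f3824fecc5c6e1f7f36b3955266bbce7f35420a845bb4197f33d05e5c37436f7f325e90d3f3b51d7f30eca1e589b2b77f2f7a918af043827f2e085fbe1ccbdc7f2c960c79030ca67f2b2397b59522a97f29b1016dc386007f283e499b7d09827f26cb7038aeda257f2558753f447e677f23e558a927d5b77f22721a704117d97f20feba8e76d44b7f1f8b38fdadf1b17f1e1795b7c9ad337f1ca3d0b6ab99ea7f1b2fe9f433a0417f19bbe16a3ffd587f1847b712ad426f7f16d36ae7565445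
    (Nat.mul (Nat.pow 2 4096) (Nat.add 0x7fcb823c0c5d38e57fca1de10b665da87fc8b96706e90e0e7fc754cdf97edbe07fc5f015ddbfefb67fc48b3eae4308797fc32648659d7ae97fc1c132fe63311b7fc05bfe7326a9fb7fbef6aabe78f8ce7fbd9137dae9c4b57fbc2ba5c30748287fbac5f4715e507e7fb96023e07a3d687fb7fa340ae500737fb69424eb271c897fb52df67bc7a56e7fb3c7a8b74c3f427fb2613b98391e017fb0faaf191105007faf94033455466a7fae2d37e485c2c57facc64d2420e86b7fab5f42eda3b3087fa9f8193b89ab1d7fa890d0084ce5797fa729674e6602b87fa5c1df084c2ec17fa45a37307520437fa2f26fc15518307fa18a88b55ee13b7fa022820703cf577f9eba5bb0b3bf2e7f9d5215acdd15a07f9be9aff5ecbf417f9a812a864e2fcf7f991885586b61b07f97afc066acd5707f9646dbab7991377f94ddd7213720467f9374b2c24992717f920b6e89137b9a7f90a20a6ff5f3287f8f3886715093867f8dcee2878179967f8c651eace544307f8afb3adbd713967f8991370eb088f17f8827133fc9c5c87f86bccf69796b767f85526b86149aa57f83e7e78feef2c57f827d43815a91837f81127f54a812417f7fa79b04268d8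d7f7e3c968a2398987f7cd171e0eb44aa7f7b662d02c81e9e7f79fac7ea032e527f788f4290e3f6237f77239cf1b0725b7f75b7d706ad18b07f744bf0ca1cd7af7f72dfea3641163a
    (Nat.mul (Nat.pow 2 4096) (Nat.add 0x8023a0b4b78693e5802243efae80874a8020e70cf06e6384801f8a0c78402ca4801e2cee40e49b58801ccfb245491c7a801b72588059d09f801a14e0ed018ba88018b74b8629d44b8017599846bae3a78015fbc7299ba4cc80149dd829b1b45180133fcb41e15fd98011e1a06d0da5a680108357a6183424800f24f0e7e16978800dc66c2d48530a800c67c9712aad14800b0908ae64e22f8009aa29dfd20adc80084b2d004bed148006ec120aaafbd080058cd8f9c6569a80042d81c873c9138002ce0c7187ca8280016e78efd57d5d80000ec73e2eaed57ffeaef75763d6637ffd4f093644154b7ffbeefcd59d36327ffa8ed2303bac9c7ff92e8940ea947f7ff7ce220273b1c87ff66d9c6f9f6fe77ff50cf88334e1567ff3ac3637f9bf257ff24b5588b268807ff0ea567021e23b7fef8938e909d6577fee27fcee2a938d7fecc6a27a430cd67feb65298810d8f17fea0392125031ec7fe8a1dc13bbf4ad7fe74007870da0787fe5de1466fd56747f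e47c02ae41d9367fe319d257908c457fe1b7835d9d73a17fe05515bb1b334a7fdef2896abb0ec77fdd8fde672ce8aa7fdc2d14ab1f42137fdaca2c313f3a3f7fd96724f4388e037fd803feeeb597567fd6a0ba1b5f4cd67fd53d5674dd414b7fd3d9d3f5d5a32d7fd2763298ed3c277fd1127258c7709c7fcfae9330063f2b7fce4a95194a40317fcce6780f32a54d
    (Nat.mul (Nat.pow 2 4096) (Nat.add 0x8079e412012180e780788e91fb98dc74807738f57acb60808075e33c79f8740d80748d66f45e4d8480733774e539f2538071e16647c7368180708b3b1740bc4d806f34f34edff3c2806dde8ee9dd1a59806c880de36f3a8b806b317036cc2b6d8069dab5df28904a806883ded7b7d83b80672ceb1bac3dc18065d5daa636c65980647ead7287421b806327637bcc4b4e8061cffcbd3346038060787931e85fa9805f20d8d5168ea8805dc91ba1e791f7805c71419383f0b5805b194aa512f9c08059c136d1bac3498058690614a02a6e805710b868e6d2d18055b84dc9b1262d80545fc6322053ee805307219d5450c38051ae60066bd63b8050558168846254804efc85beba3716804da36d04285a25804c4a3733e89458804af0e44913714e804997743ec03f0280483de710050d618046e43cb7f6adde80458a7531a8b30880443090782d7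01a8042d68e8695f89680417c6f57f21fd180402232e750788d803ec7d92fbe548b803d6d622c47c41b803c12cdd7f795b4803ab81c2dd7558580395d4d28ef4d0680380260c446828e8036a756fae2b8e480354c2fc7c86ecf8033f0eb25fadeae80329589107bfe0380313a09824c7d0a802fde6c766bc648802e82b1e7d7fe1c802d26d9d18e0253802bcae42e8969b7802a6ed0f9c483a0802912a02e3857838027b651c6dca486802659e5bea7e10f8024fd5c108f3a53
    (Nat.mul (Nat.pow 2 4096) (Nat.add 0x80ce5feda2652e5580cd1166a15a0b6380cbc2c44bca9af580ca74069d3f4c7680c9252d913f76db80c7d6392351584680c687294efa15ae80c537fe0fbdba8080c3e8b7611f384380c299553ea0663d80c149d7a3c2011680bffa3e8c03aa7b80beaa89f2e3e8c180bd5ab9d3e0268880bc0ace2a74b26080babac6f21cbe6a80b96aa426525ff980b81a65c28e8f3980b6ca0bc24926cc80b5799620f8e37080b42904da1363a280b2d857e90d273a80b1878f49598f1380b036aaf66adca980aee5aaebb231bc80ad948f249f8ff080ac43579ca1d87180aaf2044f26cb9080a9a095379b086580a84f0a516a0c7380a6fd6397fe334380a5aba106c0b60980a459c29919ab4280a307c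84a70065480a1b5b21629973080a0637ff7ab09ed809f1131ea57e66e809dbec7e9928ffc809c6c41f0bc44e9809b199ffb351e2b8099c6e2045c0f0080987408078ee48a80972112002a456b8095cdffe989b16b80947ad1bf07810d809327877bfce5368091d4211bc1e6c48090809e99ad6631808f2cfff1151b2c808dd9451d4d943b808c856e19aa3655808b317ae17d3c828089dd6b7017b7778088893fc0c98d2f808734f7cee1788f8085e09395ad08ff80848c131078a202808337763a8f7adc8081e2bd0f3b9e2580808de789c5e969807f38f5a5760cc4807de3e75d928a7e807c8ebcad60b6a3807b39759024b6a2
    (Nat.mul (Nat.pow 2 4096) (Nat.add 0x812126b11645d581811fdedbaa913f86811e96ebff942943811d4ee2111a4f86811c06bddaee6c70811abe7f58da37268119762686a6637b81182db3601aa1a08116e525e0fd9dcc81159c7e0514fff0811453bbc8256b5981130adf25f27e688111c1e81a3ed233811078d6a0cbfa3b810f2faab55a8410810de66453a9f703810c9d037778d3ca810b53881c849436810a09f23e89aad58108c041d94382a081077676e86c7eab81062c9167bdf9c88104e29152f0463781039876a5baad5181024e415bd36f2e810103f170efc25680ffb986e0c3d36580fe6f01a702c4b980fd2461bf5eae1b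80fbd9a725889c6980fa8ed1d530914080f943e1ca0582a380f7f8d6ffb55aab80f6adb171ecf72980f562711c58295280f41715faa1b56b80f2cba00873526d80f1800f4175a9b280f03463a150569a80eee89d23a9e63680ed9cbbc427d6f280ec50bf7e6e983780eb04a84e218a1b80e9b8762ee2fd0280e86c291c54314c80e71fc1121556f780e5d33e0bc58d4a80e486a00502e27c80e339e6f96a535b80e1ed12e497caf380e0a023c226223580df53198daf1f9d80de05f442cb76db80dcb8b3dd12c87680db6b58581ba17880da1de1af7b7b0d80d8d04fdec6ba3080d782a2e190af4c80d634dab36b95e680d4e6f74fe8943e80d398f8b297baf980d24aded70804c580d0fca9b8c755fa80cfae5953627c49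
    (Nat.mul (Nat.pow 2 4096) (Nat.add 0x817249adb5a02bd081710846a450ccc3816fc6c658cc799d816e852ccf1d0ea5816d437a034b792f816c01adf15fb750816abfc89560d79381697dc9eb54f8ae81683bb1ef4149398166f9809d2a075c8165b735f112808a816474d1e6fd1133816332547aeb24768161efbda8dd33d88160ad0d6cd2c6f6815f6a43c2ca733a815e2760a6c1db8c815ce46414b5b009815ba14e08a1adb5815a5e1e7e809e2d81591ad5724c575c8157d772dffdbb2e815693f6c38cb7418155506118f0449881540cb1dc1e67528152c8e9090c2e57815185069badb30c8150410a8ff61908814efcf4e1d78dc3814db8c58d43484a814c747c8e2988ef814b3019e07998fe8149eb9d8021ca6b8148a707690f778781476257972f02af81461d8e066bd5fe8144d8aab2b06300814393ad97e6225f81424e96b1f5939a81410965fcc63caf813fc41b743ea9d2813e7eb714446d19813d3938d8bc1e30813bf3a0bd895a07813aadeebe8ec28181396822d7adfe298138223d04c7b7de8136dc3d41bb9e84813596238a6864b481344fefdaabc06a813309a22e626ab88131c33a81681f7281307cb8cf979cde812f361d14caa364812def674cd9f53f812ca897739d5625812b61ad84eb8afe812a1aa97c9a598e8128d38b567e8823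81278c530e6bdd4781264500a0351f698124fd9407ac14918123b60d40a1820a81226e6c46e52c11
    (Nat.mul (Nat.pow 2 4096) (Nat.add 0x81c1d9327bda6d0681c09dfa6b61f28181bf62aa16db170e81be27417a8925a681bcebc092ae8c3081bbb0275b8cdb3981ba7475d164c5b581b938abf07620b381b7fcc9b4ffe32181b6c0cf1b40258281b584bc1f7421a981b44890bdd8327a81b30c4cf2a7d39d81b1cff0ba1da14081b0937c107357ce81af56eef1e1d3ab81ae1a495aa110f081acdd8b46e82b2281aba0b4b2ed5cf181aa63c59ae5ffef81a926bdfb068c4d81a7e99dcf82989081a6ac65148cd95581a56f13c65720ff81a431a9e1125f7a81a2f42760eea1f081a1b68c421b128681a078d880c5f812819f3b0c191cb5d6819dfd27074bcb3c819cbf29477ed38a819b8112d5e0859e819a42e3ae9ab3aa8199049bcdd64ae78197c63b2fbb5352819687c1d070ef618195492fac1d5bc281940a84bee5ef0d8192cbc104ef197e81918ce47a5c64b181904def1b507354818f0ee0e3ed00e5818dcfb9d052e167818c9079dca20117818b512104f9642b818a11af457726838188d2249a387b6481879280ff59ad2d818652c470f61d11818512eeeb2842cc8183d3006a09ac5c8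18292f8e9b2fdb5818152d8663bf07b8180129edbbb53b7817ed24c46470b8d817d91e0a1f410f6817c515bead67170817b10be1d014ebc8179d0073486de8e81788f372d786a4681774e4e03e64ea581760d4bb3dffb838174cc303973f38681738afb90afcbd5
    (Nat.mul (Nat.pow 2 4096) (Nat.add 0x820fe49fb889029f820eaf5ae5baa47e820d79feb7354d62820c448b29717568820b0f0038e6c7d98209d95de20c22e68208a3a42157976a82076dd2f33e68b2820637ea54350c36820501ea40af29618203cbd2b51f9952820295a3adf8669a82015f5d27aacd01820028ff1ea7394581fef2898f5d48de81fdbbfc763bc9bb81fc8557cfb0ba0781fb4e9b982947e781fa17c7cc11d13e81f8e0dc67d5e36b81f7a9d967e03b0981f672bec89ac3b581f53b8c866e97c781f404429dc4001881f2cce10b0273c081f19567ca9097d781f05dd6d8d43f3281ef262e32326a2b81edee6dd30f465581ecb695b7ce2e4981eb7ea5dcd1a95a81ea469e3e7b6b5c81e90e7ed92c546181e7d647a944707a81e69df8ab22f77281e56591db264c9281e42d1335abfe6181e2f47cb710c65b81e1bbce5bb088bb81e083081fe6543181df4a2a000c61a481de1133f87c13f381dcd826058df7af81db9f002399c2dd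81da65c24ef654b481d92c6c83f9b55781d7f2febef9159b81d6b978fc48cebe81d57fdb383c622781d446256f26792781d30c579d58e4b381d1d271bf249d2181d09873d0d9c1ec81cf5e5dcec7996881ce242fb53c908981cce9e980863a9981cbaf8b2cf150f781ca7514b6c9b2d981c93a861a5a64ff81c7ffdf53ed917c81c6c5205fcc876881c58a493a3fbaa381c44f59df8ec39181c314524c005ed2
    (Nat.mul (Nat.pow 2 4096) (Nat.add 0x825c7a78e9ab49f3825b4aeee3ad00a8825a1b4e5d838dc88258eb9753d8b8218257bbc9c355886d82568be5a8a2491a82555beb0066861382542bd9c7490c868252fbb1f9efeaab8251cb7395006f8d82509b1e951f2ad1824f6ab2f6efec78824e3a30b715c4b0824d0997d2330390824bd8e844e938e8824aa8220bd934028249774523a3036b8248465188e5f4b7824715473840944d8245e4262e50ad298244b2ee67b348a18243819fe104ae318242503a96e0633c82411ebe85e12ad4823fed2baaa10580823ebb8201b93103823d89c187c2281f823c57ea3953a25d823b25fc130493d48239f3f7116b2ceb8238c1db311cda1f82378fa86eae43cd82365d5ec6b34df182352afe35bf17f08233f886b863fc5a8232c5f84b3390b382319352eabea532823060969395448d822f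2dc34246b3b8822dfad8f36171ab822cc7d7a373372a822b94bf4f08f687822a618ff2aedb6482292e498af04a7c8227faec1457e1668226c7778b6f7657822593ebecc017e78224604934d20cd982232c8f602cd3d78221f8be6b57233d8220c4d652d6e8db821f90d7133149b6821e5cc0a8eaa1cf821d2893108683e4821bf44e4687b934821abff24770414482198b7f0fc151a0821856f49bfb559f82172252e89dee288215ed99f227f1708214b8c9b5176ac3821383e22de99a4182124ee3591af4a6821119cd33272309
    (Nat.mul (Nat.pow 2 4096) (Nat.add 0x82a7a874f26ce8de82a67e705cd9346d82a5545616c6bb0982a42a261d0d0c2f82a2ffe06c8306be82a1d58501fed8c282a0ab13da55ff47829f808cf25d461f829e55f046e8c7b2829d2b3dd4cbecc9829c007598d96c59829ad5978fe34b548299aaa3b6badc6d82987f9a0a30bfeb8297547a8714e372829629452a3681cf8294fdf9f06422c48293d298d66b9ad28292a721d91a0b0782917b94f53be0ca82904ff2279cd5a4828f24396d07ef0a828df86ac2477e2e828ccc8624251fc6828ba08b8f69bbd6828a747b00dd857f828948547547fac882881c17e96fe4688286efc55a1b55918285c35cc40fabbd828496de24118e7782836a4976e4ef2582823d9eb94d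08d3828110dde80c5ffe827fe406ffe4c260827eb719fd9746b5827d8a16dde44c8a827c5cfd9d8b7c06827b2fce394bc5b5827a0288ade3624d8278d52cf80fd27f8277a7bb148ddebd82767a330019970282754c94b76e52a082741ee03746b0078272f1157c5c948f8271c33483692c418270953d4924e9a1826f672fca478577826e390c0387fe98826d0ad1f19c99af826bdc81913ae108826aae1adf17a45682697f9dd7e6f87e8268510a785c375d82672260bd29ff968265f3a0a30234548264c4ca2695fd1a826395dd4495c582826266d9f9b13d11826137c0429756f4826008901bf649d0825ed949827b8f87825da9ec72d3e501
    (Nat.mul (Nat.pow 2 4096) (Nat.add 0x82f17b8cdbcabe4a82f056db3659256182ef3214a50d067e82ee0d3924e882f082ece848b2ed17b582ebc3434c1b9d4882ea9e28ed74477682e978f993f6a52a82e853b53ca1a04282e72e5be4737d5e82e608ed8869dbaf82e4e36a2581b4cc82e3bdd1b8b75c7d82e298243f06808f82e17261b56a28a582e04c8a18dcb60482df269d6657e36982de009b9ad4c4d582dcda84b34bc75f82dbb458acb4b10282da8e178406a07182d967c136380ce182d84155c03ec5e082d71ad51f0ff31e82d5f43f4fa0144182d4cd944ee300b382d3a6d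419cbe77382d27ffead4d4ee282d159140659149582d0321421e06d2282cf0afefcd3e3f182cde3d494235b0c82ccbc94e4be0aeb82cb953feb92824782ca6dd5a58ea5e582c946560f9fb06a82c81ec126b2322382c6f716e7b210db82c5cf574f8a87a482c4a7825b2626ab82c37f98076ed30282c25798514dc67082c12f8335ab8f4182c00758b170101282bedf18c1827fa182bdb6c362c9689c82bc8e58922aa96c82bb65d84c8b740582ba3d428ed04db882b9149755dd0ef882b7ebd69e94e33082b6c30065da488d82b59a14a88f0fce82b4711363945c0e82b347fc93caa29682b21ed03611aaa782b0f58e47488d4b82afcc36c44db51e82aea2c9a9fede2082ad7946f539157e82ac4faea2d8b96382ab2600afb978c282a9fc3d18b6532582a8d263daa9987a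
    (Nat.mul (Nat.pow 2 4096) (0x8304dee329945a6f8303bb93665616618302982ee9b791a5830174b5b0c5bb2683005127b88ce09282ff2d84fe18ae2d82fe09cd7e742ea082fce60136a9cad082fbc22023c349ac82fa9e2a42c9cffe82f97a1f90c5e04282f856000abf5a7282f731cbadbd7bdc82f60d8276c6deee82f4e92462e17b0f82f3c4b16f12a46b82f2a029985f0bc5))))))))))))))))))))))))))))))))))))))))))))))))))))))))))))))))))))))))))))))))))))))))))))))))))))))))))))))))

/-- The integral part of `2 ^ 60 * log n`. -/
noncomputable def tlog (n : ℕ) : ℕ :=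
  Nat.mod (Nat.shiftRight logTable (Nat.mul 64 n)) (Nat.pow 2 64)

/-- Partial sums of `2 ^ 100 * log (1 + 1 / n)`, where `d = 2 * n + 1`, rounded down termwise. -/
noncomputable def logSum (d K : ℕ) : ℕ :=
  Nat.rec (motive := fun _ => ℕ) 0 (fun k ih => Nat.add ih (Nat.div (Nat.pow 2 101)
    (Nat.mul (Nat.add (Nat.mul 2 k) 1) (Nat.pow d (Nat.add (Nat.mul 2 k) 1))))) K

/-- An approximation to `2 ^ 100 * log (1 + 1 / n)`. -/
noncomputable def logInc (n : ℕ) : ℕ :=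
  logSum (Nat.add (Nat.mul 2 n) 1) (nif (Nat.ble n 31) 33 10)

/-- Verification of `cnt` entries of the table of logarithms, starting with that of `n`. -/
noncomputable def logLoop (cnt : ℕ) : ℕ → ℕ → Bool :=
  Nat.rec (motive := fun _ => ℕ → ℕ → Bool) (fun _ _ => true)
    (fun _ ih n L => band (Nat.beq (tlog n) (Nat.shiftRight L 40))
      (force (Nat.add L (logInc n)) fun L' => force (Nat.succ n) fun n' => ih n' L')) cnt

theorem logLoop_eq_true : logLoop 3600 1 0 = true := by
  decide +kernel

theorem logSum_le (d K : ℕ) : (logSum d K : ℝ) ≤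
    ∑ k ∈ Finset.range K, (2 : ℝ) ^ 101 * (1 / (2 * (k : ℝ) + 1) * (1 / (d : ℝ)) ^ (2 * k + 1)) ∧
    ∑ k ∈ Finset.range K, (2 : ℝ) ^ 101 * (1 / (2 * (k : ℝ) + 1) * (1 / (d : ℝ)) ^ (2 * k + 1)) ≤
      (logSum d K : ℝ) + K := by
  induction K with
  | zero => simp [logSum]
  | succ K ih =>
    have h : logSum d (K + 1) = logSum d K + 2 ^ 101 / ((2 * K + 1) * d ^ (2 * K + 1)) := rfl
    have h1 := Nat.floor_le (R := ℝ) (a := (2 ^ 101 : ℕ) / ((2 * K + 1) * d ^ (2 * K + 1) : ℕ))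
      (by positivity)
    have h2 := Nat.lt_floor_add_one (R := ℝ)
      ((2 ^ 101 : ℕ) / ((2 * K + 1) * d ^ (2 * K + 1) : ℕ) : ℝ)
    rw [Nat.floor_div_eq_div] at h1 h2
    have h3 : ((2 ^ 101 : ℕ) / ((2 * K + 1) * d ^ (2 * K + 1) : ℕ) : ℝ) =
        2 ^ 101 * (1 / (2 * (K : ℝ) + 1) * (1 / (d : ℝ)) ^ (2 * K + 1)) := by
      push_cast
      rw [one_div_pow, div_eq_mul_inv, one_div, one_div, mul_inv]
      norm_num
    rw [h3] at h1 h2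
    rw [Finset.sum_range_succ, h]
    push_cast at h1 h2 ⊢
    constructor <;> linarith

theorem logInc_le {n : ℕ} (hn : 1 ≤ n) : (logInc n : ℝ) ≤ 2 ^ 100 * Real.log (1 + (n : ℝ)⁻¹) ∧
    2 ^ 100 * Real.log (1 + (n : ℝ)⁻¹) ≤ logInc n + 35 := by
  have hn0 : (0 : ℝ) < n := by exact_mod_cast hn
  set K := nif (Nat.ble n 31) 33 10 with hKdef
  set d := 2 * n + 1 with hd
  have hdr : (d : ℝ) = 2 * n + 1 := by rw [hd]; push_cast; ring
  have hd3 : 3 ≤ (d : ℝ) := by rw [hdr]; have : (1 : ℝ) ≤ n := by exact_mod_cast hn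
                               linarith
  have hK : K ≤ 33 ∧ (2 : ℝ) ^ 101 ≤ d ^ (2 * K + 1) := by
    rw [hKdef, nif_eq]
    by_cases h : n ≤ 31
    · rw [if_pos (Nat.ble_eq.mpr h)]
      refine ⟨le_rfl, ?_⟩
      calc (2 : ℝ) ^ 101 ≤ 3 ^ (2 * 33 + 1) := by norm_num
        _ ≤ _ := by gcongr
    · rw [if_neg (by rwa [Nat.ble_eq])]
      refine ⟨by norm_num, ?_⟩
      have : (65 : ℝ) ≤ d := by exact_mod_cast (by omega : 65 ≤ d)
      calc (2 : ℝ) ^ 101 ≤ 65 ^ (2 * 10 + 1) := by norm_num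
        _ ≤ _ := by gcongr
  have hs := (Real.hasSum_log_one_add_inv hn0).mul_left (2 ^ 100)
  have hf : (fun k : ℕ => (2 : ℝ) ^ 100 * (2 * (1 / (2 * (k : ℝ) + 1)) *
      (1 / (2 * (n : ℝ) + 1)) ^ (2 * k + 1))) =
      fun k : ℕ => 2 ^ 101 * (1 / (2 * (k : ℝ) + 1) * (1 / (d : ℝ)) ^ (2 * k + 1)) := by
    funext k; rw [hdr]; ring
  rw [hf] at hs
  obtain ⟨h1, h2⟩ := logSum_le d K
  refine ⟨h1.trans (sum_le_hasSum _ (fun k _ => by positivity) hs), ?_⟩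
  have ht := (hasSum_nat_add_iff' K).mpr hs
  have hg : HasSum (fun k : ℕ => ((1 : ℝ) / 9) ^ k) (1 - 1 / 9)⁻¹ :=
    hasSum_geometric_of_lt_one (by norm_num) (by norm_num)
  have hle := hasSum_le (fun k => ?_) ht hg
  · have : (K : ℝ) ≤ 33 := by exact_mod_cast hK.1
    change _ ≤ (logSum d K : ℝ) + 35
    have : ((1 : ℝ) - 1 / 9)⁻¹ ≤ 2 := by norm_num
    linarith
  · have hq : (1 / (d : ℝ)) ^ 2 ≤ 1 / 9 := by
      rw [one_div_pow]
      apply one_div_le_one_div_of_le (by norm_num)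
      nlinarith
    have h4 : 2 ^ 101 * (1 / (d : ℝ)) ^ (2 * K + 1) ≤ 1 := by
      rw [one_div_pow, mul_one_div, div_le_one (by positivity)]
      exact hK.2
    have h5 : 1 / (2 * ((k + K : ℕ) : ℝ) + 1) ≤ 1 := by
      rw [div_le_one (by positivity)]
      have : (0 : ℝ) ≤ ((k + K : ℕ) : ℝ) := by positivity
      linarith
    calc (2 : ℝ) ^ 101 * (1 / (2 * ((k + K : ℕ) : ℝ) + 1) * (1 / (d : ℝ)) ^ (2 * (k + K) + 1))
        ≤ 2 ^ 101 * (1 * (1 / (d : ℝ)) ^ (2 * (k + K) + 1)) := by gcongr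
      _ = (2 ^ 101 * (1 / (d : ℝ)) ^ (2 * K + 1)) * ((1 / (d : ℝ)) ^ 2) ^ k := by
        rw [← pow_mul]; ring
      _ ≤ 1 * (1 / 9) ^ k := by gcongr
      _ = _ := one_mul _

theorem tlog_of_logLoop (cnt : ℕ) : ∀ n L : ℕ, 1 ≤ n → (L : ℝ) ≤ 2 ^ 100 * Real.log n →
    2 ^ 100 * Real.log n ≤ L + 35 * n → logLoop cnt n L = true →
    ∀ j, n ≤ j → j < n + cnt → (tlog j : ℝ) ≤ 2 ^ 60 * Real.log j ∧
      2 ^ 60 * Real.log j ≤ tlog j + 1 + 35 * j / 2 ^ 40 := by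
  induction cnt with
  | zero => intro n L _ _ _ _ j h1 h2; omega
  | succ cnt ih =>
    intro n L hn h1 h2 h j hj1 hj2
    have h' : band (Nat.beq (tlog n) (L >>> 40))
      (force (L + logInc n) fun L' => force (n + 1) fun n' => logLoop cnt n' L') = true := h
    rw [band_eq_true, force_eq, force_eq] at h'
    obtain ⟨h3, h4⟩ := h'
    rcases hj1.eq_or_lt with rfl | hj1
    · rw [Nat.eq_of_beq_eq_true h3, Nat.shiftRight_eq_div_pow]
      have e1 : ((L / 2 ^ 40 : ℕ) : ℝ) * 2 ^ 40 ≤ L := by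
        exact_mod_cast Nat.div_mul_le_self L (2 ^ 40)
      have e2 : (L : ℝ) ≤ ((L / 2 ^ 40 : ℕ) + 1) * 2 ^ 40 := by
        exact_mod_cast (Nat.lt_div_mul_add (a := L) (b := 2 ^ 40) (by positivity)).le.trans
          (by rw [add_mul, one_mul])
      constructor
      · linarith
      · have e3 : (35 * (n : ℝ) / 2 ^ 40) * 2 ^ 40 = 35 * n := by field_simp
        linarith
    · have hn0 : (0 : ℝ) < n := by exact_mod_cast hn
      have hlog : Real.log ((n + 1 : ℕ) : ℝ) = Real.log n + Real.log (1 + (n : ℝ)⁻¹) := by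
        rw [← Real.log_mul (by positivity) (by positivity)]
        congr 1
        push_cast
        field_simp
      obtain ⟨h5, h6⟩ := logInc_le hn
      refine ih (n + 1) (L + logInc n) (by omega) ?_ ?_ h4 j hj1 (by omega)
      · rw [hlog]; push_cast; linarith
      · rw [hlog]; push_cast; linarith

/-- Accuracy of the table of logarithms. -/
theorem tlog_bounds {n : ℕ} (h1 : 1 ≤ n) (h2 : n ≤ 3600) : (tlog n : ℝ) ≤ 2 ^ 60 * Real.log n ∧
    2 ^ 60 * Real.log n ≤ tlog n + (1 + 1 / 2 ^ 20) := by
  obtain ⟨h3, h4⟩ := tlog_of_logLoop 3600 1 0 le_rfl (by simp) (by simp) logLoop_eq_true n h1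
    (by omega)
  refine ⟨h3, h4.trans ?_⟩
  have : (n : ℝ) ≤ 3600 := by exact_mod_cast h2
  have : 35 * (n : ℝ) / 2 ^ 40 ≤ 1 / 2 ^ 20 := by
    rw [div_le_div_iff₀ (by positivity) (by positivity)]
    norm_num
    linarith
  linarith

/-! ### Certificates from the Euclidean algorithm -/

/-- The bound for `|X * tlog a - Y * tlog b|` excluded by the certificates. -/
noncomputable def slack : ℕ := 2700000

theorem slack_eq : slack = 2700000 := rfl

/-- `r` and `s` are a pair of (intermediate) remainders of the Euclidean algorithm for `U`, `V`. -/
def IsRemainders (U V r s : ℕ) : Prop :=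
  ∃ p₀ q₀ p₁ q₁ : ℕ, p₀ * U = r + q₀ * V ∧ q₁ * V = s + p₁ * U ∧ p₀ * q₁ = q₀ * p₁ + 1

namespace IsRemainders

variable {U V r s : ℕ}

theorem refl (U V : ℕ) : IsRemainders U V U V := ⟨1, 0, 0, 1, by simp⟩

theorem swap (h : IsRemainders U V r s) : IsRemainders V U s r := by
  obtain ⟨p₀, q₀, p₁, q₁, h1, h2, h3⟩ := h
  exact ⟨q₁, p₁, q₀, p₀, h2, h1, by rw [mul_comm, h3, mul_comm]⟩

theorem sub_left (h : IsRemainders U V r s) {k : ℕ} (hk : s * k ≤ r) :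
    IsRemainders U V (r - s * k) s := by
  obtain ⟨p₀, q₀, p₁, q₁, h1, h2, h3⟩ := h
  refine ⟨p₀ + k * p₁, q₀ + k * q₁, p₁, q₁, ?_, h2, ?_⟩
  · zify [hk] at h1 h2 ⊢
    linear_combination h1 - (k : ℤ) * h2
  · linear_combination h3

theorem mod_left (h : IsRemainders U V r s) : IsRemainders U V (r % s) s := by
  have := h.sub_left (Nat.mul_div_le r s)
  rwa [← Nat.mod_eq_sub] at this

theorem le_mul {T X Y : ℕ} (h : IsRemainders U V r s) (hr : slack ≤ r) (hs : slack ≤ s)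
    (hr' : r ≤ T) (hs' : s ≤ T) (hX : 0 < X) (hlt : |(X : ℤ) * U - Y * V| < slack) :
    U ≤ Y * T := by
  obtain ⟨p₀, q₀, p₁, q₁, h1, h2, h3⟩ := h
  zify at *
  obtain ⟨hl, hu⟩ := abs_lt.mp hlt
  set α : ℤ := X * q₁ - Y * p₁ with hα
  set β : ℤ := Y * p₀ - X * q₀ with hβ
  have hD : (X : ℤ) * U - Y * V = α * r - β * s := by
    rw [hα, hβ]
    linear_combination (X * q₁ - Y * p₁ : ℤ) * h1 - (Y * p₀ - X * q₀ : ℤ) * h2 -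
      ((X : ℤ) * U - Y * V) * h3
  have hXe : (X : ℤ) = α * p₀ + β * p₁ := by
    rw [hα, hβ]; linear_combination -(X : ℤ) * h3
  have hYe : (Y : ℤ) = α * q₀ + β * q₁ := by
    rw [hα, hβ]; linear_combination -(Y : ℤ) * h3
  have hUe : (U : ℤ) = q₁ * r + q₀ * s := by
    linear_combination (q₁ : ℤ) * h1 + (q₀ : ℤ) * h2 - (U : ℤ) * h3
  have hslack : (0 : ℤ) ≤ slack := by positivity
  have hα1 : 1 ≤ α := by
    by_contra hα0
    by_cases hβ0 : β ≤ 0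
    · have := mul_nonpos_of_nonpos_of_nonneg (by omega : α ≤ 0) (by positivity : (0 : ℤ) ≤ p₀)
      have := mul_nonpos_of_nonpos_of_nonneg hβ0 (by positivity : (0 : ℤ) ≤ p₁)
      omega
    · have := mul_nonpos_of_nonpos_of_nonneg (by omega : α ≤ 0) (hslack.trans hr)
      have := le_mul_of_one_le_left (hslack.trans hs) (by omega : 1 ≤ β)
      omega
  have hβ1 : 1 ≤ β := by
    by_contra hβ0
    have := mul_nonpos_of_nonpos_of_nonneg (by omega : β ≤ 0) (hslack.trans hs)
    have := le_mul_of_one_le_left (hslack.trans hr) hα1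
    omega
  have hY : (q₁ : ℤ) + q₀ ≤ Y := by
    have := le_mul_of_one_le_left (by positivity : (0 : ℤ) ≤ q₀) hα1
    have := le_mul_of_one_le_left (by positivity : (0 : ℤ) ≤ q₁) hβ1
    omega
  calc (U : ℤ) ≤ q₁ * T + q₀ * T := by rw [hUe]; gcongr
    _ = (q₁ + q₀) * T := by ring
    _ ≤ Y * T := by gcongr

end IsRemainders

/-- Small values of the linear form `X * U - Y * V` occur only for large coefficients. -/
def IsSeparated (U V W : ℕ) : Prop :=
  ∀ X Y : ℕ, 0 < X → 0 < Y → |(X : ℤ) * U - Y * V| < slack → 2 ^ 80 ≤ Y * W ∨ 2 ^ 80 ≤ X * U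

theorem IsRemainders.isSeparated {U V W T r s : ℕ} (h : IsRemainders U V r s) (hU : 0 < U)
    (hr : slack ≤ r) (hs : slack ≤ s) (hr' : r ≤ T) (hs' : s ≤ T) (hT : T * 2 ^ 80 ≤ U * W) :
    IsSeparated U V W := by
  intro X Y hX _ hlt
  left
  have h1 := h.le_mul hr hs hr' hs' hX hlt
  refine le_of_mul_le_mul_left ?_ hU
  calc U * 2 ^ 80 ≤ Y * T * 2 ^ 80 := by gcongr
    _ = Y * (T * 2 ^ 80) := by ring
    _ ≤ Y * (U * W) := by gcongr
    _ = U * (Y * W) := by ring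

/-- The last step of `euclidLoop`. -/
noncomputable def euclidEnd (T r s : ℕ) : Bool :=
  band (Nat.ble slack s) (band (Nat.ble s r) (Bool.rec (Nat.ble (Nat.add (Nat.mod r s) s) T) true
    (band (Nat.ble slack (Nat.mod r s)) (Nat.ble (Nat.mod r s) T))))

/-- The Euclidean algorithm, run until both remainders are at most `T`. -/
noncomputable def euclidLoop (T : ℕ) (fuel : ℕ) : ℕ → ℕ → Bool :=
  Nat.rec (motive := fun _ => ℕ → ℕ → Bool) (fun _ _ => false)
    (fun _ ih r s => Bool.rec (ih s (Nat.mod r s)) (euclidEnd T r s) (Nat.ble s T)) fuel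

/-- Certificate for a single pair of numbers. -/
noncomputable def euclid (U V : ℕ) : Bool :=
  Bool.rec (euclidLoop (Nat.shiftRight (Nat.mul U V) 80) 80 U V) true (Nat.beq U V)

theorem exists_of_euclidLoop {T U V : ℕ} (fuel : ℕ) : ∀ r s : ℕ, euclidLoop T fuel r s = true →
    (IsRemainders U V r s ∨ IsRemainders V U r s) →
    ∃ r' s', (IsRemainders U V r' s' ∨ IsRemainders V U r' s') ∧ slack ≤ r' ∧ slack ≤ s' ∧
      r' ≤ T ∧ s' ≤ T := by
  induction fuel with
  | zero => intro r s h; exact absurd h Bool.false_ne_true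
  | succ fuel ih =>
    intro r s h hrs
    have h' : (Bool.rec (euclidLoop T fuel s (r % s)) (euclidEnd T r s) (Nat.ble s T) : Bool) =
      true := h
    rw [rec_eq_ite] at h'
    split_ifs at h' with hs
    · have h'' : band (Nat.ble slack s) (band (Nat.ble s r) (Bool.rec (Nat.ble (r % s + s) T) true
        (band (Nat.ble slack (r % s)) (Nat.ble (r % s) T)))) = true := h'
      rw [rec_eq_ite, band_eq_true, band_eq_true] at h''
      obtain ⟨h1, h2, h3⟩ := h''
      rw [Nat.ble_eq] at hs h1 h2
      by_cases h4 : slack ≤ r % s ∧ r % s ≤ T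
      · exact ⟨r % s, s, hrs.imp (fun h => h.mod_left) (fun h => h.mod_left), h4.1, h1, h4.2, hs⟩
      · rw [if_neg (by rwa [band_eq_true, Nat.ble_eq, Nat.ble_eq]), Nat.ble_eq] at h3
        have hs0 : 0 < s := lt_of_lt_of_le (by norm_num [slack_eq]) h1
        have hd : 1 ≤ r / s := Nat.div_pos h2 hs0
        have e : s * (r / s - 1) + s = s * (r / s) := by
          rw [← Nat.mul_succ]; congr 1; omega
        have e2 := Nat.div_add_mod r s
        have e3 : r % s + s = r - s * (r / s - 1) := by omega
        refine ⟨r % s + s, s, ?_, by omega, h1, h3, hs⟩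
        rw [e3]
        exact hrs.imp (fun h => h.sub_left (by omega)) (fun h => h.sub_left (by omega))
    · exact ih _ _ h' (hrs.symm.imp (fun h => h.mod_left.swap) (fun h => h.mod_left.swap))

theorem isSeparated_of_euclid {U V : ℕ} (hU : 0 < U) (hV : 0 < V) (hUV : U ≠ V)
    (h : euclid U V = true) : IsSeparated U V V := by
  have h' : (Bool.rec (euclidLoop (Nat.shiftRight (U * V) 80) 80 U V) true (Nat.beq U V) : Bool) =
    true := h
  rw [rec_eq_ite, if_neg (by rwa [Nat.beq_eq])] at h'
  have hT : Nat.shiftRight (U * V) 80 * 2 ^ 80 ≤ U * V := by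
    change (U * V) >>> 80 * 2 ^ 80 ≤ U * V
    rw [Nat.shiftRight_eq_div_pow]
    exact Nat.div_mul_le_self _ _
  obtain ⟨r, s, h1 | h1, h2, h3, h4, h5⟩ := exists_of_euclidLoop 80 U V h' (Or.inl (.refl U V))
  · exact h1.isSeparated hU h2 h3 h4 h5 hT
  · intro X Y hX hY hlt
    have hlt' : |(Y : ℤ) * V - X * U| < slack := by rwa [abs_sub_comm]
    exact (h1.isSeparated (W := U) hV h2 h3 h4 h5 (by rwa [mul_comm V]) Y X hY hX hlt').symm

/-! ### Certificates for many pairs at once -/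

/-- A fixed sequence of conditional subtractions, applied to `r` and `s` before `k`: `c` subtracts
`2 ^ c * s` from `r`, and `16 + c` subtracts `2 ^ c * r` from `s`. -/
noncomputable def runSteps (H Ht : ℕ) (k : ℕ → ℕ → Bool) (l : List ℕ) : ℕ → ℕ → Bool :=
  List.rec (motive := fun _ => ℕ → ℕ → Bool) k
    (fun c _ ih r s => Bool.rec (ih r (condSub 73 (Nat.sub c 16) H Ht s r))
      (ih (condSub 73 c H Ht r s) s) (Nat.ble c 15)) l

/-- Invariant of `runSteps` in a lane. -/
def IsState (U V r s : ℕ) : Prop :=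
  IsRemainders U V r s ∧ slack ≤ r ∧ slack ≤ s ∧ r ≤ 9 * 2 ^ 60 ∧ s ≤ 9 * 2 ^ 60

theorem IsState.swap {U V r s : ℕ} (h : IsState U V r s) : IsState V U s r :=
  ⟨h.1.swap, h.2.2.1, h.2.1, h.2.2.2.2, h.2.2.2.1⟩

theorem IsState.condSub {U V r s : ℕ} (h : IsState U V r s) (c : ℕ) :
    IsState U V (if s * 2 ^ c + slack ≤ r then r - s * 2 ^ c else r) s := by
  split_ifs with hc
  · obtain ⟨h1, h2, h3, h4, h5⟩ := h
    exact ⟨h1.sub_left (by omega), by omega, h3, by omega, h5⟩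
  · exact h

theorem condSub_pack_of_le {l : List ℕ} {r s : ℕ → ℕ} {c : ℕ} (hc : c ≤ 9)
    (hr : ∀ b ∈ l, r b ≤ 9 * 2 ^ 60) (hs : ∀ b ∈ l, s b ≤ 9 * 2 ^ 60) :
    condSub 73 c (pack 74 l fun _ => 2 ^ 73) (pack 74 l fun _ => 2 ^ 73 - slack)
      (pack 74 l r) (pack 74 l s) =
    pack 74 l fun b => if s b * 2 ^ c + slack ≤ r b then r b - s b * 2 ^ c else r b := by
  have hs' : ∀ b ∈ l, s b * 2 ^ c ≤ 9 * 2 ^ 60 * 2 ^ 9 := fun b hb =>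
    Nat.mul_le_mul (hs b hb) (Nat.pow_le_pow_right (by norm_num) hc)
  have hsl := slack_eq
  exact condSub_pack (k := 73) (by omega) (fun b hb => by have := hr b hb; omega)
    (fun b hb => by have := hs' b hb; omega) (fun b hb => by have := hs' b hb; omega)

theorem exists_of_runSteps {U : ℕ} {V : ℕ → ℕ} {l : List ℕ} {k : ℕ → ℕ → Bool} (steps : List ℕ) :
    ∀ r s : ℕ → ℕ, (∀ c ∈ steps, c ≤ 9 ∨ 16 ≤ c ∧ c ≤ 25) → (∀ b ∈ l, IsState U (V b) (r b) (s b)) →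
    runSteps (pack 74 l fun _ => 2 ^ 73) (pack 74 l fun _ => 2 ^ 73 - slack) k steps
      (pack 74 l r) (pack 74 l s) = true →
    ∃ r' s' : ℕ → ℕ, (∀ b ∈ l, IsState U (V b) (r' b) (s' b)) ∧
      k (pack 74 l r') (pack 74 l s') = true := by
  induction steps with
  | nil => intro r s _ h hk; exact ⟨r, s, h, hk⟩
  | cons c steps ih =>
    intro r s hc h hk
    simp only [List.mem_cons, forall_eq_or_imp] at hc
    have hk' : (Bool.rec
        (runSteps (pack 74 l fun _ => 2 ^ 73) (pack 74 l fun _ => 2 ^ 73 - slack) k steps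
          (pack 74 l r) (condSub 73 (c - 16) (pack 74 l fun _ => 2 ^ 73)
            (pack 74 l fun _ => 2 ^ 73 - slack) (pack 74 l s) (pack 74 l r)))
        (runSteps (pack 74 l fun _ => 2 ^ 73) (pack 74 l fun _ => 2 ^ 73 - slack) k steps
          (condSub 73 c (pack 74 l fun _ => 2 ^ 73) (pack 74 l fun _ => 2 ^ 73 - slack)
            (pack 74 l r) (pack 74 l s)) (pack 74 l s)) (Nat.ble c 15) : Bool) = true := hk
    have hr : ∀ b ∈ l, r b ≤ 9 * 2 ^ 60 := fun b hb => (h b hb).2.2.2.1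
    have hs : ∀ b ∈ l, s b ≤ 9 * 2 ^ 60 := fun b hb => (h b hb).2.2.2.2
    rw [rec_eq_ite] at hk'
    split_ifs at hk' with hc'
    · rw [Nat.ble_eq] at hc'
      rw [condSub_pack_of_le (by omega) hr hs] at hk'
      exact ih _ _ hc.2 (fun b hb => (h b hb).condSub c) hk'
    · rw [Nat.ble_eq] at hc'
      rw [condSub_pack_of_le (by omega) hs hr] at hk'
      exact ih _ _ hc.2 (fun b hb => ((h b hb).swap.condSub (c - 16)).swap) hk'

/-- A sequence of steps suited to `U = tlog a` and `V = tlog b` for most `2 ≤ a, b ≤ 3600`. -/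
noncomputable def schedule : List ℕ :=
  [0, 18, 17, 16, 3, 2, 1, 0, 24, 19, 18, 17, 16, 4, 3, 2, 1, 0, 25, 23, 22, 21, 20, 19, 18, 17,
    16, 9, 8, 7, 6, 5, 4, 3, 2, 1, 0, 25, 19, 18, 17, 16, 5, 4, 2, 1, 0, 25, 24, 18, 17, 16,
    9, 3, 2, 1, 0, 23, 22, 21, 20, 19, 18, 17, 16, 9, 8, 7, 2, 1, 0, 25, 21, 19, 18, 17, 16,
    9, 6, 5, 4, 3, 2, 1, 0, 25, 24, 23, 22, 19, 18, 17, 16, 7, 2, 1, 0, 24, 19, 18, 17, 16, 7,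
    6, 5, 4, 3, 2, 1, 0, 20, 19, 18, 17, 16]

/-- Certificates for `U` and all entries of `V`, the smallest of which is at least `W`. -/
noncomputable def vecCheck (J H Ht V W U : ℕ) : Bool :=
  runSteps H Ht (fun r s => (fun TJ => checkFlagged (euclid U) 74 (Nat.shiftLeft V 73) 1000
    (Nat.sub H (Nat.land (Nat.land (Nat.sub (Nat.add TJ H) r) (Nat.sub (Nat.add TJ H) s)) H)))
      (Nat.mul (Nat.shiftRight (Nat.mul U W) 80) J)) schedule (Nat.mul U J) V

theorem isSeparated_of_vecCheck {U W : ℕ} {V : ℕ → ℕ} {l : List ℕ} (hU : slack ≤ U)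
    (hU' : U ≤ 9 * 2 ^ 60) (hV : ∀ b ∈ l, slack ≤ V b) (hV' : ∀ b ∈ l, V b ≤ 9 * 2 ^ 60)
    (hW : W ≤ 9 * 2 ^ 60)
    (h : vecCheck (pack 74 l fun _ => 1) (pack 74 l fun _ => 2 ^ 73)
      (pack 74 l fun _ => 2 ^ 73 - slack) (pack 74 l V) W U = true) :
    ∀ b ∈ l, U ≠ V b → IsSeparated U (V b) W ∨ IsSeparated U (V b) (V b) := by
  have hsl := slack_eq
  have h' : runSteps (pack 74 l fun _ => 2 ^ 73) (pack 74 l fun _ => 2 ^ 73 - slack)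
    (fun r s => checkFlagged (euclid U) 74 (pack 74 l V <<< 73) 1000
      ((pack 74 l fun _ => 2 ^ 73) -
        ((((U * W) >>> 80 * (pack 74 l fun _ => 1)) + (pack 74 l fun _ => 2 ^ 73) - r) &&&
        (((U * W) >>> 80 * (pack 74 l fun _ => 1)) + (pack 74 l fun _ => 2 ^ 73) - s) &&&
        (pack 74 l fun _ => 2 ^ 73)))) schedule (U * (pack 74 l fun _ => 1)) (pack 74 l V) = true :=
    h
  set T := (U * W) >>> 80 with hTdef
  have hT : T * 2 ^ 80 ≤ U * W := by
    rw [hTdef, Nat.shiftRight_eq_div_pow]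
    exact Nat.div_mul_le_self _ _
  have hT' : T < 2 ^ 73 := by
    have : U * W ≤ (9 * 2 ^ 60) * (9 * 2 ^ 60) := Nat.mul_le_mul hU' hW
    omega
  rw [mul_pack, mul_pack] at h'
  simp only [mul_one] at h'
  obtain ⟨r, s, hrs, hk⟩ := exists_of_runSteps schedule _ _ (by decide +kernel)
    (fun b hb => ⟨.refl U (V b), hU, hV b hb, hU', hV' b hb⟩) h'
  rw [geFlags_land_pack (k := 73) (fun _ _ => hT') (fun b hb => by have := (hrs b hb).2.2.2.1; omega)
    (fun _ _ => hT') (fun b hb => by have := (hrs b hb).2.2.2.2; omega),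
    pack_sub (fun b _ => by split_ifs <;> omega),
    pack_congr (f := fun b => 2 ^ 73 - if r b ≤ T ∧ s b ≤ T then 2 ^ 73 else 0)
      (g := fun b => if ¬ (r b ≤ T ∧ s b ≤ T) then 2 ^ 73 else 0)
      (fun b _ => by by_cases hb : r b ≤ T ∧ s b ≤ T <;> simp [hb])] at hk
  have hf := check_of_checkFlagged (k := 73) (fuel := 1000) (check := euclid U) (B := V)
    (P := fun b => ¬ (r b ≤ T ∧ s b ≤ T)) (l := l) (fun b hb => by have := hV' b hb; omega) hk
  intro b hb hne
  by_cases hT2 : r b ≤ T ∧ s b ≤ T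
  · obtain ⟨h1, h2, h3, -, -⟩ := hrs b hb
    exact Or.inl (h1.isSeparated (by omega) h2 h3 hT2.1 hT2.2 hT)
  · exact Or.inr (isSeparated_of_euclid (by omega) (by have := hV b hb; omega) hne (hf b hb hT2))

/-- The numbers `b` to be paired with the numbers `a` such that `gcd a 30 = g`. -/
noncomputable def isPartner (g b : ℕ) : Bool :=
  Bool.rec (band (Nat.ble g (Nat.gcd b 30)) (Nat.beq (Nat.gcd (Nat.gcd b 30) g) 1)) false (isPow b)

/-- Certificates for the pairs of logarithms of `a` and `b`, where `lo ≤ a < lo + cnt` and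
`blo ≤ b < blo + bcnt`. -/
noncomputable def pairsCheck (g lo blo bcnt cnt : ℕ) : Bool :=
  (fun J V => Nat.rec (motive := fun _ => Bool) true (fun i ih => band
    (Bool.rec (Bool.rec true (vecCheck J (Nat.shiftLeft J 73)
        (Nat.mul (Nat.sub (Nat.pow 2 73) slack) J) V (tlog blo) (tlog (Nat.add lo i)))
      (Nat.beq (Nat.gcd (Nat.add lo i) 30) g)) true (isPow (Nat.add lo i))) ih) cnt)
    (packRange 74 (isPartner g) (fun _ => 1) blo bcnt)
    (packRange 74 (isPartner g) tlog blo bcnt)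

theorem vecCheck_of_pairsCheck {g lo blo bcnt cnt a : ℕ} (h : pairsCheck g lo blo bcnt cnt = true)
    (h1 : lo ≤ a) (h2 : a < lo + cnt) (ha : isPow a = false) (hg : Nat.gcd a 30 = g) :
    vecCheck (pack 74 (lanes (isPartner g) blo bcnt) fun _ => 1)
      (pack 74 (lanes (isPartner g) blo bcnt) fun _ => 2 ^ 73)
      (pack 74 (lanes (isPartner g) blo bcnt) fun _ => 2 ^ 73 - slack)
      (pack 74 (lanes (isPartner g) blo bcnt) tlog) (tlog blo) (tlog a) = true := by
  induction cnt with
  | zero => omega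
  | succ i ih =>
    have h' : band (Bool.rec (Bool.rec true (vecCheck (packRange 74 (isPartner g) (fun _ => 1) blo bcnt)
          (packRange 74 (isPartner g) (fun _ => 1) blo bcnt <<< 73)
          ((2 ^ 73 - slack) * packRange 74 (isPartner g) (fun _ => 1) blo bcnt)
          (packRange 74 (isPartner g) tlog blo bcnt) (tlog blo) (tlog (lo + i)))
        (Nat.beq (Nat.gcd (lo + i) 30) g)) true (isPow (lo + i)))
        (pairsCheck g lo blo bcnt i) = true := h
    rw [band_eq_true] at h'
    by_cases hai : a = lo + i
    · subst hai
      have h3 := h'.1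
      rw [rec_eq_ite, rec_eq_ite, ha, if_neg Bool.false_ne_true, if_pos (by rwa [Nat.beq_eq]),
        packRange_eq, packRange_eq, pack_shiftLeft, mul_pack] at h3
      simpa only [one_mul, mul_one] using h3
    · exact ih h'.2 (by omega)

theorem tlog_mem {n : ℕ} (h1 : 2 ≤ n) (h2 : n ≤ 3600) : slack ≤ tlog n ∧ tlog n ≤ 9 * 2 ^ 60 := by
  obtain ⟨h3, h4⟩ := tlog_bounds (by omega) h2
  have h5 := log_le_of_le_3600 (a := n) (by omega) h2
  have h6 : Real.log 2 ≤ Real.log n := Real.log_le_log (by norm_num) (by exact_mod_cast h1)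
  have h7 := Real.log_two_gt_d9
  rw [slack_eq]
  constructor
  · have : (2700000 : ℝ) ≤ tlog n := by linarith
    exact_mod_cast this
  · have : (tlog n : ℝ) ≤ 9 * 2 ^ 60 := by linarith
    exact_mod_cast this

theorem tlog_ne {m n : ℕ} (h1 : 1 ≤ m) (h2 : m ≤ 3600) (h3 : 1 ≤ n) (h4 : n ≤ 3600)
    (h : m ≠ n) : tlog m ≠ tlog n := by
  wlog hlt : m < n generalizing m n
  · exact (this h3 h4 h1 h2 h.symm (by omega)).symm
  intro he
  obtain ⟨-, e1⟩ := tlog_bounds h3 h4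
  obtain ⟨e2, -⟩ := tlog_bounds h1 h2
  rw [← he] at e1
  have hm0 : (0 : ℝ) < m := by exact_mod_cast h1
  have hn0 : (0 : ℝ) < n := by exact_mod_cast h3
  have e3 := Real.one_sub_inv_le_log_of_pos (div_pos hn0 hm0)
  rw [Real.log_div hn0.ne' hm0.ne', inv_div, one_sub_div hn0.ne'] at e3
  have e4 : (1 : ℝ) / 3600 ≤ (n - m) / n := by
    have : (m : ℝ) + 1 ≤ n := by exact_mod_cast hlt
    have : (n : ℝ) ≤ 3600 := by exact_mod_cast h4
    rw [div_le_div_iff₀ (by norm_num) hn0]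
    linarith
  linarith

theorem le_mul_log_of_pairsCheck {g lo blo bcnt cnt a b X Y : ℕ}
    (h : pairsCheck g lo blo bcnt cnt = true) (h1 : lo ≤ a) (h2 : a < lo + cnt) (hblo : 2 ≤ blo)
    (hbhi : blo + bcnt ≤ 3601) (h3 : blo ≤ b) (h4 : b < blo + bcnt)
    (ha : 2 ≤ a) (ha' : a ≤ 3600) (hab : a ≠ b) (hpa : isPow a = false) (hpb : isPow b = false)
    (hga : Nat.gcd a 30 = g) (hgb : g ≤ Nat.gcd b 30) (hgab : Nat.gcd (Nat.gcd b 30) g = 1)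
    (hX : 0 < X) (hY : 0 < Y) (hlt : |(X : ℤ) * tlog a - Y * tlog b| < slack) :
    2 ^ 20 ≤ X * Real.log a ∨ 2 ^ 20 ≤ Y * Real.log b := by
  have hv := vecCheck_of_pairsCheck h h1 h2 hpa hga
  have hl : ∀ b ∈ lanes (isPartner g) blo bcnt, slack ≤ tlog b ∧ tlog b ≤ 9 * 2 ^ 60 := by
    intro b hb
    rw [mem_lanes] at hb
    exact tlog_mem (by omega) (by omega)
  have hbl : b ∈ lanes (isPartner g) blo bcnt := by
    rw [mem_lanes]
    refine ⟨h3, h4, ?_⟩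
    rw [isPartner, hpb]
    change band _ _ = true
    rw [band_eq_true, Nat.ble_eq, Nat.beq_eq]
    exact ⟨hgb, hgab⟩
  have key := isSeparated_of_vecCheck (tlog_mem ha ha').1 (tlog_mem ha ha').2
    (fun b hb => (hl b hb).1) (fun b hb => (hl b hb).2) (tlog_mem hblo (by omega)).2 hv b hbl
    (tlog_ne (by omega) ha' (by omega) (by omega) hab)
  have hlb : (tlog blo : ℝ) ≤ 2 ^ 60 * Real.log b := by
    refine (tlog_bounds (by omega) (by omega)).1.trans ?_
    have : Real.log blo ≤ Real.log b :=
      Real.log_le_log (by exact_mod_cast (by omega : 0 < blo)) (by exact_mod_cast h3)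
    linarith
  have hbb : (tlog b : ℝ) ≤ 2 ^ 60 * Real.log b := (tlog_bounds (by omega) (by omega)).1
  have haa : (tlog a : ℝ) ≤ 2 ^ 60 * Real.log a := (tlog_bounds (by omega) ha').1
  have conv : ∀ {N W : ℕ} {L : ℝ}, (W : ℝ) ≤ 2 ^ 60 * L → 2 ^ 80 ≤ N * W → 2 ^ 20 ≤ N * L := by
    intro N W L hW hN
    have e1 : (2 : ℝ) ^ 80 ≤ N * W := by exact_mod_cast hN
    have e2 : (N : ℝ) * W ≤ N * (2 ^ 60 * L) := by gcongr
    linarith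
  rcases key with key | key <;> rcases key X Y hX hY hlt with h5 | h5
  · exact Or.inr (conv hlb h5)
  · exact Or.inl (conv haa h5)
  · exact Or.inr (conv hbb h5)
  · exact Or.inl (conv haa h5)

/-! ### Large coefficients of small linear forms -/

theorem pairsCheck_one_2 : ∀ i < 9, pairsCheck 1 (1 + 400 * i) 2 58 400 = true := by
  intro i hi
  interval_cases i <;> decide +kernel

theorem pairsCheck_one_60 : ∀ i < 9, pairsCheck 1 (1 + 400 * i) 60 1000 400 = true := by
  intro i hi
  interval_cases i <;> decide +kernel

theorem pairsCheck_one_1060 : ∀ i < 9, pairsCheck 1 (1 + 400 * i) 1060 1270 400 = true := by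
  intro i hi
  interval_cases i <;> decide +kernel

theorem pairsCheck_one_2330 : ∀ i < 9, pairsCheck 1 (1 + 400 * i) 2330 1271 400 = true := by
  intro i hi
  interval_cases i <;> decide +kernel

theorem pairsCheck_two_2 : ∀ i < 6, pairsCheck 2 (1 + 600 * i) 2 58 600 = true := by
  intro i hi
  interval_cases i <;> decide +kernel

theorem pairsCheck_two_60 : ∀ i < 6, pairsCheck 2 (1 + 600 * i) 60 1240 600 = true := by
  intro i hi
  interval_cases i <;> decide +kernel

theorem pairsCheck_two_1300 : ∀ i < 6, pairsCheck 2 (1 + 600 * i) 1300 2301 600 = true := by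
  intro i hi
  interval_cases i <;> decide +kernel

theorem pairsCheck_three_2 : ∀ i < 3, pairsCheck 3 (1 + 1200 * i) 2 58 1200 = true := by
  intro i hi
  interval_cases i <;> decide +kernel

theorem pairsCheck_three_60 : ∀ i < 3, pairsCheck 3 (1 + 1200 * i) 60 840 1200 = true := by
  intro i hi
  interval_cases i <;> decide +kernel

theorem pairsCheck_three_900 : ∀ i < 3, pairsCheck 3 (1 + 1200 * i) 900 2701 1200 = true := by
  intro i hi
  interval_cases i <;> decide +kernel

theorem pairsCheck_five_2 : ∀ i < 2, pairsCheck 5 (1 + 1800 * i) 2 58 1800 = true := by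
  intro i hi
  interval_cases i <;> decide +kernel

theorem pairsCheck_five_60 : ∀ i < 2, pairsCheck 5 (1 + 1800 * i) 60 840 1800 = true := by
  intro i hi
  interval_cases i <;> decide +kernel

theorem pairsCheck_five_900 : ∀ i < 2, pairsCheck 5 (1 + 1800 * i) 900 2701 1800 = true := by
  intro i hi
  interval_cases i <;> decide +kernel

/-- The linear form in `tlog a` and `tlog b` is not small, unless its coefficients are large. -/
theorem le_mul_log_of_abs_sub_lt {a b X Y : ℕ} (ha : 2 ≤ a) (ha' : a ≤ 3600) (hb : 2 ≤ b)
    (hb' : b ≤ 3600) (hab : Nat.Coprime a b) (hpa : isPow a = false) (hpb : isPow b = false)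
    (hX : 0 < X) (hY : 0 < Y) (hlt : |(X : ℤ) * tlog a - Y * tlog b| < slack) :
    2 ^ 20 ≤ X * Real.log a ∨ 2 ^ 20 ≤ Y * Real.log b := by
  wlog hle : Nat.gcd a 30 ≤ Nat.gcd b 30 generalizing a b X Y
  · exact (this hb hb' ha ha' hab.symm hpb hpa hY hX (by rwa [abs_sub_comm]) (by omega)).symm
  have hne : a ≠ b := by
    rintro rfl
    have := (Nat.coprime_self a).mp hab
    omega
  have hco : Nat.Coprime (Nat.gcd b 30) (Nat.gcd a 30) :=
    (hab.symm.coprime_dvd_left (Nat.gcd_dvd_left b 30)).coprime_dvd_right (Nat.gcd_dvd_left a 30)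
  have hdvd : Nat.gcd b 30 * Nat.gcd a 30 ∣ 30 :=
    hco.mul_dvd_of_dvd_of_dvd (Nat.gcd_dvd_right b 30) (Nat.gcd_dvd_right a 30)
  have hmul : Nat.gcd b 30 * Nat.gcd a 30 ≤ 30 := Nat.le_of_dvd (by norm_num) hdvd
  have hg1 : Nat.gcd a 30 < 6 := by nlinarith
  have hg0 : 0 < Nat.gcd a 30 := Nat.gcd_pos_of_pos_left _ (by omega)
  have hg2 : Nat.gcd a 30 ∣ 30 := Nat.gcd_dvd_right a 30
  have key : ∀ {c n : ℕ} {g blo bcnt : ℕ}, (∀ i < n, pairsCheck g (1 + c * i) blo bcnt c = true) →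
      c * n = 3600 → Nat.gcd a 30 = g → 2 ≤ blo → blo + bcnt ≤ 3601 → blo ≤ b → b < blo + bcnt →
      2 ^ 20 ≤ X * Real.log a ∨ 2 ^ 20 ≤ Y * Real.log b := by
    intro c n g blo bcnt h hcn hg h1 h2 h3 h4
    have hc : 0 < c := Nat.pos_of_ne_zero (by rintro rfl; simp at hcn)
    have e1 := Nat.div_add_mod (a - 1) c
    have e2 := Nat.mod_lt (a - 1) hc
    refine le_mul_log_of_pairsCheck (h ((a - 1) / c) ?_) (by omega) (by omega) h1 h2 h3 h4 ha ha' hne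
      hpa hpb hg (hg ▸ hle) (hg ▸ hco) hX hY hlt
    rw [Nat.div_lt_iff_lt_mul hc, mul_comm, hcn]
    omega
  have hg : Nat.gcd a 30 = 1 ∨ Nat.gcd a 30 = 2 ∨ Nat.gcd a 30 = 3 ∨ Nat.gcd a 30 = 5 := by
    interval_cases Nat.gcd a 30 <;> simp_all
  rcases hg with hg | hg | hg | hg
  · have : b < 60 ∨ 60 ≤ b ∧ b < 1060 ∨ 1060 ≤ b ∧ b < 2330 ∨ 2330 ≤ b := by omega
    rcases this with h | h | h | h
    · exact key pairsCheck_one_2 rfl hg (by omega) (by omega) (by omega) (by omega)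
    · exact key pairsCheck_one_60 rfl hg (by omega) (by omega) (by omega) (by omega)
    · exact key pairsCheck_one_1060 rfl hg (by omega) (by omega) (by omega) (by omega)
    · exact key pairsCheck_one_2330 rfl hg (by omega) (by omega) (by omega) (by omega)
  · have : b < 60 ∨ 60 ≤ b ∧ b < 1300 ∨ 1300 ≤ b := by omega
    rcases this with h | h | h
    · exact key pairsCheck_two_2 rfl hg (by omega) (by omega) (by omega) (by omega)
    · exact key pairsCheck_two_60 rfl hg (by omega) (by omega) (by omega) (by omega)
    · exact key pairsCheck_two_1300 rfl hg (by omega) (by omega) (by omega) (by omega)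
  · have : b < 60 ∨ 60 ≤ b ∧ b < 900 ∨ 900 ≤ b := by omega
    rcases this with h | h | h
    · exact key pairsCheck_three_2 rfl hg (by omega) (by omega) (by omega) (by omega)
    · exact key pairsCheck_three_60 rfl hg (by omega) (by omega) (by omega) (by omega)
    · exact key pairsCheck_three_900 rfl hg (by omega) (by omega) (by omega) (by omega)
  · have : b < 60 ∨ 60 ≤ b ∧ b < 900 ∨ 900 ≤ b := by omega
    rcases this with h | h | h
    · exact key pairsCheck_five_2 rfl hg (by omega) (by omega) (by omega) (by omega)
    · exact key pairsCheck_five_60 rfl hg (by omega) (by omega) (by omega) (by omega)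
    · exact key pairsCheck_five_900 rfl hg (by omega) (by omega) (by omega) (by omega)

/-! ### Lifting the exponent -/

theorem emultiplicity_pow_sub_one {p : ℕ} (hp : p.Prime) {c : ℤ} (h1 : (p : ℤ) ∣ c - 1)
    (h2 : p = 2 → (4 : ℤ) ∣ c - 1) (n : ℕ) :
    emultiplicity (p : ℤ) (c ^ n - 1) = emultiplicity (p : ℤ) (c - 1) + emultiplicity p n := by
  have hpc : ¬ (p : ℤ) ∣ c := by
    intro h
    have h3 : (p : ℤ) ∣ 1 := by simpa using dvd_sub h h1
    have h4 : p ∣ 1 := by exact_mod_cast h3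
    exact hp.one_lt.ne' (Nat.dvd_one.mp h4)
  rcases hp.eq_two_or_odd' with rfl | hodd
  · have := Int.two_pow_sub_pow' (y := 1) n (h2 rfl) (by exact_mod_cast hpc)
    rw [one_pow] at this
    rw [Nat.cast_ofNat, this, ← Int.natCast_emultiplicity]
    rfl
  · have := Int.emultiplicity_pow_sub_pow hp hodd (x := c) (y := 1) h1 hpc n
    rwa [one_pow] at this

/-- If `p ^ x` divides `b ^ n - 1`, then `n` is large as compared to `p ^ x`. -/
theorem pow_sub_dvd {p b n x v : ℕ} (hp : p.Prime) (hb : Nat.Coprime p b)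
    (hv : ¬ p ^ (v + 1) ∣ b ^ (2 * (p - 1)) - 1) (hn : p ^ x ∣ b ^ n - 1) :
    p ^ (x - v) ∣ n := by
  have hb0 : 0 < b := Nat.pos_of_ne_zero (by
    rintro rfl
    rw [Nat.coprime_zero_right] at hb
    exact hp.one_lt.ne' hb)
  set c : ℕ := b ^ (2 * (p - 1)) with hc
  have hc1 : 1 ≤ c := Nat.one_le_pow _ _ hb0
  have hbn : 1 ≤ b ^ n := Nat.one_le_pow _ _ hb0
  have hpc : p ∣ c - 1 := by
    have h1 : b ^ (p - 1) ≡ 1 [MOD p] := by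
      have := Nat.ModEq.pow_totient hb.symm
      rwa [Nat.totient_prime hp] at this
    have h2 := h1.pow 2
    rw [one_pow, ← pow_mul, mul_comm (p - 1) 2] at h2
    exact (Nat.modEq_iff_dvd' hc1).mp h2.symm
  have hz : ((c : ℤ) - 1) = ((c - 1 : ℕ) : ℤ) := by push_cast [hc1]; ring
  have hp2 : p = 2 → (4 : ℤ) ∣ (c : ℤ) - 1 := by
    intro h
    subst h
    have hodd : ¬ 2 ∣ b := (Nat.Prime.coprime_iff_not_dvd Nat.prime_two).mp hb
    have : (b : ℤ) % 2 = 1 := by omega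
    have h8 := Int.sq_mod_four_eq_one_of_odd (Int.odd_iff.mpr this)
    have : ((c : ℕ) : ℤ) = (b : ℤ) ^ 2 := by rw [hc]; push_cast; norm_num
    rw [this]
    omega
  have hdvd : ((p : ℤ)) ^ x ∣ (c : ℤ) ^ n - 1 := by
    have h1 : (c ^ n - 1 : ℕ) = (b ^ n) ^ (2 * (p - 1)) - 1 := by
      rw [hc, ← pow_mul, ← pow_mul, mul_comm]
    have h2 : b ^ n - 1 ∣ (b ^ n) ^ (2 * (p - 1)) - 1 := by
      simpa using Nat.sub_dvd_pow_sub_pow (b ^ n) 1 (2 * (p - 1))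
    have h3 : p ^ x ∣ c ^ n - 1 := h1 ▸ hn.trans h2
    have h4 : ((c ^ n - 1 : ℕ) : ℤ) = (c : ℤ) ^ n - 1 := by
      push_cast [Nat.one_le_pow n c hc1]; ring
    rw [← h4]
    exact_mod_cast h3
  have hlte := emultiplicity_pow_sub_one hp (c := c) (by rw [hz]; exact_mod_cast hpc) hp2 n
  have hle := le_emultiplicity_of_pow_dvd hdvd
  rw [hlte] at hle
  have hvlt : emultiplicity (p : ℤ) ((c : ℤ) - 1) < ((v + 1 : ℕ) : ℕ∞) := by
    rw [emultiplicity_lt_iff_not_dvd, hz]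
    exact_mod_cast hv
  have hvle : emultiplicity (p : ℤ) ((c : ℤ) - 1) ≤ v := by
    rw [Nat.cast_add, Nat.cast_one] at hvlt
    exact Order.le_of_lt_add_one hvlt
  refine pow_dvd_of_le_emultiplicity ?_
  rw [ENat.natCast_sub]
  refine tsub_le_iff_left.mpr (hle.trans ?_)
  gcongr

/-- Upper bound for `x` if `p ^ x` divides `b ^ n - 1`. -/
theorem pow_sub_le {p b n x v : ℕ} (hp : p.Prime) (hb : Nat.Coprime p b) (hn0 : 0 < n)
    (hv : ¬ p ^ (v + 1) ∣ b ^ (2 * (p - 1)) - 1) (hn : p ^ x ∣ b ^ n - 1) :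
    p ^ (x - v) ≤ n :=
  Nat.le_of_dvd hn0 (pow_sub_dvd hp hb hv hn)

/-! ### The case of a small power `a ^ m`: checking a single pair -/

/-- Membership in a list of numbers. -/
noncomputable def memList (A : ℕ) : List ℕ → Bool :=
  List.rec false (fun c _ ih => Bool.rec ih true (Nat.beq A c))

/-- Code of a quadruple. -/
noncomputable def encode (a b A B : ℕ) : ℕ :=
  Nat.add a (Nat.mul 4096 (Nat.add b (Nat.mul 4096 (Nat.add A (Nat.mul 4096 B)))))

/-- The codes of `a`, `b`, `a ^ x` and `b ^ y` for the exceptional coincidences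
`a ^ x * (a ^ m - 1) = b ^ y * (b ^ n - 1)`. -/
noncomputable def exceptions : List ℕ :=
  [206191996930, 206292660226, 206426877954, 343731621890, 6253506310146, 137489293315,
    549806153731, 1099561967619, 893403582467, 549839708165, 206376546317, 138965688411]

/-- Division by `b` as often as possible. -/
noncomputable def strip (b : ℕ) (fuel : ℕ) : ℕ → ℕ :=
  Nat.rec (motive := fun _ => ℕ → ℕ) (fun t => t)
    (fun _ ih t => Bool.rec t (ih (Nat.div t b)) (Nat.beq (Nat.mod t b) 0)) fuel

/-- Whether all `1 ≤ x ≤ n` for which `t * a ^ x + 1` is a power of `b` are exceptional. -/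
noncomputable def expCheck (a b N t : ℕ) (n : ℕ) : Bool :=
  Nat.rec (motive := fun _ => Bool) true (fun x ih => band ((fun s => Bool.rec true (Bool.rec true
    (memList (encode a b (Nat.pow a (Nat.succ x)) (Nat.div N t)) exceptions)
      (Nat.beq (strip b 1000 s) 1)) (Nat.beq (Nat.mod s b) 0))
    (Nat.add (Nat.mul t (Nat.pow a (Nat.succ x))) 1)) ih) n

/-- The smallest divisor of `a` between `k` and `k + fuel - 1`, if there is one, else `a`. -/
noncomputable def leastDvd (a : ℕ) (fuel : ℕ) : ℕ → ℕ :=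
  Nat.rec (motive := fun _ => ℕ → ℕ) (fun _ => a)
    (fun _ ih k => Bool.rec (ih (Nat.succ k)) k (Nat.beq (Nat.mod a k) 0)) fuel

/-- Application of `k` to the least `v ≥ v₀` such that `p ^ (v + 1)` does not divide `B`. -/
noncomputable def valCheck (p B : ℕ) (k : ℕ → Bool) (fuel : ℕ) : ℕ → Bool :=
  Nat.rec (motive := fun _ => ℕ → Bool) (fun _ => false) (fun _ ih v =>
    Bool.rec (k v) (ih (Nat.succ v)) (Nat.beq (Nat.mod B (Nat.pow p (Nat.succ v))) 0)) fuel

/-- Whether all coincidences `a ^ x * (a ^ m - 1) = b ^ y * (b ^ n - 1)` are exceptional, where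
`a`, `b` and `m` are given. -/
noncomputable def pairCheck (a m b : ℕ) : Bool :=
  (fun p N => valCheck p (Nat.sub (Nat.pow b (Nat.mul 2 (Nat.sub p 1))) 1) (fun v =>
    force (strip b 40 N) (fun t => expCheck a b N t (Nat.add v (nif (Nat.ble 20 p) 1 8)))) 25 0)
    (leastDvd a 59 2) (Nat.sub (Nat.pow a m) 1)

theorem rec_eq_ite_nat (c : Bool) (x y : ℕ) : (Bool.rec x y c : ℕ) = if c then y else x := by
  cases c <;> rfl

theorem mem_of_memList {A : ℕ} {l : List ℕ} (h : memList A l = true) : A ∈ l := by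
  induction l with
  | nil => exact absurd h Bool.false_ne_true
  | cons c l ih =>
    have h' : (Bool.rec (memList A l) true (Nat.beq A c) : Bool) = true := h
    rw [rec_eq_ite] at h'
    split_ifs at h' with hc
    · exact List.mem_cons.mpr (Or.inl (Nat.eq_of_beq_eq_true hc))
    · exact List.mem_cons_of_mem _ (ih h')

theorem strip_mul_pow {b t : ℕ} (hb : 0 < b) (ht : ¬ b ∣ t) (fuel : ℕ) :
    ∀ y, y ≤ fuel → strip b fuel (t * b ^ y) = t := by
  induction fuel with
  | zero =>
    intro y hy
    obtain rfl : y = 0 := by omega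
    rw [pow_zero, mul_one]; rfl
  | succ fuel ih =>
    intro y hy
    have h : strip b (fuel + 1) (t * b ^ y) = Bool.rec (t * b ^ y) (strip b fuel (t * b ^ y / b))
      (Nat.beq (t * b ^ y % b) 0) := rfl
    rw [h, rec_eq_ite_nat]
    cases y with
    | zero =>
      rw [if_neg, pow_zero, mul_one]
      rw [Nat.beq_eq, pow_zero, mul_one]
      exact fun h => ht (Nat.dvd_of_mod_eq_zero h)
    | succ y =>
      rw [pow_succ, ← mul_assoc, Nat.mul_mod_left, if_pos (show Nat.beq 0 0 = true from rfl),
        Nat.mul_div_cancel _ hb]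
      exact ih y (by omega)

theorem expCheck_spec {a b N t x n k : ℕ} (hb : 2 ≤ b) (h : expCheck a b N t n = true) (hx : 0 < x)
    (hxn : x ≤ n) (hk : 0 < k) (hk' : k ≤ 1000) (he : t * a ^ x + 1 = b ^ k) :
    encode a b (a ^ x) (N / t) ∈ exceptions := by
  induction n with
  | zero => omega
  | succ n ih =>
    have h' : band (Bool.rec true (Bool.rec true
      (memList (encode a b (a ^ (n + 1)) (N / t)) exceptions)
        (Nat.beq (strip b 1000 (t * a ^ (n + 1) + 1)) 1))
          (Nat.beq ((t * a ^ (n + 1) + 1) % b) 0)) (expCheck a b N t n) = true := h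
    rw [band_eq_true] at h'
    rcases hxn.eq_or_lt with rfl | hlt
    · have h1 := h'.1
      have hs : strip b 1000 (b ^ k) = 1 := by
        simpa using strip_mul_pow (b := b) (t := 1) (by omega)
          (fun h => by have := Nat.dvd_one.mp h; omega) 1000 k hk'
      rw [he, hs, Nat.mod_eq_zero_of_dvd (dvd_pow_self b hk.ne')] at h1
      exact mem_of_memList h1
    · exact ih h'.2 (by omega)

theorem leastDvd_spec {a : ℕ} (ha : 2 ≤ a) (fuel : ℕ) :
    ∀ k, 2 ≤ k → (∀ d, 2 ≤ d → d < k → ¬ d ∣ a) →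
    a < (k + fuel) ^ 2 → (leastDvd a fuel k).Prime ∧ leastDvd a fuel k ∣ a := by
  induction fuel with
  | zero =>
    intro k hk hd hlt
    refine ⟨?_, dvd_rfl⟩
    change a.Prime
    by_contra hp
    have h1 := Nat.minFac_sq_le_self (by omega) hp
    have h2 := Nat.minFac_prime (n := a) (by omega)
    exact hd _ h2.two_le (lt_of_pow_lt_pow_left₀ 2 (by omega) (h1.trans_lt hlt))
      (Nat.minFac_dvd a)
  | succ fuel ih =>
    intro k hk hd hlt
    have h : leastDvd a (fuel + 1) k =
      Bool.rec (leastDvd a fuel (k + 1)) k (Nat.beq (a % k) 0) := rfl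
    rw [h, rec_eq_ite_nat]
    split_ifs with hc
    · have hka : k ∣ a := Nat.dvd_of_mod_eq_zero (Nat.eq_of_beq_eq_true hc)
      refine ⟨?_, hka⟩
      have h2 := Nat.minFac_prime (n := k) (by omega)
      have h3 : k.minFac = k := by
        by_contra hne
        exact hd _ h2.two_le (lt_of_le_of_ne (Nat.minFac_le (by omega)) hne)
          ((Nat.minFac_dvd k).trans hka)
      exact h3 ▸ h2
    · refine ih (k + 1) (by omega) (fun d h2 hdk hda => ?_) (by rwa [add_assoc, add_comm 1])
      rcases (Nat.lt_succ_iff.mp hdk).eq_or_lt with rfl | hlt'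
      · exact hc (by rw [Nat.beq_eq]; exact Nat.mod_eq_zero_of_dvd hda)
      · exact hd d h2 hlt' hda

theorem exists_of_valCheck {p B : ℕ} {k : ℕ → Bool} (fuel : ℕ) : ∀ v₀,
    valCheck p B k fuel v₀ = true → ∃ v, v < v₀ + fuel ∧ ¬ p ^ (v + 1) ∣ B ∧ k v = true := by
  induction fuel with
  | zero => intro v₀ h; exact absurd h Bool.false_ne_true
  | succ fuel ih =>
    intro v₀ h
    have h' : (Bool.rec (k v₀) (valCheck p B k fuel (v₀ + 1))
      (Nat.beq (B % p ^ (v₀ + 1)) 0) : Bool) = true := h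
    rw [rec_eq_ite] at h'
    split_ifs at h' with hc
    · obtain ⟨v, h1, h2⟩ := ih _ h'
      exact ⟨v, by omega, h2⟩
    · refine ⟨v₀, by omega, fun hd => hc ?_, h'⟩
      rw [Nat.beq_eq]
      exact Nat.mod_eq_zero_of_dvd hd

/-- Decomposition of a coincidence `a ^ x * (a ^ m - 1) = b ^ y * (b ^ n - 1)`. -/
theorem exists_cofactor {a b x y m n : ℕ} (hab : Nat.Coprime a b) (hb : 0 < b)
    (he : a ^ x * (a ^ m - 1) = b ^ y * (b ^ n - 1)) :
    ∃ t, a ^ m - 1 = t * b ^ y ∧ b ^ n = t * a ^ x + 1 := by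
  have hco : Nat.Coprime (b ^ y) (a ^ x) := hab.symm.pow _ _
  obtain ⟨t, ht⟩ := hco.dvd_of_dvd_mul_left (Dvd.intro _ he.symm)
  refine ⟨t, by rw [ht, mul_comm], ?_⟩
  have hby : 0 < b ^ y := Nat.pow_pos hb
  have h1 : b ^ n - 1 = t * a ^ x := by
    refine Nat.eq_of_mul_eq_mul_left hby ?_
    rw [← he, ht]; ring
  have h2 : 0 < b ^ n := Nat.pow_pos hb
  omega

theorem pairCheck_spec {a b x y m n : ℕ} (ha : 2 ≤ a) (ha' : a ≤ 3600) (hb : 2 ≤ b)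
    (hab : Nat.Coprime a b) (hx : 0 < x) (hm : 0 < m) (hn : 0 < n) (ham : a ^ m ≤ 2 ^ 40)
    (he : a ^ x * (a ^ m - 1) = b ^ y * (b ^ n - 1)) (h : pairCheck a m b = true) :
    encode a b (a ^ x) (b ^ y) ∈ exceptions := by
  obtain ⟨t, h1, h2⟩ := exists_cofactor hab (by omega) he
  have h' : valCheck (leastDvd a 59 2) (b ^ (2 * (leastDvd a 59 2 - 1)) - 1) (fun v =>
    force (strip b 40 (a ^ m - 1)) (fun t => expCheck a b (a ^ m - 1) t
      (v + nif (Nat.ble 20 (leastDvd a 59 2)) 1 8))) 25 0 = true := h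
  obtain ⟨hp, hpa⟩ := leastDvd_spec ha 59 2 le_rfl (by intros; omega) (by norm_num; omega)
  set p := leastDvd a 59 2
  obtain ⟨v, hv, hv1, hk⟩ := exists_of_valCheck 25 0 h'
  rw [force_eq] at hk
  have ham1 : 1 < a ^ m := Nat.one_lt_pow hm.ne' (by omega)
  have ht0 : 0 < t := Nat.pos_of_ne_zero (by rintro rfl; simp at h1; omega)
  have hbt : ¬ b ∣ t := by
    intro hd
    have h3 : b ∣ t * a ^ x + 1 := h2 ▸ dvd_pow_self b hn.ne'
    have h4 : b ∣ 1 := (Nat.dvd_add_right (hd.mul_right _)).mp h3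
    have := Nat.dvd_one.mp h4
    omega
  have htle : t * 2 ^ y ≤ t * b ^ y := by gcongr
  have hy : y ≤ 40 := by
    by_contra hy
    have h3 : 2 ^ 40 < 2 ^ y := Nat.pow_lt_pow_right (by norm_num) (by omega)
    have h4 : 2 ^ y ≤ t * 2 ^ y := Nat.le_mul_of_pos_left _ ht0
    omega
  have hstrip : strip b 40 (a ^ m - 1) = t := by
    rw [h1]; exact strip_mul_pow (by omega) hbt 40 y hy
  have hdiv : (a ^ m - 1) / t = b ^ y := by rw [h1, Nat.mul_div_cancel_left _ ht0]
  rw [hstrip] at hk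
  have hpb : Nat.Coprime p b := hab.coprime_dvd_left hpa
  have hnle : n ≤ 40 + 12 * x := by
    have e1 : 2 ^ n ≤ b ^ n := by gcongr
    have e2 : a ^ x ≤ (2 ^ 12) ^ x := by gcongr; omega
    have e3 : t + 1 ≤ 2 ^ 40 := by
      have : 2 ^ 0 ≤ 2 ^ y := Nat.pow_le_pow_right (by norm_num) (by omega)
      have : t ≤ t * 2 ^ y := Nat.le_mul_of_pos_right _ (by positivity)
      omega
    have e4 : t * a ^ x + 1 ≤ (t + 1) * a ^ x := by
      have : 0 < a ^ x := Nat.pow_pos (by omega)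
      rw [add_mul]; omega
    have e5 : 2 ^ n ≤ 2 ^ (40 + 12 * x) := by
      calc 2 ^ n ≤ t * a ^ x + 1 := h2 ▸ e1
        _ ≤ (t + 1) * a ^ x := e4
        _ ≤ 2 ^ 40 * (2 ^ 12) ^ x := by gcongr
        _ = 2 ^ (40 + 12 * x) := by rw [← pow_mul, ← pow_add]
    exact (Nat.pow_le_pow_iff_right (by norm_num)).mp e5
  have hdvd : p ^ x ∣ b ^ n - 1 := by
    rw [h2, Nat.add_sub_cancel]
    exact (pow_dvd_pow_of_dvd hpa x).mul_left t
  have hple := pow_sub_le hp hpb hn hv1 hdvd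
  have hxle : x ≤ v + nif (Nat.ble 20 p) 1 8 := by
    by_contra hlt
    rw [nif_eq] at hlt
    obtain ⟨j, rfl⟩ : ∃ j, x = v + j := ⟨x - v, by split_ifs at hlt <;> omega⟩
    rw [Nat.add_sub_cancel_left] at hple
    by_cases hp20 : 20 ≤ p
    · rw [if_pos (Nat.ble_eq.mpr hp20)] at hlt
      obtain ⟨i, rfl⟩ : ∃ i, j = i + 2 := ⟨j - 2, by omega⟩
      have e1 : 20 ^ (i + 2) ≤ p ^ (i + 2) := by gcongr
      have e2 : i < 20 ^ i := Nat.lt_pow_self (by norm_num)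
      rw [pow_add] at e1
      omega
    · rw [if_neg (by rwa [Nat.ble_eq])] at hlt
      obtain ⟨i, rfl⟩ : ∃ i, j = i + 9 := ⟨j - 9, by omega⟩
      have e1 : 2 ^ (i + 9) ≤ p ^ (i + 9) := by gcongr; exact hp.two_le
      have e2 : i < 2 ^ i := Nat.lt_pow_self (by norm_num)
      rw [pow_add] at e1
      omega
  have hxb : x ≤ 32 := by rw [nif_eq] at hxle; split_ifs at hxle <;> omega
  rw [← hdiv]
  exact expCheck_spec hb hk hx hxle hn (by omega) h2.symm

/-! ### The case of a small power `a ^ m`: selecting the pairs -/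

/-- The top bit of every lane in which `X` and `C` agree. -/
noncomputable def eqFlags (H X C : ℕ) : ℕ :=
  Nat.land (Nat.land (Nat.sub (Nat.add X H) C) (Nat.sub (Nat.add C H) X)) H

theorem eqFlags_pack {l : List ℕ} {X C : ℕ → ℕ} (hX : ∀ b ∈ l, X b < 2 ^ 36)
    (hC : ∀ b ∈ l, C b < 2 ^ 36) :
    eqFlags (pack 37 l fun _ => 2 ^ 36) (pack 37 l X) (pack 37 l C) =
      pack 37 l fun b => if X b = C b then 2 ^ 36 else 0 := by
  refine (geFlags_land_pack (k := 36) hX hC hC hX).trans (pack_congr fun b _ => ?_)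
  simp only [le_antisymm_iff, and_comm]

/-- Lane-wise remainder modulo `M`. -/
noncomputable def modStep (H M : ℕ) (n : ℕ) : ℕ → ℕ :=
  Nat.rec (motive := fun _ => ℕ → ℕ) (fun v => v) (fun c ih v => ih (condSub 36 c H H v M)) n

/-- Lane-wise product with `a`, modulo `M`. -/
noncomputable def mulMod (H M a v : ℕ) : ℕ := modStep H M 12 (Nat.mul v a)

theorem modStep_pack {l : List ℕ} {M : ℕ → ℕ} (hM : ∀ b ∈ l, M b < 2 ^ 24) (n : ℕ) (hn : n ≤ 12) :
    ∀ v : ℕ → ℕ, (∀ b ∈ l, v b < M b * 2 ^ n) → (∀ b ∈ l, v b < 2 ^ 36) →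
    modStep (pack 37 l fun _ => 2 ^ 36) (pack 37 l M) n (pack 37 l v) =
      pack 37 l fun b => v b % M b := by
  induction n with
  | zero =>
    intro v hv _
    refine pack_congr fun b hb => (Nat.mod_eq_of_lt ?_).symm
    simpa using hv b hb
  | succ c ih =>
    intro v hv hv'
    change modStep (pack 37 l fun _ => 2 ^ 36) (pack 37 l M) c
      (condSub 36 c (pack 37 l fun _ => 2 ^ 36) (pack 37 l fun _ => 2 ^ 36 - 0) (pack 37 l v)
        (pack 37 l M)) = _
    have hMc : ∀ b ∈ l, M b * 2 ^ c < 2 ^ 36 := fun b hb => by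
      calc M b * 2 ^ c ≤ M b * 2 ^ 11 := by gcongr <;> omega
        _ < 2 ^ 24 * 2 ^ 11 := by have := hM b hb; gcongr
        _ < 2 ^ 36 := by norm_num
    rw [condSub_pack (by positivity) hv' (fun b hb => (hMc b hb).le) hMc, ih (by omega)]
    · refine pack_congr fun b _ => ?_
      split_ifs with h
      · exact Nat.sub_mul_mod h
      · rfl
    · intro b hb
      have := hv b hb
      rw [pow_succ, ← mul_assoc] at this
      split_ifs <;> omega
    · intro b hb
      have := hv' b hb
      split_ifs <;> omega

theorem mulMod_pack {l : List ℕ} {M f : ℕ → ℕ} {a : ℕ} (ha : a ≤ 3600)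
    (hM : ∀ b ∈ l, 0 < M b ∧ M b ≤ 3600 ^ 2) :
    mulMod (pack 37 l fun _ => 2 ^ 36) (pack 37 l M) a (pack 37 l fun b => f b % M b) =
      pack 37 l fun b => f b * a % M b := by
  have hlt : ∀ b ∈ l, f b % M b * a ≤ M b * 3600 := fun b hb =>
    Nat.mul_le_mul (Nat.mod_lt _ (hM b hb).1).le ha
  change modStep _ _ 12 (pack 37 l (fun b => f b % M b) * a) = _
  rw [pack_mul, modStep_pack (fun b hb => by have := (hM b hb).2; omega) 12 le_rfl]
  · exact pack_congr fun b _ => by rw [Nat.mod_mul_mod]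
  · intro b hb
    have := hlt b hb
    have := (hM b hb).1
    omega
  · intro b hb
    have := hlt b hb
    have := (hM b hb).2
    omega

/-- The checks for all exponents `m` with `a ^ m ≤ 2 ^ 40`. The vectors `w` and `v` hold
`b * a ^ (m - 1)` and `a ^ (m - 1)`, respectively, modulo the entries `b ^ 2` of `M`, and `T`
comprises the tests for the preceding values of `w`. -/
noncomputable def powLoop (H M B C a : ℕ) (fuel : ℕ) : ℕ → (ℕ → ℕ → Bool) → ℕ → ℕ → Bool :=
  Nat.rec (motive := fun _ => ℕ → (ℕ → ℕ → Bool) → ℕ → ℕ → Bool) (fun _ _ _ _ => false)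
    (fun _ ih m T w v => Bool.rec true
      ((fun T' v' => band (T' m v') (ih (Nat.succ m) T' (mulMod H M a w) v'))
        (fun m X => band (checkFlagged (pairCheck a m) 37 (Nat.shiftLeft B 36) 3600
          (eqFlags H (Nat.add X w) C)) (T m X))
        (mulMod H M a v)) (Nat.ble (Nat.pow a m) (Nat.pow 2 40))) fuel

/-- The checks for a single `a`. -/
noncomputable def baseCheck (H M J B C a : ℕ) : Bool :=
  powLoop H M B C a 50 1 (fun m X => checkFlagged (pairCheck a m) 37 (Nat.shiftLeft B 36) 3600
    (eqFlags H X J)) B J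

/-- The condition selecting `b` for closer inspection. -/
def IsSelected (a m b n : ℕ) : Prop :=
  a ^ m % b ^ 2 = 1 ∨ ∃ j < n, a ^ m % b ^ 2 + b * a ^ j % b ^ 2 = b ^ 2 + 1

theorem pairCheck_of_eqFlags {l : List ℕ} (hl : ∀ b ∈ l, b < 2 ^ 36) {X C : ℕ → ℕ} {a m : ℕ}
    (hX : ∀ b ∈ l, X b < 2 ^ 36) (hC : ∀ b ∈ l, C b < 2 ^ 36)
    (h : checkFlagged (pairCheck a m) 37 (Nat.shiftLeft (pack 37 l fun b => b) 36) 3600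
      (eqFlags (pack 37 l fun _ => 2 ^ 36) (pack 37 l X) (pack 37 l C)) = true) :
    ∀ b ∈ l, X b = C b → pairCheck a m b = true := by
  rw [eqFlags_pack hX hC] at h
  exact check_of_checkFlagged (k := 36) (fuel := 3600) (check := pairCheck a m) (B := fun b => b)
    (P := fun b => X b = C b) (l := l)
    (fun b hb => (hl b hb).trans (Nat.pow_lt_pow_right (by norm_num) (by norm_num))) h

theorem pairCheck_of_powLoop {l : List ℕ} (hl : ∀ b ∈ l, 2 ≤ b ∧ b ≤ 3600) {a : ℕ} (ha0 : 0 < a)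
    (ha : a ≤ 3600) (fuel : ℕ) : ∀ (m : ℕ) (T : ℕ → ℕ → Bool),
    (∀ m', T m' (pack 37 l fun b => a ^ m' % b ^ 2) = true →
      ∀ b ∈ l, IsSelected a m' b m → pairCheck a m' b = true) →
    powLoop (pack 37 l fun _ => 2 ^ 36) (pack 37 l fun b => b ^ 2) (pack 37 l fun b => b)
      (pack 37 l fun b => b ^ 2 + 1) a fuel (m + 1) T (pack 37 l fun b => b * a ^ m % b ^ 2)
      (pack 37 l fun b => a ^ m % b ^ 2) = true →
    ∀ m', m < m' → a ^ m' ≤ 2 ^ 40 → ∀ b ∈ l, IsSelected a m' b m' → pairCheck a m' b = true := by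
  have hsq : ∀ b ∈ l, 0 < b ^ 2 ∧ b ^ 2 ≤ 3600 ^ 2 := fun b hb => by
    have := hl b hb
    exact ⟨Nat.pow_pos (by omega), by gcongr; exact this.2⟩
  induction fuel with
  | zero => intro m T _ h; exact absurd h Bool.false_ne_true
  | succ fuel ih =>
    intro m T hT h m' hm ham
    have h' : (Bool.rec true
      ((fun (T' : ℕ → ℕ → Bool) v' => band (T' (m + 1) v')
        (powLoop (pack 37 l fun _ => 2 ^ 36) (pack 37 l fun b => b ^ 2) (pack 37 l fun b => b)
          (pack 37 l fun b => b ^ 2 + 1) a fuel (m + 1 + 1) T'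
          (mulMod (pack 37 l fun _ => 2 ^ 36) (pack 37 l fun b => b ^ 2) a
            (pack 37 l fun b => b * a ^ m % b ^ 2)) v'))
        (fun m₁ X => band (checkFlagged (pairCheck a m₁) 37
          (Nat.shiftLeft (pack 37 l fun b => b) 36) 3600
          (eqFlags (pack 37 l fun _ => 2 ^ 36) (X + (pack 37 l fun b => b * a ^ m % b ^ 2))
            (pack 37 l fun b => b ^ 2 + 1))) (T m₁ X))
        (mulMod (pack 37 l fun _ => 2 ^ 36) (pack 37 l fun b => b ^ 2) a
          (pack 37 l fun b => a ^ m % b ^ 2))) (Nat.ble (a ^ (m + 1)) (2 ^ 40)) : Bool) = true := h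
    have hle : a ^ (m + 1) ≤ 2 ^ 40 := (Nat.pow_le_pow_right ha0 hm).trans ham
    rw [rec_eq_ite, if_pos (Nat.ble_eq.mpr hle), mulMod_pack ha hsq, mulMod_pack ha hsq] at h'
    simp only [mul_assoc, ← pow_succ] at h'
    rw [band_eq_true] at h'
    obtain ⟨h1, h2⟩ := h'
    have hT' : ∀ m', (fun (m₁ : ℕ) (X : ℕ) => band (checkFlagged (pairCheck a m₁) 37
          (Nat.shiftLeft (pack 37 l fun b => b) 36) 3600
          (eqFlags (pack 37 l fun _ => 2 ^ 36) (X + (pack 37 l fun b => b * a ^ m % b ^ 2))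
            (pack 37 l fun b => b ^ 2 + 1))) (T m₁ X)) m' (pack 37 l fun b => a ^ m' % b ^ 2) =
        true → ∀ b ∈ l, IsSelected a m' b (m + 1) → pairCheck a m' b = true := by
      intro m' h3 b hb hs
      dsimp only at h3
      rw [band_eq_true, pack_add] at h3
      obtain ⟨h4, h5⟩ := h3
      rcases hs with hs | ⟨j, hj, hs⟩
      · exact hT m' h5 b hb (Or.inl hs)
      · rcases (Nat.lt_succ_iff.mp hj).eq_or_lt with rfl | hj
        · refine pairCheck_of_eqFlags (fun b hb => by have := hl b hb; omega) (fun b hb => ?_)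
            (fun b hb => ?_) h4 b hb hs
          · have := hsq b hb
            have := Nat.mod_lt (a ^ m') this.1
            have := Nat.mod_lt (b * a ^ j) (hsq b hb).1
            omega
          · have := hsq b hb
            omega
        · exact hT m' h5 b hb (Or.inr ⟨j, hj, hs⟩)
    rcases (Nat.succ_le_of_lt hm).eq_or_lt with rfl | hm
    · exact hT' _ h1
    · exact ih (m + 1) _ hT' h2 m' hm ham

/-- The checks for `lo ≤ a < lo + cnt`. -/
noncomputable def smallCheck (lo cnt : ℕ) : Bool :=
  (fun J M B => Nat.rec (motive := fun _ => Bool) true (fun i ih => band (Bool.rec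
    (baseCheck (Nat.shiftLeft J 36) M J B (Nat.add M J) (Nat.add lo i)) true
      (isPow (Nat.add lo i))) ih) cnt)
    (packRange 37 (fun b => Bool.rec true false (isPow b)) (fun _ => 1) 2 3599)
    (packRange 37 (fun b => Bool.rec true false (isPow b)) (fun b => Nat.mul b b) 2 3599)
    (packRange 37 (fun b => Bool.rec true false (isPow b)) (fun b => b) 2 3599)

theorem baseCheck_of_smallCheck {lo cnt a : ℕ} (h : smallCheck lo cnt = true) (h1 : lo ≤ a)
    (h2 : a < lo + cnt) (ha : isPow a = false) {l : List ℕ}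
    (hl : l = lanes (fun b => Bool.rec true false (isPow b)) 2 3599) :
    baseCheck (pack 37 l fun _ => 2 ^ 36) (pack 37 l fun b => b ^ 2) (pack 37 l fun _ => 1)
      (pack 37 l fun b => b) (pack 37 l fun b => b ^ 2 + 1) a = true := by
  subst hl
  induction cnt with
  | zero => omega
  | succ i ih =>
    have h' : band (Bool.rec (baseCheck
        (packRange 37 (fun b => Bool.rec true false (isPow b)) (fun _ => 1) 2 3599 <<< 36)
        (packRange 37 (fun b => Bool.rec true false (isPow b)) (fun b => b * b) 2 3599)
        (packRange 37 (fun b => Bool.rec true false (isPow b)) (fun _ => 1) 2 3599)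
        (packRange 37 (fun b => Bool.rec true false (isPow b)) (fun b => b) 2 3599)
        (packRange 37 (fun b => Bool.rec true false (isPow b)) (fun b => b * b) 2 3599 +
          packRange 37 (fun b => Bool.rec true false (isPow b)) (fun _ => 1) 2 3599)
        (lo + i)) true (isPow (lo + i))) (smallCheck lo i) = true := h
    rw [band_eq_true] at h'
    by_cases hai : a = lo + i
    · subst hai
      have h3 := h'.1
      rw [rec_eq_ite, ha, if_neg Bool.false_ne_true, packRange_eq, packRange_eq, packRange_eq,
        pack_shiftLeft, pack_add] at h3
      simpa only [one_mul, ← sq] using h3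
    · exact ih h'.2 (by omega)

theorem pairCheck_of_smallCheck {lo cnt a b m : ℕ} (h : smallCheck lo cnt = true) (h1 : lo ≤ a)
    (h2 : a < lo + cnt) (ha0 : 0 < a) (ha : a ≤ 3600) (hb : 2 ≤ b) (hb' : b ≤ 3600)
    (hpa : isPow a = false)
    (hpb : isPow b = false) (hm : 0 < m) (ham : a ^ m ≤ 2 ^ 40) (hs : IsSelected a m b m) :
    pairCheck a m b = true := by
  obtain ⟨l, hl⟩ : ∃ l, l = lanes (fun b => Bool.rec true false (isPow b)) 2 3599 := ⟨_, rfl⟩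
  have hl' : ∀ b ∈ l, 2 ≤ b ∧ b ≤ 3600 := fun b hb => by
    rw [hl, mem_lanes] at hb
    omega
  have hbl : b ∈ l := by
    rw [hl, mem_lanes, hpb]
    exact ⟨hb, by omega, rfl⟩
  have h3 := baseCheck_of_smallCheck h h1 h2 hpa hl
  have hone : (pack 37 l fun b => a ^ 0 % b ^ 2) = pack 37 l fun _ => 1 :=
    pack_congr fun b hb => by
      have := hl' b hb
      rw [pow_zero, Nat.mod_eq_of_lt]
      nlinarith
  have hid : (pack 37 l fun b => b * a ^ 0 % b ^ 2) = pack 37 l fun b => b :=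
    pack_congr fun b hb => by
      have := hl' b hb
      rw [pow_zero, mul_one, Nat.mod_eq_of_lt]
      nlinarith
  refine pairCheck_of_powLoop hl' ha0 ha 50 0 (fun m X => checkFlagged (pairCheck a m) 37
    (Nat.shiftLeft (pack 37 l fun b => b) 36) 3600
      (eqFlags (pack 37 l fun _ => 2 ^ 36) X (pack 37 l fun _ => 1))) ?_ ?_ m hm ham b hbl hs
  · intro m' h4 b hb hs
    rcases hs with hs | ⟨j, hj, -⟩
    · refine pairCheck_of_eqFlags (fun b hb => by have := hl' b hb; omega) (fun b hb => ?_)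
        (fun b _ => by norm_num) h4 b hb hs
      have := hl' b hb
      have h5 : b ^ 2 ≤ 3600 ^ 2 := by gcongr; exact this.2
      have := Nat.mod_lt (a ^ m') (show 0 < b ^ 2 from Nat.pow_pos (by omega))
      omega
    · omega
  · rw [hone, hid]
    exact h3

/-! ### The case of a small power `a ^ m`: conclusion -/

/-- The triples excluded in the main theorem. -/
def IsExceptional (a b r : ℕ) : Prop :=
  (a, b, r) ∈ ({(3, 2, 1), (2, 3, 5), (2, 3, 13), (2, 5, 3), (13, 3, 10),
    (91, 2, 89)} : Set (ℕ × ℕ × ℕ))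

theorem isExceptional_of_encode_mem {a b x y : ℕ} (ha : 2 ≤ a) (ha' : a ≤ 3600) (hb : 2 ≤ b)
    (hb' : b ≤ 3600) (h : encode a b (a ^ x) (b ^ y) ∈ exceptions) {r : ℕ} (hr : 0 < r) :
    (a ^ x = b ^ y + r → IsExceptional a b r) ∧ (b ^ y = a ^ x + r → IsExceptional b a r) := by
  have h1 : ∀ v, encode a b (a ^ x) (b ^ y) = v →
      a = v % 4096 ∧ b = v / 4096 % 4096 ∧ a ^ x + 4096 * b ^ y = v / 4096 / 4096 := by
    intro v hv
    change a + 4096 * (b + 4096 * (a ^ x + 4096 * b ^ y)) = v at hv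
    omega
  have h2 : ∀ {c d w}, a = c → b = d → a ^ x + 4096 * b ^ y = w → w < 2 ^ 19 →
      x < 19 ∧ y < 7 ∧ c ^ x + 4096 * d ^ y = w := by
    rintro c d w rfl rfl hw hlt
    have h3 : 2 ^ x ≤ a ^ x := Nat.pow_le_pow_left ha x
    have h4 : 2 ^ y ≤ b ^ y := Nat.pow_le_pow_left hb y
    exact ⟨(Nat.pow_lt_pow_iff_right (by norm_num : 1 < 2)).mp (by omega),
      (Nat.pow_lt_pow_iff_right (by norm_num : 1 < 2)).mp (by omega), hw⟩
  simp only [exceptions, List.mem_cons, List.not_mem_nil, or_false] at h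
  rcases h with h | h | h | h | h | h | h | h | h | h | h | h <;>
  · obtain ⟨e1, e2, e3⟩ := h1 _ h
    norm_num at e1 e2 e3
    obtain ⟨hx, hy, e4⟩ := h2 e1 e2 e3 (by norm_num)
    subst e1 e2
    simp only [IsExceptional, Set.mem_insert_iff, Set.mem_singleton_iff, Prod.mk.injEq]
    clear h h1 h2 e3
    interval_cases x <;> interval_cases y <;> first
      | omega
      | exact ⟨fun h => by simp; omega, fun h => by simp; omega⟩

theorem isSelected_of_eq {a b x y m n : ℕ} (hb : 2 ≤ b) (hab : Nat.Coprime a b) (hy : 0 < y)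
    (hm : 0 < m) (hn : 0 < n) (ha : 0 < a) (he : a ^ x * (a ^ m - 1) = b ^ y * (b ^ n - 1)) :
    IsSelected a m b m := by
  obtain ⟨u, hu⟩ : ∃ u, a ^ m = u + 1 := ⟨a ^ m - 1, by have := Nat.pow_pos (n := m) ha; omega⟩
  obtain ⟨v, hv⟩ : ∃ v, b ^ n = v + 1 := ⟨b ^ n - 1, by
    have := Nat.pow_pos (n := n) (show 0 < b by omega); omega⟩
  rw [hu, hv, Nat.add_sub_cancel, Nat.add_sub_cancel] at he
  have hb2 : 1 < b ^ 2 := by nlinarith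
  have hco : Nat.Coprime (b ^ y) (a ^ x) := (hab.symm.pow_left y).pow_right x
  have hdu : b ^ y ∣ u := hco.dvd_of_dvd_mul_left (he ▸ dvd_mul_right _ _)
  by_cases hy2 : 2 ≤ y
  · left
    obtain ⟨c, rfl⟩ := (pow_dvd_pow b hy2).trans hdu
    rw [hu, Nat.mul_add_mod, Nat.mod_eq_of_lt hb2]
  · right
    obtain rfl : y = 1 := by omega
    rw [pow_one] at he hdu
    obtain ⟨j, hj, hjm⟩ : ∃ j < m, m ∣ x + j := by
      refine ⟨(m - x % m) % m, Nat.mod_lt _ hm, ?_⟩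
      rw [Nat.dvd_iff_mod_eq_zero, Nat.add_mod, Nat.mod_mod, ← Nat.add_mod]
      have h1 := Nat.div_add_mod x m
      have h2 := Nat.mod_lt x hm
      rw [show x + (m - x % m) = m * (x / m + 1) by rw [mul_add]; omega]
      exact Nat.mul_mod_right _ _
    refine ⟨j, hj, ?_⟩
    obtain ⟨k, hk⟩ := hjm
    obtain ⟨c, rfl⟩ := hdu
    -- `a ^ (x + j)` is congruent to `1` modulo `b`
    have h1 : b ∣ a ^ (x + j) - 1 := by
      rw [hk, pow_mul, hu]
      have : b * c + 1 - 1 ∣ (b * c + 1) ^ k - 1 ^ k := Nat.sub_dvd_pow_sub_pow _ 1 k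
      rw [Nat.add_sub_cancel, one_pow] at this
      exact (dvd_mul_right b c).trans this
    obtain ⟨d, hd⟩ := h1
    have hd' : a ^ (x + j) = b * d + 1 := by
      have := Nat.pow_pos (n := x + j) ha
      omega
    obtain ⟨n, rfl⟩ : ∃ k, n = k + 1 := ⟨n - 1, by omega⟩
    have h2 : ((a ^ m + b * a ^ j : ℕ) : ℤ) ≡ 1 [ZMOD ((b ^ 2 : ℕ) : ℤ)] := by
      refine (Int.modEq_iff_dvd.mpr ⟨c * d - b ^ n * a ^ j, ?_⟩)
      have e1 : (a : ℤ) ^ x * (b * c) = b * v := by exact_mod_cast he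
      have e2 : (b : ℤ) ^ n * b = v + 1 := by exact_mod_cast hv
      have e3 : (a : ℤ) ^ x * a ^ j = b * d + 1 := by rw [← pow_add]; exact_mod_cast hd'
      have e4 : (a : ℤ) ^ m = b * c + 1 := by exact_mod_cast hu
      push_cast
      rw [e4]
      linear_combination (-(a : ℤ) ^ j) * e1 + (b * (a : ℤ) ^ j) * e2 + (b * c : ℤ) * e3
    have h3 : (a ^ m + b * a ^ j) % b ^ 2 = 1 := by
      have := (Int.natCast_modEq_iff (a := a ^ m + b * a ^ j) (b := 1) (n := b ^ 2)).mp h2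
      rw [Nat.ModEq, Nat.mod_eq_of_lt hb2] at this
      exact this
    have h4 : b * a ^ j % b ^ 2 = b * (a ^ j % b) := by rw [sq, Nat.mul_mod_mul_left]
    have h5 : a ^ j % b ≠ 0 := fun h => by
      have := Nat.Coprime.eq_one_of_dvd (hab.symm.pow_right j) (Nat.dvd_of_mod_eq_zero h)
      omega
    have h6 : b ≤ b * (a ^ j % b) := Nat.le_mul_of_pos_right b (by omega)
    have h7 := Nat.mod_lt (a ^ m) (show b ^ 2 > 0 by omega)
    have h8 := Nat.mod_lt (b * a ^ j) (show b ^ 2 > 0 by omega)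
    rw [Nat.add_mod] at h3
    rw [← h4] at h6
    generalize a ^ m % b ^ 2 = A, b * a ^ j % b ^ 2 = B at *
    by_cases h9 : A + B < b ^ 2
    · rw [Nat.mod_eq_of_lt h9] at h3
      omega
    · rw [Nat.mod_eq_sub_mod (by omega), Nat.mod_eq_of_lt (by omega)] at h3
      omega

theorem smallCheck_all : ∀ i < 18, smallCheck (1 + 200 * i) 200 = true := by
  intro i hi
  interval_cases i <;> decide +kernel

theorem isExceptional_of_pow_le {a b x y m n r : ℕ} (ha : 2 ≤ a) (ha' : a ≤ 3600) (hb : 2 ≤ b)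
    (hb' : b ≤ 3600) (hab : Nat.Coprime a b) (hpa : isPow a = false) (hpb : isPow b = false)
    (hx : 0 < x) (hy : 0 < y) (hm : 0 < m) (hn : 0 < n) (ham : a ^ m ≤ 2 ^ 40)
    (he : a ^ x * (a ^ m - 1) = b ^ y * (b ^ n - 1)) (hr : 0 < r) :
    (a ^ x = b ^ y + r → IsExceptional a b r) ∧ (b ^ y = a ^ x + r → IsExceptional b a r) := by
  refine isExceptional_of_encode_mem ha ha' hb hb' (pairCheck_spec ha ha' hb hab hx hm hn ham he
    (pairCheck_of_smallCheck (smallCheck_all ((a - 1) / 200) (by omega)) (by omega) (by omega)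
      (by omega) ha' hb hb' hpa hpb hm ham
      (isSelected_of_eq hb hab hy hm hn (by omega) he))) hr

/-! ### The case of large powers -/

theorem mul_log_le {a b x y n : ℕ} (ha : 2 ≤ a) (ha' : a ≤ 3600) (hb : 2 ≤ b) (hb' : b ≤ 3600)
    (hab : Nat.Coprime a b) (hn : 0 < n) (hdvd : a ^ x ∣ b ^ y * (b ^ n - 1)) :
    x * Real.log a ≤ 59000 + 12 * Real.log n := by
  have hp : a.minFac.Prime := Nat.minFac_prime (by omega)
  have hpa : a.minFac ∣ a := Nat.minFac_dvd a
  have hcomp : a.minFac = a ∨ a.minFac ≤ 60 := by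
    by_cases h : a.Prime
    · exact Or.inl ((Nat.prime_def_minFac.mp h).2)
    · have := Nat.minFac_sq_le_self (by omega) h
      exact Or.inr (by nlinarith)
  obtain ⟨p, hpeq⟩ : ∃ p, p = a.minFac := ⟨_, rfl⟩
  rw [← hpeq] at hp hpa hcomp
  have hp2 := hp.two_le
  have hpb : Nat.Coprime p b := hab.coprime_dvd_left hpa
  have hB : 0 < b ^ (2 * (p - 1)) - 1 := by
    have : 1 < b ^ (2 * (p - 1)) := Nat.one_lt_pow (by omega) (by omega)
    omega
  obtain ⟨v, hv, hv'⟩ : ∃ v, p ^ v ∣ b ^ (2 * (p - 1)) - 1 ∧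
      ¬ p ^ (v + 1) ∣ b ^ (2 * (p - 1)) - 1 := by
    have := Fact.mk hp
    exact ⟨padicValNat p (b ^ (2 * (p - 1)) - 1), pow_padicValNat_dvd,
      pow_succ_padicValNat_not_dvd hB.ne'⟩
  have hpx : p ^ x ∣ b ^ n - 1 := ((hpb.pow_left x).pow_right y).dvd_of_dvd_mul_left
    ((pow_dvd_pow_of_dvd hpa x).trans hdvd)
  have h1 : p ^ (x - v) ≤ n := pow_sub_le hp hpb hn hv' hpx
  have h2 : p ^ v ≤ b ^ (2 * (p - 1)) := (Nat.le_of_dvd hB hv).trans (Nat.sub_le _ _)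
  have hp0 : (0 : ℝ) < p := by exact_mod_cast hp.pos
  have hlp : 0 < Real.log p := Real.log_pos (by exact_mod_cast hp.one_lt)
  have hln : 0 ≤ Real.log n := Real.log_natCast_nonneg n
  have h3 : ((x - v : ℕ) : ℝ) * Real.log p ≤ Real.log n := by
    rw [← Real.log_pow]
    exact Real.log_le_log (by positivity) (by exact_mod_cast h1)
  have h4 : v * Real.log p ≤ (2 * (p - 1 : ℕ) : ℝ) * Real.log b := by
    have : Real.log ((p : ℝ) ^ v) ≤ Real.log ((b : ℝ) ^ (2 * (p - 1))) :=
      Real.log_le_log (by positivity) (by exact_mod_cast h2)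
    rw [Real.log_pow, Real.log_pow] at this
    exact_mod_cast this
  have h5 : Real.log b ≤ 8.19 := log_le_of_le_3600 (by omega) hb'
  have h6 : (x : ℝ) ≤ v + (x - v : ℕ) := by
    have : x ≤ v + (x - v) := by omega
    exact_mod_cast this
  have h7 : (x : ℝ) * Real.log p ≤ 2 * (p - 1 : ℕ) * 8.19 + Real.log n := by
    have e1 : (x : ℝ) * Real.log p ≤ (v + (x - v : ℕ)) * Real.log p :=
      mul_le_mul_of_nonneg_right h6 hlp.le
    have e2 : (2 * (p - 1 : ℕ) : ℝ) * Real.log b ≤ 2 * (p - 1 : ℕ) * 8.19 :=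
      mul_le_mul_of_nonneg_left h5 (by positivity)
    linarith only [e1, e2, h3, h4]
  rcases hcomp with rfl | hp60
  · have : ((p - 1 : ℕ) : ℝ) ≤ 3599 := by
      have : p - 1 ≤ 3599 := by omega
      exact_mod_cast this
    linarith only [this, h7, hln]
  · have e1 : ((p - 1 : ℕ) : ℝ) ≤ 59 := by
      have : p - 1 ≤ 59 := by omega
      exact_mod_cast this
    have e2 : Real.log a ≤ 12 * Real.log p := by
      have e3 : a ≤ p ^ 12 := by
        have : 2 ^ 12 ≤ p ^ 12 := Nat.pow_le_pow_left hp2 12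
        omega
      have e4 : Real.log a ≤ Real.log ((p : ℝ) ^ 12) :=
        Real.log_le_log (by exact_mod_cast (by omega : 0 < a)) (by exact_mod_cast e3)
      rw [Real.log_pow] at e4
      exact_mod_cast e4
    have e5 : (x : ℝ) * Real.log a ≤ x * (12 * Real.log p) :=
      mul_le_mul_of_nonneg_left e2 (by positivity)
    linarith only [e1, e5, h7, hln]

theorem log_sub_log_sub_one {A T : ℝ} (hT : 1 < T) (hA : T ≤ A) :
    0 ≤ Real.log A - Real.log (A - 1) ∧ Real.log A - Real.log (A - 1) ≤ 1 / (T - 1) := by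
  have h1 : 0 < A - 1 := by linarith
  refine ⟨sub_nonneg.mpr (Real.log_le_log h1 (by linarith)), ?_⟩
  rw [← Real.log_div (by linarith) h1.ne']
  calc Real.log (A / (A - 1)) ≤ A / (A - 1) - 1 :=
        Real.log_le_sub_one_of_pos (div_pos (by linarith) h1)
    _ = 1 / (A - 1) := by field_simp; ring
    _ ≤ 1 / (T - 1) := one_div_le_one_div_of_le (by linarith) (by linarith)

theorem abs_linear_form_le {a b x y m n : ℕ} (ha : 2 ≤ a) (hb : 2 ≤ b)
    (he : a ^ x * (a ^ m - 1) = b ^ y * (b ^ n - 1)) {T : ℝ} (hT : 1 < T)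
    (hm : T ≤ (a : ℝ) ^ m) (hn : T ≤ (b : ℝ) ^ n) :
    |((x + m : ℕ) : ℝ) * Real.log a - (y + n : ℕ) * Real.log b| ≤ 1 / (T - 1) := by
  have ha0 : (0 : ℝ) < a := by exact_mod_cast (by omega : 0 < a)
  have hb0 : (0 : ℝ) < b := by exact_mod_cast (by omega : 0 < b)
  have he' : (a : ℝ) ^ x * ((a : ℝ) ^ m - 1) = (b : ℝ) ^ y * ((b : ℝ) ^ n - 1) := by
    have := congrArg (Nat.cast : ℕ → ℝ) he
    rwa [Nat.cast_mul, Nat.cast_mul, Nat.cast_sub (Nat.one_le_pow _ _ (by omega)),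
      Nat.cast_sub (Nat.one_le_pow _ _ (by omega)), Nat.cast_pow, Nat.cast_pow, Nat.cast_pow,
      Nat.cast_pow, Nat.cast_one] at this
  have h := congrArg Real.log he'
  rw [Real.log_mul (by positivity) (by linarith), Real.log_mul (by positivity) (by linarith),
    Real.log_pow, Real.log_pow] at h
  have h1 := log_sub_log_sub_one hT hm
  have h2 := log_sub_log_sub_one hT hn
  rw [Real.log_pow] at h1 h2
  push_cast
  rw [abs_le]
  constructor <;> linarith only [h, h1.1, h1.2, h2.1, h2.2]

theorem one_le_exp_mul_log_sub_log {u v : ℕ} {c : ℝ} (hu : 0 < u) (huv : u < v)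
    (hv : Real.log v ≤ c) : 1 ≤ Real.exp c * (Real.log v - Real.log u) := by
  have hu' : (0 : ℝ) < u := by exact_mod_cast hu
  have hv' : (0 : ℝ) < v := by exact_mod_cast hu.trans huv
  have h1 : (u : ℝ) + 1 ≤ v := by exact_mod_cast huv
  have h2 : 1 / (v : ℝ) ≤ Real.log v - Real.log u := by
    have := Real.log_le_sub_one_of_pos (div_pos hu' hv')
    rw [Real.log_div hu'.ne' hv'.ne'] at this
    have h3 : (u : ℝ) / v + 1 / v ≤ 1 := by
      rw [← add_div, div_le_one hv']
      exact h1
    linarith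
  have h4 : (v : ℝ) ≤ Real.exp c := by rwa [← Real.log_le_iff_le_exp hv']
  calc (1 : ℝ) = v * (1 / v) := by field_simp
    _ ≤ Real.exp c * (Real.log v - Real.log u) := by gcongr

theorem one_le_exp_mul_linear_form_of_dependent {a b X Y R S N : ℕ} (ha : 2 ≤ a) (ha' : a ≤ 3600)
    (hb : 2 ≤ b) (hb' : b ≤ 3600) (hab : Nat.Coprime a b) (hX : 0 < X) (hS : 0 < S)
    (hRN : R ≤ N) (hSN : S ≤ N) (h : R * X = S * Y) :
    1 ≤ Real.exp (9.19 * N) * |X * Real.log a - Y * Real.log b| := by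
  have hla : Real.log a ≤ 8.19 := log_le_of_le_3600 (by omega) ha'
  have hlb : Real.log b ≤ 8.19 := log_le_of_le_3600 (by omega) hb'
  have hR' : (R : ℝ) ≤ N := by exact_mod_cast hRN
  have hS' : (S : ℝ) ≤ N := by exact_mod_cast hSN
  have h1 : Real.log ((a ^ S : ℕ) : ℝ) ≤ 8.19 * N := by
    rw [Nat.cast_pow, Real.log_pow]
    nlinarith only [hla, hS', Real.log_natCast_nonneg a, Nat.cast_nonneg (α := ℝ) S]
  have h2 : Real.log ((b ^ R : ℕ) : ℝ) ≤ 8.19 * N := by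
    rw [Nat.cast_pow, Real.log_pow]
    nlinarith only [hlb, hR', Real.log_natCast_nonneg b, Nat.cast_nonneg (α := ℝ) R]
  have hne : a ^ S ≠ b ^ R := fun h => by
    have h3 : Nat.Coprime (a ^ S) (b ^ R) := (hab.pow_left S).pow_right R
    rw [← h, Nat.coprime_self] at h3
    have := Nat.one_lt_pow hS.ne' (show 1 < a by omega)
    omega
  have h3 : 1 ≤ Real.exp (8.19 * N) * |S * Real.log a - R * Real.log b| := by
    rw [← Real.log_pow, ← Real.log_pow, ← Nat.cast_pow, ← Nat.cast_pow]
    rcases hne.lt_or_gt with hlt | hlt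
    · rw [abs_sub_comm]
      exact (one_le_exp_mul_log_sub_log (Nat.pow_pos (by omega)) hlt h2).trans
        (by gcongr; exact le_abs_self _)
    · exact (one_le_exp_mul_log_sub_log (Nat.pow_pos (by omega)) hlt h1).trans
        (by gcongr; exact le_abs_self _)
  have h4 : |S * Real.log a - R * Real.log b| ≤ S * |X * Real.log a - Y * Real.log b| := by
    have e : (R : ℝ) * X = S * Y := by exact_mod_cast h
    have e2 : (S : ℝ) * (X * Real.log a - Y * Real.log b) =
        X * (S * Real.log a - R * Real.log b) := by
      linear_combination Real.log b * e
    have e3 := congrArg abs e2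
    rw [abs_mul, abs_mul, Nat.abs_cast, Nat.abs_cast] at e3
    rw [e3]
    exact le_mul_of_one_le_left (abs_nonneg _) (by exact_mod_cast hX)
  have h5 : (S : ℝ) ≤ Real.exp N := hS'.trans ((lt_add_one _).le.trans (Real.add_one_le_exp _))
  calc 1 ≤ Real.exp (8.19 * N) * |S * Real.log a - R * Real.log b| := h3
    _ ≤ Real.exp (8.19 * N) * (Real.exp N * |X * Real.log a - Y * Real.log b|) := by
      gcongr
      exact h4.trans (by gcongr)
    _ = Real.exp (9.19 * N) * |X * Real.log a - Y * Real.log b| := by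
      rw [← mul_assoc, ← Real.exp_add, show (9.19 : ℝ) * N = 8.19 * N + N by ring]

/-- A lower bound for the linear form without any assumption on linear independence. -/
theorem one_le_exp_mul_linear_form_of_coprime {a b X Y l : ℕ} (ha : 2 ≤ a) (ha' : a ≤ 3600)
    (hb : 2 ≤ b) (hb' : b ≤ 3600) (hab : Nat.Coprime a b) (hX : 0 < X) (hl : 10 ≤ l)
    (hXl : X * Real.log a ≤ 4 ^ (l + 1)) (hYl : Y * Real.log b ≤ 4 ^ (l + 1))
    (hX' : (4 : ℝ) ^ l ≤ 16 * X) :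
    1 ≤ Real.exp (1904 * (2 * l + 1) ^ 2) * |X * Real.log a - Y * Real.log b| := by
  by_cases hdist : ∀ r s : ℤ, |r| ≤ 2 * (35 * l + 17) → |s| ≤ 2 * (35 * l + 17) →
      r * X + s * Y = 0 → r = 0 ∧ s = 0
  · rw [show (1904 : ℝ) * (2 * l + 1) ^ 2 = 1.6 * (1190 * (2 * l + 1) ^ 2) by ring]
    exact (one_lt_exp_mul_linear_form ha ha' hb hb' hl hXl hYl hX' hdist).le
  · push Not at hdist
    obtain ⟨r, s, hr, hs, h, hrs⟩ := hdist
    have hs0 : s ≠ 0 := by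
      rintro rfl
      refine hrs ?_ rfl
      have hX0 : (X : ℤ) ≠ 0 := by exact_mod_cast hX.ne'
      exact (mul_eq_zero.mp (by simpa using h)).resolve_right hX0
    have h1 : r.natAbs * X = s.natAbs * Y := by
      have := congrArg Int.natAbs (eq_neg_of_add_eq_zero_left h)
      simpa [Int.natAbs_mul] using this
    have h2 := one_le_exp_mul_linear_form_of_dependent (N := 2 * (35 * l + 17)) ha ha' hb hb' hab hX
      (Int.natAbs_pos.mpr hs0) (by zify; exact hr) (by zify; exact hs) h1
    refine h2.trans (mul_le_mul_of_nonneg_right (Real.exp_le_exp.mpr ?_) (abs_nonneg _))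
    have : (10 : ℝ) ≤ l := by exact_mod_cast hl
    push_cast
    nlinarith only [this]

theorem quadratic_lt_four_pow {l : ℕ} (hl : 10 ≤ l) :
    59100 + 17 * (l + 2) + 1904 * (2 * l + 1) ^ 2 < 4 ^ l := by
  induction l, hl using Nat.le_induction with
  | base => norm_num
  | succ l hl ih =>
    rw [pow_succ 4 l]
    nlinarith only [ih, hl]

theorem max_lt_of_eq {a b x y m n : ℕ} (ha : 2 ≤ a) (ha' : a ≤ 3600) (hb : 2 ≤ b)
    (hb' : b ≤ 3600) (hab : Nat.Coprime a b) (hm : 0 < m) (hn : 0 < n)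
    (he : a ^ x * (a ^ m - 1) = b ^ y * (b ^ n - 1)) (ham : 2 ^ 40 ≤ a ^ m) (hbn : 2 ^ 40 ≤ b ^ n) :
    max ((x + m : ℕ) * Real.log a) ((y + n : ℕ) * Real.log b) < 2 ^ 20 := by
  by_contra! hZ
  obtain ⟨Z, hZe⟩ : ∃ Z, Z = max ((x + m : ℕ) * Real.log a) ((y + n : ℕ) * Real.log b) := ⟨_, rfl⟩
  rw [← hZe] at hZ
  obtain ⟨l, hl1, hl2⟩ := exists_nat_pow_near (x := Z) (y := 4) (by linarith) (by norm_num)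
  have hl : 10 ≤ l := by
    have h1 : (4 : ℝ) ^ 10 < 4 ^ (l + 1) := lt_of_le_of_lt (by linarith) hl2
    have := (pow_lt_pow_iff_right₀ (by norm_num : (1 : ℝ) < 4)).mp h1
    omega
  have ha2 : (2 : ℝ) ≤ a := by exact_mod_cast ha
  have hb2 : (2 : ℝ) ≤ b := by exact_mod_cast hb
  have hla : Real.log a ≤ 8.19 := log_le_of_le_3600 (by omega) ha'
  have hla' : 0.69 ≤ Real.log a :=
    (by linarith [Real.log_two_gt_d9] : (0.69 : ℝ) ≤ Real.log 2).trans
      (Real.log_le_log (by norm_num) ha2)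
  have hlb' : 0.69 ≤ Real.log b :=
    (by linarith [Real.log_two_gt_d9] : (0.69 : ℝ) ≤ Real.log 2).trans
      (Real.log_le_log (by norm_num) hb2)
  have hXZ : (x + m : ℕ) * Real.log a ≤ Z := hZe ▸ le_max_left _ _
  have hYZ : (y + n : ℕ) * Real.log b ≤ Z := hZe ▸ le_max_right _ _
  have ham' : (2 : ℝ) ^ 40 ≤ (a : ℝ) ^ m := by exact_mod_cast ham
  have hbn' : (2 : ℝ) ^ 40 ≤ (b : ℝ) ^ n := by exact_mod_cast hbn
  obtain ⟨t, ht⟩ : ∃ t, t = min (m * Real.log a) (n * Real.log b) := ⟨_, rfl⟩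
  have hmexp : (a : ℝ) ^ m = Real.exp (m * Real.log a) := by
    rw [mul_comm, Real.exp_mul, Real.exp_log (by linarith), Real.rpow_natCast]
  have hnexp : (b : ℝ) ^ n = Real.exp (n * Real.log b) := by
    rw [mul_comm, Real.exp_mul, Real.exp_log (by linarith), Real.rpow_natCast]
  have htm : Real.exp t ≤ (a : ℝ) ^ m := hmexp ▸ Real.exp_le_exp.mpr (ht ▸ min_le_left _ _)
  have htn : Real.exp t ≤ (b : ℝ) ^ n := hnexp ▸ Real.exp_le_exp.mpr (ht ▸ min_le_right _ _)
  have ht40 : 2 ^ 40 ≤ Real.exp t := by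
    rcases min_choice (m * Real.log a) (n * Real.log b) with h | h
    · rwa [ht, h, ← hmexp]
    · rwa [ht, h, ← hnexp]
  obtain ⟨Λ, hΛe⟩ : ∃ Λ, Λ = (x + m : ℕ) * Real.log a - (y + n : ℕ) * Real.log b := ⟨_, rfl⟩
  have hΛ : |Λ| ≤ 1 / (Real.exp t - 1) := hΛe ▸ abs_linear_form_le ha hb he (by linarith) htm htn
  rw [le_div_iff₀ (by linarith)] at hΛ
  have hΛ1 : |Λ| ≤ 1 := by nlinarith only [hΛ, ht40, abs_nonneg Λ]
  have hΛ2 : |Λ| * Real.exp t ≤ 2 := by linarith only [hΛ, hΛ1]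
  have hXZ' : Z - 1 ≤ (x + m : ℕ) * Real.log a := by
    have := abs_le.mp hΛ1
    rcases max_choice ((x + m : ℕ) * Real.log a) ((y + n : ℕ) * Real.log b) with h | h <;>
      rw [h] at hZe <;> linarith only [this.1, this.2, hΛe, hZe]
  have hYZ' : Z - 1 ≤ (y + n : ℕ) * Real.log b := by
    have := abs_le.mp hΛ1
    rcases max_choice ((x + m : ℕ) * Real.log a) ((y + n : ℕ) * Real.log b) with h | h <;>
      rw [h] at hZe <;> linarith only [this.1, this.2, hΛe, hZe]
  have hlog : ∀ {k i : ℕ} {c : ℝ}, 0.69 ≤ c → ((i + k : ℕ) : ℝ) * c ≤ Z → 0 < k →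
      Real.log k ≤ 1.4 * (l + 2) := by
    intro k i c hc hk hk0
    have h1 : (k : ℝ) ≤ 4 ^ (l + 2) := by
      have h2 : (k : ℝ) * 0.69 ≤ (i + k : ℕ) * c := by
        have : (k : ℝ) ≤ (i + k : ℕ) := by exact_mod_cast Nat.le_add_left k i
        gcongr
      rw [pow_succ]
      linarith only [h2, hk, hl2, pow_pos (show (0 : ℝ) < 4 by norm_num) (l + 1)]
    have h3 := Real.log_le_log (by exact_mod_cast hk0) h1
    rw [show (4 : ℝ) = 2 ^ 2 by norm_num, ← pow_mul, Real.log_pow] at h3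
    push_cast at h3
    have : (0 : ℝ) ≤ l := Nat.cast_nonneg l
    nlinarith only [h3, this, Real.log_two_lt_d9]
  have hx := mul_log_le ha ha' hb hb' hab hn (he ▸ dvd_mul_right (a ^ x) _)
  have hy := mul_log_le hb hb' ha ha' hab.symm hm (he ▸ dvd_mul_right (b ^ y) _)
  have hlm := hlog hla' hXZ hm
  have hln := hlog hlb' hYZ hn
  have htZ : Z - 59001 - 17 * (l + 2) ≤ t := by
    push_cast at hXZ' hYZ'
    have hl0 : (0 : ℝ) ≤ l := Nat.cast_nonneg l
    rw [ht]
    refine le_min ?_ ?_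
    · linarith only [hXZ', hx, hln, hl0]
    · linarith only [hYZ', hy, hlm, hl0]
  have hlow : 1 ≤ Real.exp (1904 * (2 * l + 1) ^ 2) * |Λ| := by
    rw [hΛe]
    refine one_le_exp_mul_linear_form_of_coprime ha ha' hb hb' hab (by omega) hl
      (hXZ.trans hl2.le) (hYZ.trans hl2.le) ?_
    have h1 : ((x + m : ℕ) : ℝ) * Real.log a ≤ (x + m : ℕ) * 8.19 := by gcongr
    linarith only [h1, hXZ', hl1, hZ]
  have htK : t ≤ 1904 * (2 * l + 1) ^ 2 + 1 := by
    rw [← Real.exp_le_exp, Real.exp_add]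
    have h1 : 2 ≤ Real.exp 1 := by linarith [Real.exp_one_gt_d9]
    calc Real.exp t = 1 * Real.exp t := (one_mul _).symm
      _ ≤ Real.exp (1904 * (2 * l + 1) ^ 2) * |Λ| * Real.exp t := by gcongr
      _ = Real.exp (1904 * (2 * l + 1) ^ 2) * (|Λ| * Real.exp t) := mul_assoc _ _ _
      _ ≤ Real.exp (1904 * (2 * l + 1) ^ 2) * Real.exp 1 := by gcongr; exact hΛ2.trans h1
  have hfin : (59100 + 17 * (l + 2) + 1904 * (2 * l + 1) ^ 2 : ℝ) < 4 ^ l := by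
    exact_mod_cast quadratic_lt_four_pow hl
  linarith only [hfin, htK, htZ, hl1]

theorem false_of_two_pow_le {a b x y m n : ℕ} (ha : 2 ≤ a) (ha' : a ≤ 3600) (hb : 2 ≤ b)
    (hb' : b ≤ 3600) (hab : Nat.Coprime a b) (hpa : isPow a = false) (hpb : isPow b = false)
    (hm : 0 < m) (hn : 0 < n) (he : a ^ x * (a ^ m - 1) = b ^ y * (b ^ n - 1))
    (ham : 2 ^ 40 ≤ a ^ m) (hbn : 2 ^ 40 ≤ b ^ n) : False := by
  have hmax := max_lt_of_eq ha ha' hb hb' hab hm hn he ham hbn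
  obtain ⟨hX, hY⟩ := max_lt_iff.mp hmax
  have hΛ := abs_linear_form_le (T := 2 ^ 40) ha hb he (by norm_num) (by exact_mod_cast ham)
    (by exact_mod_cast hbn)
  refine (le_mul_log_of_abs_sub_lt ha ha' hb hb' hab hpa hpb (X := x + m) (Y := y + n) (by omega)
    (by omega) ?_).elim (not_le.mpr hX) (not_le.mpr hY)
  generalize x + m = X at *
  generalize y + n = Y at *
  have hbound : ∀ {c Z : ℕ}, 2 ≤ c → (Z : ℝ) * Real.log c < 2 ^ 20 → (Z : ℝ) ≤ 1513000 := by
    intro c Z hc hZ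
    have h1 : Real.log 2 ≤ Real.log c := Real.log_le_log (by norm_num) (by exact_mod_cast hc)
    have h2 : (Z : ℝ) * 0.6931471803 ≤ Z * Real.log c := by
      gcongr
      linarith [Real.log_two_gt_d9]
    linarith only [h2, hZ]
  have hX' := hbound ha hX
  have hY' := hbound hb hY
  have hta := tlog_bounds (by omega : 1 ≤ a) ha'
  have htb := tlog_bounds (by omega : 1 ≤ b) hb'
  have hX0 : (0 : ℝ) ≤ X := Nat.cast_nonneg X
  have hY0 : (0 : ℝ) ≤ Y := Nat.cast_nonneg Y
  have a1 := mul_le_mul_of_nonneg_left hta.1 hX0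
  have a2 := mul_le_mul_of_nonneg_left hta.2 hX0
  have b1 := mul_le_mul_of_nonneg_left htb.1 hY0
  have b2 := mul_le_mul_of_nonneg_left htb.2 hY0
  rw [abs_le] at hΛ
  rw [slack_eq]
  have : |(X : ℝ) * tlog a - Y * tlog b| < 2700000 := by
    rw [abs_lt]
    norm_num at hΛ
    constructor <;> linarith only [a1, a2, b1, b2, hΛ.1, hΛ.2, hX', hY', hX0, hY0]
  exact_mod_cast this

theorem isExceptional_of_eq {a b x y m n r : ℕ} (ha : 2 ≤ a) (ha' : a ≤ 3600) (hb : 2 ≤ b)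
    (hb' : b ≤ 3600) (hab : Nat.Coprime a b) (hpa : isPow a = false) (hpb : isPow b = false)
    (hx : 0 < x) (hy : 0 < y) (hm : 0 < m) (hn : 0 < n)
    (he : a ^ x * (a ^ m - 1) = b ^ y * (b ^ n - 1)) (hr : 0 < r) (h : a ^ x = b ^ y + r) :
    IsExceptional a b r := by
  rcases le_or_gt (a ^ m) (2 ^ 40) with ham | ham
  · exact (isExceptional_of_pow_le ha ha' hb hb' hab hpa hpb hx hy hm hn ham he hr).1 h
  rcases le_or_gt (b ^ n) (2 ^ 40) with hbn | hbn
  · exact (isExceptional_of_pow_le hb hb' ha ha' hab.symm hpb hpa hy hx hn hm hbn he.symm hr).2 h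
  · exact (false_of_two_pow_le ha ha' hb hb' hab hpa hpb hm hn he ham.le hbn.le).elim

theorem isExceptional_of_lt {a b x₁ y₁ x₂ y₂ r : ℕ} (ha : 2 ≤ a) (ha' : a ≤ 3600) (hb : 2 ≤ b)
    (hb' : b ≤ 3600) (hab : Nat.Coprime a b) (hpa : isPow a = false) (hpb : isPow b = false)
    (hx : 0 < x₁) (hy : 0 < y₁) (hr : 0 < r) (h₁ : a ^ x₁ = b ^ y₁ + r) (h₂ : a ^ x₂ = b ^ y₂ + r)
    (hlt : x₁ < x₂) : IsExceptional a b r := by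
  have h3 : a ^ x₁ < a ^ x₂ := Nat.pow_lt_pow_right (by omega) hlt
  have h4 : y₁ < y₂ := (Nat.pow_lt_pow_iff_right (show 1 < b by omega)).mp (by omega)
  obtain ⟨m, rfl⟩ := Nat.exists_eq_add_of_lt hlt
  obtain ⟨n, rfl⟩ := Nat.exists_eq_add_of_lt h4
  refine isExceptional_of_eq (m := m + 1) (n := n + 1) ha ha' hb hb' hab hpa hpb hx hy m.succ_pos
    n.succ_pos ?_ hr h₁
  rw [Nat.mul_sub, Nat.mul_sub, ← pow_add, ← pow_add, mul_one, mul_one, ← add_assoc, ← add_assoc]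
  omega

theorem isPow_eq_false {n : ℕ} (h : ¬ ∃ m k : ℕ, 1 ≤ m ∧ 2 ≤ k ∧ n = m ^ k) : isPow n = false := by
  rw [← Bool.not_eq_true]
  exact fun h' => h (exists_pow_of_isPow h')

end Pillai

theorem pillai_at_most_one_solution
    (a b : ℕ) (ha : 2 ≤ a) (ha' : a ≤ 3600) (hb : 2 ≤ b) (hb' : b ≤ 3600)
    (hab : Nat.Coprime a b)
    (hpa : ¬ ∃ m k : ℕ, 1 ≤ m ∧ 2 ≤ k ∧ a = m ^ k)
    (hpb : ¬ ∃ m k : ℕ, 1 ≤ m ∧ 2 ≤ k ∧ b = m ^ k)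
    (r : ℕ) (hr : 0 < r)
    (hexc : (a, b, r) ∉ ({(3, 2, 1), (2, 3, 5), (2, 3, 13), (2, 5, 3), (13, 3, 10),
      (91, 2, 89)} : Set (ℕ × ℕ × ℕ))) :
    ∀ x₁ y₁ x₂ y₂ : ℕ, 0 < x₁ → 0 < y₁ → 0 < x₂ → 0 < y₂ →
      a ^ x₁ = b ^ y₁ + r → a ^ x₂ = b ^ y₂ + r → (x₁, y₁) = (x₂, y₂) := by
  intro x₁ y₁ x₂ y₂ hx₁ hy₁ hx₂ hy₂ h₁ h₂
  have hpa' := Pillai.isPow_eq_false hpa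
  have hpb' := Pillai.isPow_eq_false hpb
  rcases lt_trichotomy x₁ x₂ with h | rfl | h
  · exact absurd (Pillai.isExceptional_of_lt ha ha' hb hb' hab hpa' hpb' hx₁ hy₁ hr h₁ h₂ h) hexc
  · have : b ^ y₁ = b ^ y₂ := by omega
    rw [Nat.pow_right_injective hb this]
  · exact absurd (Pillai.isExceptional_of_lt ha ha' hb hb' hab hpa' hpb' hx₂ hy₂ hr h₂ h₁ h) hexc
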